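/- For every ε > 0 there exists a constant C > 0 (depending on ε, a and f) such that for all real numbers V ≥ U ≥ 1, Σ_{|u| ≤ U} Σ_{|v| ≤ V, F(u,v) ≠ 0} ϖ(|F(u,v)|) ≤ C·(U·V·(1 + log V)^{ρ−2} + V^{1+ε}), where the sums are over integers u, v in the indicated ranges. -/

import Mathlib

/-- The binary quartic form `F(u,v) = v⁴·f(u/v)`, the degree-4 homogenization of `f`. -/
noncomputable def binQuartic (f : Polynomial ℤ) (u v : ℤ) : ℤ :=
  ∑ i ∈ Finset.range 5, f.coeff i * u ^ i * v ^ (4 - i)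

open Classical in
/-- `χ_a(p)`: the Legendre symbol `(a/p)` for an odd prime `p`, with `χ_a(2) = 0`. -/
noncomputable def chiA (a : ℤ) (p : ℕ) : ℝ :=
  if p = 2 then 0
  else if (a : ZMod p) = 0 then 0
  else if IsSquare ((a : ZMod p)) then 1 else -1

/-- `ϑ(n) = ∏_{p ∥ n} (1 + χ_a(p))/2`, the product over primes dividing `n` exactly once. -/
noncomputable def thetaA (a : ℤ) (n : ℕ) : ℝ :=
  ∏ p ∈ n.primeFactors.filter (fun p => ¬ p ^ 2 ∣ n), (1 + chiA a p) / 2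

/-- `ϖ(n) = 2^{ω(n)} ϑ(n)`. -/
noncomputable def varpiA (a : ℤ) (n : ℕ) : ℝ :=
  2 ^ n.primeFactors.card * thetaA a n

section

open Finset

/-- The primes up to `n`. -/
def primesUpTo (n : ℕ) : Finset ℕ := (Finset.range (n + 1)).filter Nat.Prime

theorem mem_primesUpTo {n p : ℕ} : p ∈ primesUpTo n ↔ p ≤ n ∧ p.Prime := by
  simp [primesUpTo]

theorem sum_log_primeFactors_le_log {m : ℕ} (hm : m ≠ 0) :
    ∑ p ∈ m.primeFactors, Real.log p ≤ Real.log m := by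
  rw [← Real.log_prod (fun p hp => by
    have := (Nat.prime_of_mem_primeFactors hp).pos
    positivity)]
  apply Real.log_le_log
  · exact Finset.prod_pos fun p hp => by
      have := (Nat.prime_of_mem_primeFactors hp).pos
      positivity
  · have := Nat.le_of_dvd (Nat.pos_of_ne_zero hm) (Nat.prod_primeFactors_dvd m)
    rw [← Nat.cast_prod]
    exact_mod_cast this

theorem sum_log_primesUpTo_le (n : ℕ) :
    ∑ p ∈ primesUpTo n, Real.log p ≤ Real.log 4 * n := by
  have h := Chebyshev.theta_le_log4_mul_x (x := n) (by positivity)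
  refine le_trans (le_of_eq ?_) h
  rw [Chebyshev.theta_eq_sum_Icc, Nat.floor_natCast]
  apply Finset.sum_congr _ fun _ _ => rfl
  ext p
  simp [mem_primesUpTo]

/-- Mertens' first theorem, upper bound. -/
theorem sum_log_div_le {n : ℕ} (hn : 1 ≤ n) :
    ∑ p ∈ primesUpTo n, Real.log p / p ≤ Real.log n + Real.log 4 := by
  have hn0 : (0 : ℝ) < n := by exact_mod_cast hn
  have h1 : ∑ p ∈ primesUpTo n, Real.log p * ((n / p : ℕ) : ℝ) ≤ n * Real.log n := by
    calc ∑ p ∈ primesUpTo n, Real.log p * ((n / p : ℕ) : ℝ)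
        = ∑ p ∈ primesUpTo n, ∑ m ∈ Finset.Ioc 0 n, if p ∣ m then Real.log p else 0 := by
          refine Finset.sum_congr rfl fun p hp => ?_
          rw [← Finset.sum_filter, Finset.sum_const, Nat.Ioc_filter_dvd_card_eq_div, nsmul_eq_mul,
            mul_comm]
      _ = ∑ m ∈ Finset.Ioc 0 n, ∑ p ∈ primesUpTo n, if p ∣ m then Real.log p else 0 :=
          Finset.sum_comm
      _ ≤ ∑ m ∈ Finset.Ioc 0 n, Real.log n := by
          refine Finset.sum_le_sum fun m hm => ?_
          rw [Finset.mem_Ioc] at hm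
          rw [← Finset.sum_filter]
          have : (primesUpTo n).filter (fun p => p ∣ m) = m.primeFactors := by
            ext p
            simp only [Finset.mem_filter, mem_primesUpTo, Nat.mem_primeFactors]
            constructor
            · rintro ⟨⟨h1, h2⟩, h3⟩
              exact ⟨h2, h3, by omega⟩
            · rintro ⟨h1, h2, h3⟩
              exact ⟨⟨(Nat.le_of_dvd hm.1 h2).trans hm.2, h1⟩, h2⟩
          rw [this]
          refine (sum_log_primeFactors_le_log (by omega)).trans ?_
          exact Real.log_le_log (by exact_mod_cast hm.1) (by exact_mod_cast hm.2)
      _ = n * Real.log n := by simp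
  have h2 : ∀ p ∈ primesUpTo n,
      n * (Real.log p / p) - Real.log p ≤ Real.log p * ((n / p : ℕ) : ℝ) := by
    intro p hp
    have hp1 := (mem_primesUpTo.1 hp).2
    have hlog : 0 ≤ Real.log p := Real.log_natCast_nonneg p
    have hp0 : (0 : ℝ) < p := by exact_mod_cast hp1.pos
    have : (n : ℝ) / p - 1 ≤ ((n / p : ℕ) : ℝ) := by
      rw [← Nat.floor_div_eq_div (K := ℝ)]
      exact (Nat.sub_one_lt_floor _).le
    calc n * (Real.log p / p) - Real.log p = Real.log p * (n / p - 1) := by field_simp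
      _ ≤ _ := mul_le_mul_of_nonneg_left this hlog
  have h3 := Finset.sum_le_sum h2
  rw [Finset.sum_sub_distrib, ← Finset.mul_sum] at h3
  have h4 := sum_log_primesUpTo_le n
  have h5 : n * ∑ p ∈ primesUpTo n, Real.log p / p ≤ n * (Real.log n + Real.log 4) := by
    linarith
  exact le_of_mul_le_mul_left h5 hn0

theorem sum_log_div_le_mul_log {n : ℕ} (hn : 2 ≤ n) :
    ∑ p ∈ primesUpTo n, Real.log p / p ≤ 3 * Real.log n := by
  have h := sum_log_div_le (n := n) (by omega)
  have h4 : Real.log 4 = 2 * Real.log 2 := by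
    rw [show (4 : ℝ) = 2 ^ 2 by norm_num, Real.log_pow]; norm_num
  have h2 : Real.log 2 ≤ Real.log n := Real.log_le_log (by norm_num) (by exact_mod_cast hn)
  linarith

theorem sum_primes_inv_sq_le (s : Finset ℕ) (hs : ∀ p ∈ s, p.Prime) :
    ∑ p ∈ s, 1 / (p : ℝ) ^ 2 ≤ 2 := by
  by_cases hne : s = ∅
  · simp [hne]
  have hsub : s ⊆ Finset.Ioc 1 (s.sup id) := by
    intro p hp
    rw [Finset.mem_Ioc]
    exact ⟨(hs p hp).one_lt, Finset.le_sup (f := id) hp⟩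
  refine (Finset.sum_le_sum_of_subset_of_nonneg hsub fun _ _ _ => by positivity).trans ?_
  have h := sum_Ioc_inv_sq_le_sub (α := ℝ) (k := 1) (n := s.sup id) (by norm_num) (by
    obtain ⟨p, hp⟩ := Finset.nonempty_iff_ne_empty.2 hne
    exact ((hs p hp).one_le).trans (Finset.le_sup (f := id) hp))
  simp only [one_div]
  refine h.trans ?_
  have : (0 : ℝ) ≤ ((s.sup id : ℕ) : ℝ)⁻¹ := by positivity
  norm_num
  linarith

/-- The part of the prime zeta series at `1 + 1 / log y` beyond `y` is bounded. -/
theorem sum_rpow_tail_le {y : ℕ} (hy : 2 ≤ y) (s : Finset ℕ) (hs : ∀ p ∈ s, p.Prime ∧ y < p) :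
    ∑ p ∈ s, (p : ℝ) ^ (-(1 + 1 / Real.log y)) ≤ 12 := by
  have hy0 : (0 : ℝ) < y := by positivity
  have hL : 0 < Real.log y := Real.log_pos (by exact_mod_cast hy)
  set J : ℕ → ℕ := fun p => ⌊Real.log p / Real.log y⌋₊ with hJ
  have hfib : ∑ p ∈ s, (p : ℝ) ^ (-(1 + 1 / Real.log y)) =
      ∑ j ∈ s.image J, ∑ p ∈ s with J p = j, (p : ℝ) ^ (-(1 + 1 / Real.log y)) :=
    (Finset.sum_fiberwise_of_maps_to (fun p hp => Finset.mem_image_of_mem J hp) _).symm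
  rw [hfib]
  have hblock : ∀ j ∈ s.image J, ∑ p ∈ s with J p = j, (p : ℝ) ^ (-(1 + 1 / Real.log y))
      ≤ 6 * (1 / 2 : ℝ) ^ j := by
    intro j hj
    have hj1 : 1 ≤ j := by
      obtain ⟨p, hp, rfl⟩ := Finset.mem_image.1 hj
      apply Nat.le_floor
      rw [Nat.cast_one, le_div_iff₀ hL, one_mul]
      exact Real.log_le_log hy0 (by exact_mod_cast (hs p hp).2.le)
    have hj1' : (1 : ℝ) ≤ j := by exact_mod_cast hj1
    have hterm : ∀ p ∈ s.filter (fun p => J p = j), (p : ℝ) ^ (-(1 + 1 / Real.log y))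
        ≤ (Real.exp (-(j : ℝ)) / (j * Real.log y)) * (Real.log p / p) := by
      intro p hp
      obtain ⟨hps, hpj⟩ := Finset.mem_filter.1 hp
      have hp0 : (0 : ℝ) < p := by exact_mod_cast (hs p hps).1.pos
      have hlow : (j : ℝ) * Real.log y ≤ Real.log p := by
        rw [← le_div_iff₀ hL, ← hpj]
        exact Nat.floor_le (div_nonneg (Real.log_natCast_nonneg p) hL.le)
      have e1 : (p : ℝ) ^ (-(1 + 1 / Real.log y)) = Real.exp (-(Real.log p / Real.log y)) / p := by
        rw [neg_add, Real.rpow_add hp0, Real.rpow_neg_one, Real.rpow_def_of_pos hp0]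
        rw [div_eq_mul_inv (Real.exp _), mul_comm]
        congr 2
        ring
      rw [e1]
      have e2 : Real.exp (-(Real.log p / Real.log y)) ≤ Real.exp (-(j : ℝ)) := by
        apply Real.exp_le_exp.2
        rw [neg_le_neg_iff, le_div_iff₀ hL]
        exact hlow
      have e3 : 1 ≤ Real.log p / (j * Real.log y) := by
        rw [le_div_iff₀ (by positivity), one_mul]; exact hlow
      calc Real.exp (-(Real.log p / Real.log y)) / p ≤ Real.exp (-(j : ℝ)) / p := by gcongr
        _ = Real.exp (-(j : ℝ)) / p * 1 := by ring
        _ ≤ Real.exp (-(j : ℝ)) / p * (Real.log p / (j * Real.log y)) := by gcongr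
        _ = _ := by ring
    refine (Finset.sum_le_sum hterm).trans ?_
    rw [← Finset.mul_sum]
    have hsub : s.filter (fun p => J p = j) ⊆ primesUpTo (y ^ (j + 1)) := by
      intro p hp
      obtain ⟨hps, hpj⟩ := Finset.mem_filter.1 hp
      rw [mem_primesUpTo]
      refine ⟨?_, (hs p hps).1⟩
      have hp0 : (0 : ℝ) < p := by exact_mod_cast (hs p hps).1.pos
      have h1 : Real.log p / Real.log y < j + 1 := by
        rw [← hpj]; exact Nat.lt_floor_add_one _
      rw [div_lt_iff₀ hL] at h1
      have h2 : Real.log p ≤ Real.log ((y : ℝ) ^ (j + 1)) := by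
        rw [Real.log_pow]; push_cast; exact h1.le
      have h3 := (Real.log_le_log_iff hp0 (by positivity)).1 h2
      exact_mod_cast h3
    have hsum : ∑ p ∈ s with J p = j, Real.log p / p ≤ 3 * ((j + 1) * Real.log y) := by
      refine (Finset.sum_le_sum_of_subset_of_nonneg hsub fun p _ _ =>
        div_nonneg (Real.log_natCast_nonneg p) (by positivity)).trans ?_
      refine (sum_log_div_le_mul_log (hy.trans (Nat.le_self_pow (by omega) y))).trans ?_
      push_cast
      rw [Real.log_pow]
      push_cast
      exact le_rfl
    have hexp : Real.exp (-(j : ℝ)) ≤ (1 / 2 : ℝ) ^ j := by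
      rw [Real.exp_neg, ← one_div, one_div_pow]
      apply one_div_le_one_div_of_le (by positivity)
      have h2 : (2 : ℝ) ≤ Real.exp 1 := by
        have := Real.add_one_le_exp (1 : ℝ); linarith
      calc (2 : ℝ) ^ j ≤ Real.exp 1 ^ j := by gcongr
        _ = Real.exp j := by rw [← Real.exp_nat_mul, mul_one]
    calc Real.exp (-(j : ℝ)) / (j * Real.log y) * ∑ p ∈ s with J p = j, Real.log p / p
        ≤ Real.exp (-(j : ℝ)) / (j * Real.log y) * (3 * ((j + 1) * Real.log y)) := by gcongr
      _ = Real.exp (-(j : ℝ)) * (3 * ((j + 1) / j)) := by field_simp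
      _ ≤ (1 / 2 : ℝ) ^ j * (3 * 2) := by
          gcongr
          rw [div_le_iff₀ (by positivity)]
          linarith
      _ = _ := by ring
  refine (Finset.sum_le_sum hblock).trans ?_
  rw [← Finset.mul_sum]
  have hg : ∑ j ∈ s.image J, (1 / 2 : ℝ) ^ j ≤ 2 := by
    have h := summable_geometric_two.sum_le_tsum (s.image J) fun _ _ => by positivity
    rwa [tsum_geometric_two] at h
  linarith

/-- `G` depends only on its arguments modulo `q`. -/
def PeriodicMod (q : ℕ) (G : ℤ → ℤ → ℝ) : Prop :=
  ∀ u u' v v' : ℤ, u ≡ u' [ZMOD q] → v ≡ v' [ZMOD q] → G u v = G u' v'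

/-- The mean of `G` over a complete system of residues modulo `q`. -/
noncomputable def residueMean (q : ℕ) (G : ℤ → ℤ → ℝ) : ℝ :=
  (∑ u ∈ Finset.range q, ∑ v ∈ Finset.range q, G u v) / (q : ℝ) ^ 2

/-- The integer points of the box `|u| ≤ M`, `|v| ≤ N`. -/
noncomputable def intBox (M N : ℕ) : Finset (ℤ × ℤ) :=
  Finset.Icc (-(M : ℤ)) M ×ˢ Finset.Icc (-(N : ℤ)) N

theorem card_intBox (M N : ℕ) : (intBox M N).card = (2 * M + 1) * (2 * N + 1) := by
  simp only [intBox, Finset.card_product, Int.card_Icc]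
  congr 1 <;> omega

theorem sum_shift_eq_of_periodic {q : ℕ} {f : ℤ → ℝ} (hf : ∀ x, f (x + q) = f x) (s : ℤ) :
    ∑ i ∈ Finset.range q, f (s + i) = ∑ i ∈ Finset.range q, f i := by
  have step : ∀ s : ℤ, ∑ i ∈ Finset.range q, f (s + 1 + i) = ∑ i ∈ Finset.range q, f (s + i) := by
    intro s
    have h1 := Finset.sum_range_succ (fun i : ℕ => f (s + i)) q
    have h2 := Finset.sum_range_succ' (fun i : ℕ => f (s + i)) q
    rw [h1] at h2
    simp only [Nat.cast_zero, add_zero, hf] at h2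
    have h3 := add_right_cancel h2
    rw [h3]
    refine Finset.sum_congr rfl fun i _ => ?_
    push_cast
    ring_nf
  induction s using Int.induction_on with
  | zero => simp
  | succ n ih => rw [step, ih]
  | pred n ih =>
    rw [← ih, ← step (-n - 1)]
    simp

theorem abs_sum_range_sub_le {q : ℕ} (hq : 0 < q) {f : ℤ → ℝ} (hf : ∀ x, f (x + q) = f x)
    (hb : ∀ x, |f x| ≤ 1) (s : ℤ) (n : ℕ) :
    |∑ i ∈ Finset.range n, f (s + i) - n / q * ∑ i ∈ Finset.range q, f i| ≤ 2 * q := by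
  have hq' : (0 : ℝ) < q := by exact_mod_cast hq
  have hmul : ∀ k : ℕ, ∑ i ∈ Finset.range (q * k), f (s + i)
      = k * ∑ i ∈ Finset.range q, f i := by
    intro k
    induction k with
    | zero => simp
    | succ k ih =>
      rw [Nat.mul_succ, Finset.sum_range_add, ih]
      have : ∑ x ∈ Finset.range q, f (s + ((q * k + x : ℕ) : ℤ))
          = ∑ i ∈ Finset.range q, f i := by
        rw [← sum_shift_eq_of_periodic hf (s + q * k)]
        refine Finset.sum_congr rfl fun i _ => ?_
        push_cast
        ring_nf
      rw [this]
      push_cast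
      ring
  have habs : ∀ (t : ℤ) (m : ℕ), |∑ i ∈ Finset.range m, f (t + i)| ≤ m := by
    intro t m
    refine (Finset.abs_sum_le_sum_abs _ _).trans ?_
    refine (Finset.sum_le_sum fun i _ => hb _).trans ?_
    simp
  have hdm := Nat.div_add_mod n q
  set k := n / q
  set r := n % q
  have hr : r ≤ q := (Nat.mod_lt n hq).le
  have hr' : (r : ℝ) ≤ q := by exact_mod_cast hr
  have hn : (n : ℝ) = q * k + r := by exact_mod_cast hdm.symm
  have hsplit : ∑ i ∈ Finset.range n, f (s + i) = k * ∑ i ∈ Finset.range q, f i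
      + ∑ i ∈ Finset.range r, f (s + q * k + i) := by
    rw [← hdm, Finset.sum_range_add, hmul]
    congr 1
    refine Finset.sum_congr rfl fun i _ => ?_
    push_cast
    ring_nf
  have e : ∑ i ∈ Finset.range n, f (s + i) - n / q * ∑ i ∈ Finset.range q, f i
      = ∑ i ∈ Finset.range r, f (s + q * k + i) - r / q * ∑ i ∈ Finset.range q, f i := by
    rw [hsplit, hn]
    field_simp
    ring
  rw [e]
  refine (abs_sub _ _).trans ?_
  have h1 := habs (s + q * k) r
  have h2 := habs 0 q
  simp only [zero_add] at h2
  rw [abs_mul, abs_of_nonneg (by positivity : (0 : ℝ) ≤ r / q)]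
  have h3 : (r : ℝ) / q * |∑ i ∈ Finset.range q, f i| ≤ r / q * q := by gcongr
  rw [div_mul_cancel₀ _ hq'.ne'] at h3
  linarith

theorem abs_sum_Icc_sub_le {q : ℕ} (hq : 0 < q) {f : ℤ → ℝ} (hf : ∀ x, f (x + q) = f x)
    (hb : ∀ x, |f x| ≤ 1) (M : ℕ) :
    |∑ x ∈ Finset.Icc (-(M : ℤ)) M, f x - (2 * M + 1) / q * ∑ i ∈ Finset.range q, f i|
      ≤ 2 * q := by
  have h := abs_sum_range_sub_le hq hf hb (-(M : ℤ)) (2 * M + 1)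
  have e : ∑ x ∈ Finset.Icc (-(M : ℤ)) M, f x
      = ∑ i ∈ Finset.range (2 * M + 1), f (-(M : ℤ) + i) := by
    symm
    refine Finset.sum_bij (fun i _ => -(M : ℤ) + i) ?_ ?_ ?_ ?_
    · intro i hi
      simp only [Finset.mem_range] at hi
      simp only [Finset.mem_Icc]
      omega
    · intro i _ j _ hij
      simpa using hij
    · intro x hx
      simp only [Finset.mem_Icc] at hx
      exact ⟨(x + M).toNat, by simp only [Finset.mem_range]; omega, by omega⟩
    · intro _ _
      rfl
  rw [e]
  push_cast at h
  exact h

theorem PeriodicMod.add_left {q : ℕ} {G : ℤ → ℤ → ℝ} (h : PeriodicMod q G) (u v : ℤ) :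
    G (u + q) v = G u v :=
  h _ _ _ _ (by simp [Int.ModEq]) rfl

theorem PeriodicMod.add_right {q : ℕ} {G : ℤ → ℤ → ℝ} (h : PeriodicMod q G) (u v : ℤ) :
    G u (v + q) = G u v :=
  h _ _ _ _ rfl (by simp [Int.ModEq])

theorem abs_sum_intBox_sub_le {q : ℕ} (hq : 0 < q) {G : ℤ → ℤ → ℝ} (hG : PeriodicMod q G)
    (hb : ∀ u v, |G u v| ≤ 1) (M N : ℕ) :
    |∑ x ∈ intBox M N, G x.1 x.2 - (2 * M + 1) * (2 * N + 1) * residueMean q G|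
      ≤ 4 * q * (M + N + 1) := by
  have hq' : (0 : ℝ) < q := by exact_mod_cast hq
  rw [intBox, Finset.sum_product]
  have h1 : |∑ u ∈ Finset.Icc (-(M : ℤ)) M, ∑ v ∈ Finset.Icc (-(N : ℤ)) N, G u v
      - ∑ u ∈ Finset.Icc (-(M : ℤ)) M, (2 * N + 1) / q * ∑ v ∈ Finset.range q, G u v|
      ≤ (2 * M + 1) * (2 * q) := by
    rw [← Finset.sum_sub_distrib]
    refine (Finset.abs_sum_le_sum_abs _ _).trans ?_
    refine (Finset.sum_le_sum fun u _ =>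
      abs_sum_Icc_sub_le hq (fun x => hG.add_right u x) (hb u) N).trans ?_
    rw [Finset.sum_const, Int.card_Icc, nsmul_eq_mul]
    have : ((M : ℤ) + 1 - -(M : ℤ)).toNat = 2 * M + 1 := by omega
    rw [this]
    push_cast
    exact le_rfl
  have h2 : |∑ u ∈ Finset.Icc (-(M : ℤ)) M, (2 * N + 1) / q * ∑ v ∈ Finset.range q, G u v
      - (2 * M + 1) * (2 * N + 1) * residueMean q G| ≤ (2 * N + 1) * (2 * q) := by
    rw [← Finset.mul_sum, Finset.sum_comm]
    have e : (2 * (M : ℝ) + 1) * (2 * N + 1) * residueMean q G = (2 * N + 1) / q *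
        ∑ v ∈ Finset.range q, (2 * M + 1) / q * ∑ u ∈ Finset.range q, G u v := by
      rw [← Finset.mul_sum, residueMean, Finset.sum_comm]
      field_simp
    rw [e, ← mul_sub, ← Finset.sum_sub_distrib, abs_mul,
      abs_of_nonneg (by positivity : (0 : ℝ) ≤ (2 * N + 1) / q)]
    have : |∑ v ∈ Finset.range q, (∑ u ∈ Finset.Icc (-(M : ℤ)) M, G u v
        - (2 * M + 1) / q * ∑ u ∈ Finset.range q, G u v)| ≤ q * (2 * q) := by
      refine (Finset.abs_sum_le_sum_abs _ _).trans ?_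
      refine (Finset.sum_le_sum (s := Finset.range q) fun (v : ℕ) _ =>
        abs_sum_Icc_sub_le hq (f := fun u => G u (v : ℤ)) (fun x => hG.add_left x (v : ℤ))
          (fun u => hb u (v : ℤ)) M).trans ?_
      simp
    calc (2 * (N : ℝ) + 1) / q * _ ≤ (2 * N + 1) / q * (q * (2 * q)) := by gcongr
      _ = _ := by field_simp
  have h3 := abs_add_le (∑ u ∈ Finset.Icc (-(M : ℤ)) M, ∑ v ∈ Finset.Icc (-(N : ℤ)) N, G u v
      - ∑ u ∈ Finset.Icc (-(M : ℤ)) M, (2 * N + 1) / q * ∑ v ∈ Finset.range q, G u v)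
    (∑ u ∈ Finset.Icc (-(M : ℤ)) M, (2 * N + 1) / q * ∑ v ∈ Finset.range q, G u v
      - (2 * M + 1) * (2 * N + 1) * residueMean q G)
  rw [sub_add_sub_cancel] at h3
  refine h3.trans ((add_le_add h1 h2).trans (le_of_eq ?_))
  ring

theorem sum_range_mul_of_coprime {a b : ℕ} (hab : a.Coprime b) (ha : 0 < a) (hb : 0 < b)
    {Φ : ℤ → ℤ → ℝ} (h1 : ∀ x x' y : ℤ, x ≡ x' [ZMOD a] → Φ x y = Φ x' y)
    (h2 : ∀ x y y' : ℤ, y ≡ y' [ZMOD b] → Φ x y = Φ x y') :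
    ∑ x ∈ Finset.range (a * b), Φ x x
      = ∑ x ∈ Finset.range a, ∑ y ∈ Finset.range b, Φ x y := by
  rw [← Finset.sum_product']
  refine Finset.sum_bij' (fun x _ => (x % a, x % b))
    (fun z _ => (Nat.chineseRemainder hab z.1 z.2 : ℕ)) ?_ ?_ ?_ ?_ ?_
  · intro x _
    simp only [Finset.mem_product, Finset.mem_range]
    exact ⟨Nat.mod_lt _ ha, Nat.mod_lt _ hb⟩
  · intro z _
    simp only [Finset.mem_range]
    exact Nat.chineseRemainder_lt_mul hab z.1 z.2 ha.ne' hb.ne'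
  · intro x hx
    have := Nat.chineseRemainder_modEq_unique hab (a := x % a) (b := x % b) (z := x)
      (Nat.mod_modEq x a).symm (Nat.mod_modEq x b).symm
    have h3 : x % (a * b) = x := Nat.mod_eq_of_lt (Finset.mem_range.1 hx)
    have h4 := Nat.chineseRemainder_lt_mul hab (x % a) (x % b) ha.ne' hb.ne'
    rw [Nat.ModEq, h3, Nat.mod_eq_of_lt h4] at this
    exact this.symm
  · intro z hz
    simp only [Finset.mem_product, Finset.mem_range] at hz
    obtain ⟨p1, p2⟩ := (Nat.chineseRemainder hab z.1 z.2).2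
    ext
    · change _ % a = _
      rw [p1, Nat.mod_eq_of_lt hz.1]
    · change _ % b = _
      rw [p2, Nat.mod_eq_of_lt hz.2]
  · intro x _
    rw [h1 x ((x % a : ℕ) : ℤ) x, h2 _ x ((x % b : ℕ) : ℤ)]
    · exact (Int.natCast_modEq_iff.2 (Nat.mod_modEq x b)).symm
    · exact (Int.natCast_modEq_iff.2 (Nat.mod_modEq x a)).symm

theorem residueMean_mul_of_coprime {a b : ℕ} (hab : a.Coprime b) (ha : 0 < a) (hb : 0 < b)
    {G H : ℤ → ℤ → ℝ} (hG : PeriodicMod a G) (hH : PeriodicMod b H) :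
    residueMean (a * b) (fun u v => G u v * H u v) = residueMean a G * residueMean b H := by
  simp only [residueMean]
  have e1 : ∀ u : ℕ, ∑ v ∈ Finset.range (a * b), G u v * H u v
      = ∑ v ∈ Finset.range a, ∑ w ∈ Finset.range b, G u v * H u w := fun u =>
    sum_range_mul_of_coprime hab ha hb (Φ := fun v w => G u v * H u w)
      (fun v v' w h => by rw [hG u u v v' rfl h]) (fun v w w' h => by rw [hH u u w w' rfl h])
  simp only [e1]
  have e2 : ∑ u ∈ Finset.range (a * b), ∑ v ∈ Finset.range a, ∑ w ∈ Finset.range b,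
      G u v * H u w = ∑ u ∈ Finset.range a, ∑ t ∈ Finset.range b,
        ∑ v ∈ Finset.range a, ∑ w ∈ Finset.range b, G u v * H t w :=
    sum_range_mul_of_coprime hab ha hb
      (Φ := fun u t => ∑ v ∈ Finset.range a, ∑ w ∈ Finset.range b, G u v * H t w)
      (fun u u' t h => Finset.sum_congr rfl fun v _ => Finset.sum_congr rfl fun w _ => by
        rw [hG u u' v v h rfl])
      (fun u t t' h => Finset.sum_congr rfl fun v _ => Finset.sum_congr rfl fun w _ => by
        rw [hH t t' w w h rfl])
  rw [e2]
  have e3 : ∑ u ∈ Finset.range a, ∑ t ∈ Finset.range b,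
        ∑ v ∈ Finset.range a, ∑ w ∈ Finset.range b, G u v * H t w
      = (∑ u ∈ Finset.range a, ∑ v ∈ Finset.range a, G u v)
        * ∑ t ∈ Finset.range b, ∑ w ∈ Finset.range b, H t w := by
    rw [Finset.sum_mul_sum]
    refine Finset.sum_congr rfl fun u _ => Finset.sum_congr rfl fun t _ => ?_
    rw [Finset.sum_mul_sum]
  rw [e3]
  have ha' : (a : ℝ) ≠ 0 := by exact_mod_cast ha.ne'
  have hb' : (b : ℝ) ≠ 0 := by exact_mod_cast hb.ne'
  push_cast
  field_simp

theorem PeriodicMod.of_dvd {a b : ℕ} (h : a ∣ b) {G : ℤ → ℤ → ℝ} (hG : PeriodicMod a G) :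
    PeriodicMod b G := fun u u' v v' hu hv =>
  hG u u' v v' (hu.of_dvd (Int.natCast_dvd_natCast.2 h)) (hv.of_dvd (Int.natCast_dvd_natCast.2 h))

theorem PeriodicMod.mul {q : ℕ} {G H : ℤ → ℤ → ℝ} (hG : PeriodicMod q G) (hH : PeriodicMod q H) :
    PeriodicMod q (fun u v => G u v * H u v) := fun u u' v v' hu hv => by
  simp only [hG u u' v v' hu hv, hH u u' v v' hu hv]

theorem PeriodicMod.prod {q : ℕ → ℕ} {φ : ℕ → ℤ → ℤ → ℝ} (T : Finset ℕ)
    (hφ : ∀ p ∈ T, PeriodicMod (q p) (φ p)) :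
    PeriodicMod (∏ p ∈ T, q p) (fun u v => ∏ p ∈ T, φ p u v) := fun u u' v v' hu hv =>
  Finset.prod_congr rfl fun p hp =>
    (hφ p hp).of_dvd (Finset.dvd_prod_of_mem q hp) u u' v v' hu hv

theorem residueMean_prod {φ : ℕ → ℤ → ℤ → ℝ} (T : Finset ℕ) (hT : ∀ p ∈ T, p.Prime)
    (hφ : ∀ p ∈ T, PeriodicMod (p ^ 2) (φ p)) :
    residueMean (∏ p ∈ T, p ^ 2) (fun u v => ∏ p ∈ T, φ p u v)
      = ∏ p ∈ T, residueMean (p ^ 2) (φ p) := by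
  induction T using Finset.induction_on with
  | empty => simp [residueMean]
  | insert r T hr ih =>
    simp only [Finset.prod_insert hr]
    have hrp : r.Prime := hT r (Finset.mem_insert_self r T)
    have hT' : ∀ p ∈ T, p.Prime := fun p hp => hT p (Finset.mem_insert_of_mem hp)
    have hφ' : ∀ p ∈ T, PeriodicMod (p ^ 2) (φ p) := fun p hp => hφ p (Finset.mem_insert_of_mem hp)
    rw [residueMean_mul_of_coprime _ (by have := hrp.pos; positivity)
      (Finset.prod_pos fun p hp => by have := (hT' p hp).pos; positivity)
      (hφ r (Finset.mem_insert_self r T)) (PeriodicMod.prod T hφ'), ih hT' hφ']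
    refine Nat.Coprime.prod_right fun p hp => Nat.Coprime.pow _ _ ?_
    exact (Nat.coprime_primes hrp (hT' p hp)).2 fun h => hr (h ▸ hp)

/-- Equidistribution of products of local functions over the integer points of a box. -/
theorem abs_sum_intBox_prod_sub_le {φ : ℕ → ℤ → ℤ → ℝ} (T : Finset ℕ) (hT : ∀ p ∈ T, p.Prime)
    (hφ : ∀ p ∈ T, PeriodicMod (p ^ 2) (φ p)) (hb : ∀ p ∈ T, ∀ u v, |φ p u v| ≤ 1) {M N : ℕ}
    (hM : 1 ≤ M) (hMN : M ≤ N) :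
    |∑ x ∈ intBox M N, ∏ p ∈ T, φ p x.1 x.2
        - (2 * M + 1) * (2 * N + 1) * ∏ p ∈ T, residueMean (p ^ 2) (φ p)|
      ≤ 12 * N * ((∏ p ∈ T, p : ℕ) : ℝ) ^ 2 := by
  rw [← residueMean_prod T hT hφ]
  have hq : 0 < ∏ p ∈ T, p ^ 2 := Finset.prod_pos fun p hp => by
    have := (hT p hp).pos; positivity
  have h := abs_sum_intBox_sub_le hq (PeriodicMod.prod T hφ) (fun u v => by
    rw [Finset.abs_prod]
    exact Finset.prod_le_one (fun p _ => abs_nonneg _) fun p hp => hb p hp u v) M N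
  refine h.trans ?_
  rw [Finset.prod_pow]
  push_cast
  have h1 : (M : ℝ) + N + 1 ≤ 3 * N := by
    have : M + N + 1 ≤ 3 * N := by omega
    exact_mod_cast this
  calc 4 * (∏ p ∈ T, (p : ℝ)) ^ 2 * (M + N + 1) ≤ 4 * (∏ p ∈ T, (p : ℝ)) ^ 2 * (3 * N) := by
        gcongr
    _ = _ := by ring

end

theorem residueMean_linear {q : ℕ} (hq : 0 < q) (G : ℤ → ℤ → ℝ) (b c : ℝ) :
    residueMean q (fun u v => b + c * G u v) = b + c * residueMean q G := by
  have : (q : ℝ) ≠ 0 := by exact_mod_cast hq.ne'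
  simp only [residueMean, Finset.sum_add_distrib, ← Finset.mul_sum, Finset.sum_const,
    Finset.card_range, nsmul_eq_mul]
  field_simp

theorem residueMean_nonneg {q : ℕ} {G : ℤ → ℤ → ℝ} (hG : ∀ u v, 0 ≤ G u v) :
    0 ≤ residueMean q G :=
  div_nonneg (Finset.sum_nonneg fun _ _ => Finset.sum_nonneg fun _ _ => hG _ _) (by positivity)

/-- The subsets of `T` whose product is at most `L`. -/
noncomputable def smallSubsets (T : Finset ℕ) (L : ℕ) : Finset (Finset ℕ) :=
  T.powerset.filter fun m => ∏ p ∈ m, p ≤ L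

theorem mem_smallSubsets {T : Finset ℕ} {L : ℕ} {m : Finset ℕ} :
    m ∈ smallSubsets T L ↔ m ⊆ T ∧ ∏ p ∈ m, p ≤ L := by
  simp [smallSubsets]

theorem primeFactors_prod_id {m : Finset ℕ} (hm : ∀ p ∈ m, p.Prime) :
    (∏ p ∈ m, p).primeFactors = m :=
  Nat.primeFactors_prod hm

theorem card_smallSubsets_le {T : Finset ℕ} (hT : ∀ p ∈ T, p.Prime) (L : ℕ) :
    (smallSubsets T L).card ≤ L := by
  have h : (smallSubsets T L).card ≤ (Finset.Ioc 0 L).card := by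
    refine Finset.card_le_card_of_injOn (fun m => ∏ p ∈ m, p) ?_ ?_
    · intro m hm
      obtain ⟨h1, h2⟩ := mem_smallSubsets.1 hm
      exact Finset.mem_coe.2 (Finset.mem_Ioc.2
        ⟨Finset.prod_pos fun p hp => (hT p (h1 hp)).pos, h2⟩)
    · intro m hm m' hm' h
      obtain ⟨h1, -⟩ := mem_smallSubsets.1 hm
      obtain ⟨h2, -⟩ := mem_smallSubsets.1 hm'
      have h : ∏ p ∈ m, p = ∏ p ∈ m', p := h
      rw [← primeFactors_prod_id fun p hp => hT p (h1 hp), h,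
        primeFactors_prod_id fun p hp => hT p (h2 hp)]
  simpa using h

/-- The local factor used in the Selberg-type majorant, of mean zero. -/
noncomputable def sieveWeight (D : ℕ → ℤ → ℤ → ℝ) (p : ℕ) (u v : ℤ) : ℝ :=
  residueMean (p ^ 2) (D p) / (1 - residueMean (p ^ 2) (D p))
    + -(1 / (1 - residueMean (p ^ 2) (D p))) * D p u v

section Sieve

variable {D e : ℕ → ℤ → ℤ → ℝ}

theorem residueMean_sieveWeight {p : ℕ} (hp : 0 < p)
    (hg : residueMean (p ^ 2) (D p) ≤ 1 / 2) : residueMean (p ^ 2) (sieveWeight D p) = 0 := by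
  unfold sieveWeight
  rw [residueMean_linear (by positivity)]
  have : 1 - residueMean (p ^ 2) (D p) ≠ 0 := by linarith
  field_simp
  ring

theorem sieveWeight_sq {p : ℕ} (hD : ∀ u v, D p u v = 0 ∨ D p u v = 1)
    (hg : residueMean (p ^ 2) (D p) ≤ 1 / 2) (u v : ℤ) :
    sieveWeight D p u v * sieveWeight D p u v
      = (residueMean (p ^ 2) (D p) / (1 - residueMean (p ^ 2) (D p))) ^ 2
        + (1 - (residueMean (p ^ 2) (D p) / (1 - residueMean (p ^ 2) (D p))) ^ 2) * D p u v := by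
  have : 1 - residueMean (p ^ 2) (D p) ≠ 0 := by linarith
  rcases hD u v with h | h
  · simp only [sieveWeight, h]; ring
  · simp only [sieveWeight, h]; field_simp; ring

theorem residueMean_sieveWeight_sq {p : ℕ} (hp : 0 < p) (hD : ∀ u v, D p u v = 0 ∨ D p u v = 1)
    (hg : residueMean (p ^ 2) (D p) ≤ 1 / 2) :
    residueMean (p ^ 2) (fun u v => sieveWeight D p u v * sieveWeight D p u v)
      = residueMean (p ^ 2) (D p) / (1 - residueMean (p ^ 2) (D p)) := by
  simp only [sieveWeight_sq hD hg]
  rw [residueMean_linear (by positivity)]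
  have : 1 - residueMean (p ^ 2) (D p) ≠ 0 := by linarith
  field_simp
  ring

theorem abs_sieveWeight_le {p : ℕ} (hD : ∀ u v, D p u v = 0 ∨ D p u v = 1)
    (hg : residueMean (p ^ 2) (D p) ≤ 1 / 2) (u v : ℤ) : |sieveWeight D p u v| ≤ 1 := by
  have h0 : 0 ≤ residueMean (p ^ 2) (D p) :=
    residueMean_nonneg fun u v => by rcases hD u v with h | h <;> simp [h]
  have h1 : 0 < 1 - residueMean (p ^ 2) (D p) := by linarith
  rcases hD u v with h | h
  · simp only [sieveWeight, h, mul_zero, add_zero]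
    rw [abs_of_nonneg (by positivity), div_le_one h1]
    linarith
  · have : sieveWeight D p u v = -1 := by
      simp only [sieveWeight, h]
      field_simp
      ring
    rw [this]; norm_num

theorem periodicMod_sieveWeight {p : ℕ} (hD : PeriodicMod (p ^ 2) (D p)) :
    PeriodicMod (p ^ 2) (sieveWeight D p) := fun u u' v v' hu hv => by
  simp only [sieveWeight, hD u u' v v' hu hv]

theorem periodicMod_ite {q : ℕ} {G : ℤ → ℤ → ℝ} {P : Prop} [Decidable P] (hG : P → PeriodicMod q G) :
    PeriodicMod q (fun u v => if P then G u v else 1) := fun u u' v v' hu hv => by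
  by_cases h : P
  · simp only [h, if_true, hG h u u' v v' hu hv]
  · simp only [h, if_false]

/-- Selberg's upper bound sieve for the lattice points `x` of a box with `D p x = 0` for `p ∈ T`
and `e p x = 1` for `p ∈ E`. -/
theorem selberg_upper_bound {T E : Finset ℕ} (hT : ∀ p ∈ T, p.Prime) (hE : ∀ p ∈ E, p.Prime)
    (hTE : Disjoint T E) (hDp : ∀ p ∈ T, PeriodicMod (p ^ 2) (D p))
    (hep : ∀ p ∈ E, PeriodicMod (p ^ 2) (e p))
    (hD : ∀ p ∈ T, ∀ u v, D p u v = 0 ∨ D p u v = 1)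
    (he : ∀ p ∈ E, ∀ u v, e p u v = 0 ∨ e p u v = 1)
    (hg : ∀ p ∈ T, residueMean (p ^ 2) (D p) ≤ 1 / 2) {M N L : ℕ} (hM : 1 ≤ M) (hMN : M ≤ N)
    (hL : 1 ≤ L) {A : Finset (ℤ × ℤ)} (hA : A ⊆ intBox M N)
    (hA1 : ∀ x ∈ A, ∀ p ∈ E, e p x.1 x.2 = 1) (hA2 : ∀ x ∈ A, ∀ p ∈ T, D p x.1 x.2 = 0) :
    A.card * ∑ m ∈ smallSubsets T L,
        ∏ p ∈ m, (residueMean (p ^ 2) (D p) / (1 - residueMean (p ^ 2) (D p)))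
      ≤ (2 * M + 1) * (2 * N + 1) * ∏ p ∈ E, residueMean (p ^ 2) (e p)
        + 12 * N * ((∏ p ∈ E, p : ℕ) : ℝ) ^ 2 * (L : ℝ) ^ 6 := by
  set h : ℕ → ℝ := fun p => residueMean (p ^ 2) (D p) / (1 - residueMean (p ^ 2) (D p)) with hh
  set S := ∑ m ∈ smallSubsets T L, ∏ p ∈ m, h p with hS
  have hh0 : ∀ p ∈ T, 0 ≤ h p := fun p hp => by
    have h0 : 0 ≤ residueMean (p ^ 2) (D p) :=
      residueMean_nonneg fun u v => by rcases hD p hp u v with h | h <;> simp [h]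
    have := hg p hp
    exact div_nonneg h0 (by linarith)
  have hS1 : 1 ≤ S := by
    have := Finset.single_le_sum (f := fun m => ∏ p ∈ m, h p) (s := smallSubsets T L)
      (fun m hm => Finset.prod_nonneg fun p hp => hh0 p ((mem_smallSubsets.1 hm).1 hp))
      (mem_smallSubsets.2 ⟨Finset.empty_subset T, by simpa using hL⟩)
    simpa using this
  set φ : Finset ℕ → Finset ℕ → ℕ → ℤ → ℤ → ℝ := fun m m' p u v =>
    (if p ∈ E then e p u v else 1) * ((if p ∈ m then sieveWeight D p u v else 1)
      * (if p ∈ m' then sieveWeight D p u v else 1)) with hφ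
  have he0 : ∀ x : ℤ × ℤ, 0 ≤ ∏ p ∈ E, e p x.1 x.2 := fun x => Finset.prod_nonneg fun p hp => by
    rcases he p hp x.1 x.2 with h | h <;> simp [h]
  have hexp : ∀ x : ℤ × ℤ, (∏ p ∈ E, e p x.1 x.2)
      * (∑ m ∈ smallSubsets T L, ∏ p ∈ m, sieveWeight D p x.1 x.2) ^ 2
      = ∑ m ∈ smallSubsets T L, ∑ m' ∈ smallSubsets T L,
          ∏ p ∈ E ∪ (m ∪ m'), φ m m' p x.1 x.2 := by
    intro x
    rw [sq, Finset.sum_mul_sum, Finset.mul_sum]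
    refine Finset.sum_congr rfl fun m _ => ?_
    rw [Finset.mul_sum]
    refine Finset.sum_congr rfl fun m' _ => ?_
    simp only [hφ, Finset.prod_mul_distrib, Finset.prod_ite_mem]
    rw [Finset.inter_eq_right.2 Finset.subset_union_left,
      Finset.inter_eq_right.2 (Finset.subset_union_left.trans Finset.subset_union_right),
      Finset.inter_eq_right.2 (Finset.subset_union_right.trans Finset.subset_union_right)]
  have hlow : A.card * S ^ 2 ≤ ∑ x ∈ intBox M N, (∏ p ∈ E, e p x.1 x.2)
      * (∑ m ∈ smallSubsets T L, ∏ p ∈ m, sieveWeight D p x.1 x.2) ^ 2 := by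
    calc A.card * S ^ 2 = ∑ x ∈ A, S ^ 2 := by rw [Finset.sum_const, nsmul_eq_mul]
      _ = ∑ x ∈ A, (∏ p ∈ E, e p x.1 x.2)
          * (∑ m ∈ smallSubsets T L, ∏ p ∈ m, sieveWeight D p x.1 x.2) ^ 2 := by
        refine Finset.sum_congr rfl fun x hx => ?_
        rw [Finset.prod_eq_one fun p hp => hA1 x hx p hp, one_mul]
        congr 1
        refine Finset.sum_congr rfl fun m hm => Finset.prod_congr rfl fun p hp => ?_
        simp only [sieveWeight, hA2 x hx p ((mem_smallSubsets.1 hm).1 hp), hh, mul_zero, add_zero]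
      _ ≤ _ := Finset.sum_le_sum_of_subset_of_nonneg hA fun x _ _ =>
        mul_nonneg (he0 x) (sq_nonneg _)
  have hmean : ∀ m ∈ smallSubsets T L, ∀ m' ∈ smallSubsets T L,
      ∏ p ∈ E ∪ (m ∪ m'), residueMean (p ^ 2) (φ m m' p)
      = if m = m' then (∏ p ∈ E, residueMean (p ^ 2) (e p)) * ∏ p ∈ m, h p else 0 := by
    intro m hm m' hm'
    have hmT := (mem_smallSubsets.1 hm).1
    have hmT' := (mem_smallSubsets.1 hm').1
    have hnE : ∀ p ∈ T, p ∉ E := fun p hp => Finset.disjoint_left.1 hTE hp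
    split_ifs with hmm
    · subst hmm
      rw [Finset.union_self, Finset.prod_union (hTE.symm.mono_right hmT)]
      congr 1
      · refine Finset.prod_congr rfl fun p hp => ?_
        have : p ∉ m := fun h => hnE p (hmT h) hp
        simp only [hφ, hp, this, if_true, if_false, mul_one]
      · refine Finset.prod_congr rfl fun p hp => ?_
        simp only [hφ, hp, hnE p (hmT hp), if_true, if_false, one_mul]
        exact residueMean_sieveWeight_sq (hT p (hmT hp)).pos (hD p (hmT hp)) (hg p (hmT hp))
    · have key : ∀ p ∈ T, ((p ∈ m ∧ p ∉ m') ∨ (p ∉ m ∧ p ∈ m')) →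
          residueMean (p ^ 2) (φ m m' p) = 0 := by
        intro p hp hpm
        have := residueMean_sieveWeight (D := D) (hT p hp).pos (hg p hp)
        rcases hpm with ⟨h1, h2⟩ | ⟨h1, h2⟩ <;>
        · simp only [hφ, h1, h2, hnE p hp, if_true, if_false, one_mul, mul_one]
          exact this
      have : ∃ p, (p ∈ m ∧ p ∉ m') ∨ (p ∉ m ∧ p ∈ m') := by
        by_contra hcon
        push Not at hcon
        exact hmm (Finset.ext fun p => ⟨fun h => (hcon p).1 h, fun h => by
          by_contra h'; exact (hcon p).2 h' h⟩)
      obtain ⟨p, hp⟩ := this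
      refine Finset.prod_eq_zero (i := p) ?_ (key p ?_ hp)
      · rcases hp with h | h <;> simp [h]
      · rcases hp with h | h
        · exact hmT h.1
        · exact hmT' h.2
  have hE0 : (1 : ℝ) ≤ ((∏ p ∈ E, p : ℕ) : ℝ) := by
    exact_mod_cast Finset.prod_pos fun p hp => (hE p hp).pos
  have hpair : ∀ m ∈ smallSubsets T L, ∀ m' ∈ smallSubsets T L,
      ∑ x ∈ intBox M N, ∏ p ∈ E ∪ (m ∪ m'), φ m m' p x.1 x.2
      ≤ (2 * M + 1) * (2 * N + 1)
          * (if m = m' then (∏ p ∈ E, residueMean (p ^ 2) (e p)) * ∏ p ∈ m, h p else 0)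
        + 12 * N * ((∏ p ∈ E, p : ℕ) : ℝ) ^ 2 * (L : ℝ) ^ 4 := by
    intro m hm m' hm'
    obtain ⟨hmT, hmL⟩ := mem_smallSubsets.1 hm
    obtain ⟨hmT', hmL'⟩ := mem_smallSubsets.1 hm'
    have hpr : ∀ p ∈ E ∪ (m ∪ m'), p.Prime := by
      intro p hp
      simp only [Finset.mem_union] at hp
      rcases hp with h | h | h
      exacts [hE p h, hT p (hmT h), hT p (hmT' h)]
    have hb := abs_sum_intBox_prod_sub_le (φ := φ m m') (E ∪ (m ∪ m')) hpr (fun p _ =>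
      (periodicMod_ite fun h => hep p h).mul ((periodicMod_ite fun h =>
        periodicMod_sieveWeight (hDp p (hmT h))).mul (periodicMod_ite fun h =>
        periodicMod_sieveWeight (hDp p (hmT' h))))) (fun p _ u v => by
        simp only [hφ, abs_mul]
        refine mul_le_one₀ ?_ (by positivity) (mul_le_one₀ ?_ (by positivity) ?_)
        · split_ifs with h
          · rcases he p h u v with h | h <;> rw [h] <;> norm_num
          · norm_num
        · split_ifs with h
          · exact abs_sieveWeight_le (hD p (hmT h)) (hg p (hmT h)) u v
          · norm_num
        · split_ifs with h
          · exact abs_sieveWeight_le (hD p (hmT' h)) (hg p (hmT' h)) u v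
          · norm_num) hM hMN
    rw [hmean m hm m' hm'] at hb
    have h1 := (abs_le.1 hb).2
    have hunion : ∀ a b : Finset ℕ, (∀ p ∈ a, p.Prime) → ∏ p ∈ a ∪ b, p ≤ (∏ p ∈ a, p) * ∏ p ∈ b, p := by
      intro a b ha
      rw [← Finset.prod_union_inter]
      refine Nat.le_mul_of_pos_right _ (Finset.prod_pos fun p hp => ?_)
      exact (ha p (Finset.mem_inter.1 hp).1).pos
    have h2 : ∏ p ∈ E ∪ (m ∪ m'), p ≤ (∏ p ∈ E, p) * (L * L) :=
      (hunion _ _ hE).trans (Nat.mul_le_mul_left _ ((hunion _ _ fun p hp => hT p (hmT hp)).trans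
        (Nat.mul_le_mul hmL hmL')))
    have h3 : ((∏ p ∈ E ∪ (m ∪ m'), p : ℕ) : ℝ) ≤ ((∏ p ∈ E, p : ℕ) : ℝ) * (L * L) := by
      rw [← Nat.cast_mul, ← Nat.cast_mul]
      exact Nat.cast_le.2 h2
    have h4 : 12 * (N : ℝ) * ((∏ p ∈ E ∪ (m ∪ m'), p : ℕ) : ℝ) ^ 2
        ≤ 12 * N * (((∏ p ∈ E, p : ℕ) : ℝ) * (L * L)) ^ 2 := by gcongr
    have h5 : 12 * (N : ℝ) * (((∏ p ∈ E, p : ℕ) : ℝ) * (L * L)) ^ 2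
        = 12 * N * ((∏ p ∈ E, p : ℕ) : ℝ) ^ 2 * (L : ℝ) ^ 4 := by ring
    linarith
  have hcard : ((smallSubsets T L).card : ℝ) ≤ L := by
    exact_mod_cast card_smallSubsets_le hT L
  have hup : A.card * S ^ 2 ≤ (2 * M + 1) * (2 * N + 1)
      * ((∏ p ∈ E, residueMean (p ^ 2) (e p)) * S)
      + 12 * N * ((∏ p ∈ E, p : ℕ) : ℝ) ^ 2 * (L : ℝ) ^ 6 := by
    refine hlow.trans ?_
    simp only [hexp]
    rw [Finset.sum_comm]
    calc ∑ m ∈ smallSubsets T L, ∑ x ∈ intBox M N, ∑ m' ∈ smallSubsets T L,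
          ∏ p ∈ E ∪ (m ∪ m'), φ m m' p x.1 x.2
        = ∑ m ∈ smallSubsets T L, ∑ m' ∈ smallSubsets T L, ∑ x ∈ intBox M N,
          ∏ p ∈ E ∪ (m ∪ m'), φ m m' p x.1 x.2 :=
          Finset.sum_congr rfl fun m _ => Finset.sum_comm
      _ ≤ ∑ m ∈ smallSubsets T L, ∑ m' ∈ smallSubsets T L, ((2 * M + 1) * (2 * N + 1)
          * (if m = m' then (∏ p ∈ E, residueMean (p ^ 2) (e p)) * ∏ p ∈ m, h p else 0)
        + 12 * N * ((∏ p ∈ E, p : ℕ) : ℝ) ^ 2 * (L : ℝ) ^ 4) :=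
          Finset.sum_le_sum fun m hm => Finset.sum_le_sum fun m' hm' => hpair m hm m' hm'
      _ = (2 * M + 1) * (2 * N + 1) * ((∏ p ∈ E, residueMean (p ^ 2) (e p)) * S)
          + (smallSubsets T L).card * ((smallSubsets T L).card
            * (12 * N * ((∏ p ∈ E, p : ℕ) : ℝ) ^ 2 * (L : ℝ) ^ 4)) := by
          have : ∑ m ∈ smallSubsets T L, ∑ m' ∈ smallSubsets T L,
              (if m = m' then (∏ p ∈ E, residueMean (p ^ 2) (e p)) * ∏ p ∈ m, h p else 0)
              = (∏ p ∈ E, residueMean (p ^ 2) (e p)) * S := by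
            simp only [Finset.sum_ite_eq]
            rw [hS, Finset.mul_sum]
            exact Finset.sum_congr rfl fun m hm => by simp [hm]
          rw [← this, Finset.mul_sum]
          simp only [Finset.sum_add_distrib, ← Finset.mul_sum, Finset.sum_const, nsmul_eq_mul]
          ring
      _ ≤ (2 * M + 1) * (2 * N + 1) * ((∏ p ∈ E, residueMean (p ^ 2) (e p)) * S)
          + L * (L * (12 * N * ((∏ p ∈ E, p : ℕ) : ℝ) ^ 2 * (L : ℝ) ^ 4)) := by gcongr
      _ = _ := by ring
  have herr : 0 ≤ 12 * N * ((∏ p ∈ E, p : ℕ) : ℝ) ^ 2 * (L : ℝ) ^ 6 := by positivity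
  have : (A.card * S) * S ≤ ((2 * M + 1) * (2 * N + 1) * ∏ p ∈ E, residueMean (p ^ 2) (e p)
        + 12 * N * ((∏ p ∈ E, p : ℕ) : ℝ) ^ 2 * (L : ℝ) ^ 6) * S := by
    nlinarith
  exact le_of_mul_le_mul_right this (by linarith)

end Sieve

theorem rpow_sub_one_le {p β B : ℝ} (hp : 1 ≤ p) (hβ : 0 ≤ β) (hB : β * Real.log p ≤ B) :
    p ^ β - 1 ≤ Real.exp B * (β * Real.log p) := by
  have h0 : 0 ≤ β * Real.log p := mul_nonneg hβ (Real.log_nonneg hp)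
  rw [Real.rpow_def_of_pos (by linarith), mul_comm (Real.log p)]
  set t := β * Real.log p
  have h1 : Real.exp t ≤ Real.exp B := Real.exp_le_exp.2 hB
  have h2 : 1 - t ≤ Real.exp (-t) := by have := Real.add_one_le_exp (-t); linarith
  have h3 : Real.exp t * Real.exp (-t) = 1 := by rw [← Real.exp_add]; simp
  have h4 : Real.exp t * (1 - t) ≤ 1 := by
    exact (mul_le_mul_of_nonneg_left h2 (Real.exp_pos t).le).trans h3.le
  nlinarith

/-- Rankin's trick: restricting to subsets of small product loses at most a factor two. -/
theorem half_prod_le_sum_smallSubsets {T : Finset ℕ} {h : ℕ → ℝ} {κ s : ℝ} {z L : ℕ} (hz : 2 ≤ z)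
    (hT : ∀ p ∈ T, p.Prime ∧ p ≤ z) (hh0 : ∀ p ∈ T, 0 ≤ h p) (hκ0 : 0 ≤ κ)
    (hκ : ∀ p ∈ T, h p ≤ κ / p) (hs : 9 * κ + 1 ≤ s)
    (hL : s * Real.log z ≤ Real.log (L + 1)) :
    (∏ p ∈ T, (1 + h p)) / 2 ≤ ∑ m ∈ smallSubsets T L, ∏ p ∈ m, h p := by
  have hlz : 0 < Real.log z := Real.log_pos (by exact_mod_cast hz)
  set β := 1 / Real.log z with hβ
  have hβ0 : 0 < β := by positivity
  have htail : ∑ m ∈ T.powerset with ¬ ∏ p ∈ m, p ≤ L, ∏ p ∈ m, h p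
      ≤ Real.exp (-s) * ∏ p ∈ T, (1 + h p * (p : ℝ) ^ β) := by
    have hle : ∀ m ∈ T.powerset.filter fun m => ¬ ∏ p ∈ m, p ≤ L, ∏ p ∈ m, h p
        ≤ Real.exp (-s) * ∏ p ∈ m, (h p * (p : ℝ) ^ β) := by
      intro m hm
      simp only [Finset.mem_filter, Finset.mem_powerset, not_le] at hm
      obtain ⟨hmT, hmL⟩ := hm
      rw [Finset.prod_mul_distrib, Real.finsetProd_rpow _ _ fun p _ => by positivity]
      have h1 : Real.log (L + 1) ≤ Real.log (∏ p ∈ m, (p : ℝ)) := by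
        apply Real.log_le_log (by positivity)
        rw [← Nat.cast_prod]
        exact_mod_cast hmL
      have hpos : 0 < ∏ p ∈ m, (p : ℝ) := Finset.prod_pos fun p hp => by
        exact_mod_cast (hT p (hmT hp)).1.pos
      have h2 : Real.exp s ≤ (∏ p ∈ m, (p : ℝ)) ^ β := by
        rw [Real.rpow_def_of_pos hpos]
        apply Real.exp_le_exp.2
        rw [hβ, mul_one_div, le_div_iff₀ hlz]
        linarith
      have h3 : 1 ≤ Real.exp (-s) * (∏ p ∈ m, (p : ℝ)) ^ β := by
        rw [Real.exp_neg, ← div_eq_inv_mul, le_div_iff₀ (Real.exp_pos s)]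
        linarith
      have h4 : 0 ≤ ∏ p ∈ m, h p := Finset.prod_nonneg fun p hp => hh0 p (hmT hp)
      nlinarith
    refine (Finset.sum_le_sum hle).trans ?_
    rw [← Finset.mul_sum, Finset.prod_one_add]
    refine mul_le_mul_of_nonneg_left ?_ (Real.exp_pos _).le
    refine Finset.sum_le_sum_of_subset_of_nonneg (Finset.filter_subset _ _) fun m hm _ => ?_
    exact Finset.prod_nonneg fun p hp =>
      mul_nonneg (hh0 p (Finset.mem_powerset.1 hm hp)) (by positivity)
  have hsplit : ∏ p ∈ T, (1 + h p) = ∑ m ∈ smallSubsets T L, ∏ p ∈ m, h p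
      + ∑ m ∈ T.powerset with ¬ ∏ p ∈ m, p ≤ L, ∏ p ∈ m, h p := by
    rw [Finset.prod_one_add, smallSubsets, Finset.sum_filter_add_sum_filter_not]
  have hprod : ∏ p ∈ T, (1 + h p * (p : ℝ) ^ β)
      ≤ Real.exp (9 * κ) * ∏ p ∈ T, (1 + h p) := by
    have hterm : ∀ p ∈ T, 1 + h p * (p : ℝ) ^ β
        ≤ Real.exp (3 * κ * β * (Real.log p / p)) * (1 + h p) := by
      intro p hp
      obtain ⟨hpp, hpz⟩ := hT p hp
      have hp1 : (1 : ℝ) ≤ p := by exact_mod_cast hpp.one_le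
      have hp0 : (0 : ℝ) < p := by linarith
      have hlp : 0 ≤ Real.log p := Real.log_nonneg hp1
      have h1 := rpow_sub_one_le (p := p) (β := β) (B := 1) hp1 hβ0.le (by
        rw [hβ, one_div_mul_eq_div, div_le_one hlz]
        exact Real.log_le_log hp0 (by exact_mod_cast hpz))
      have h2 : (p : ℝ) ^ β - 1 ≤ 3 * (β * Real.log p) :=
        h1.trans (mul_le_mul_of_nonneg_right (by have := Real.exp_one_lt_d9; linarith)
          (by positivity))
      have h3 := hh0 p hp
      have h4 : h p * ((p : ℝ) ^ β - 1) ≤ κ / p * (3 * (β * Real.log p)) := by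
        refine (mul_le_mul_of_nonneg_left h2 h3).trans ?_
        exact mul_le_mul_of_nonneg_right (hκ p hp) (by positivity)
      have h5 := Real.add_one_le_exp (3 * κ * β * (Real.log p / p))
      have h6 : κ / p * (3 * (β * Real.log p)) = 3 * κ * β * (Real.log p / p) := by
        field_simp
      have h7 : 0 ≤ 3 * κ * β * (Real.log p / p) := by positivity
      nlinarith
    refine (Finset.prod_le_prod (fun p hp => ?_) hterm).trans ?_
    · have := hh0 p hp
      positivity
    rw [Finset.prod_mul_distrib, ← Real.exp_sum, ← Finset.mul_sum]
    refine mul_le_mul_of_nonneg_right (Real.exp_le_exp.2 ?_)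
      (Finset.prod_nonneg fun p hp => by have := hh0 p hp; positivity)
    have h8 : ∑ p ∈ T, Real.log p / p ≤ 3 * Real.log z := by
      refine (Finset.sum_le_sum_of_subset_of_nonneg (t := primesUpTo z) ?_ ?_).trans
        (sum_log_div_le_mul_log hz)
      · intro p hp
        exact mem_primesUpTo.2 ⟨(hT p hp).2, (hT p hp).1⟩
      · intro p _ _
        exact div_nonneg (Real.log_natCast_nonneg p) (by positivity)
    calc 3 * κ * β * ∑ p ∈ T, Real.log p / p ≤ 3 * κ * β * (3 * Real.log z) := by gcongr
      _ = 9 * κ := by rw [hβ]; field_simp; ring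
  have hP : 0 ≤ ∏ p ∈ T, (1 + h p) :=
    Finset.prod_nonneg fun p hp => by have := hh0 p hp; positivity
  have hexp : Real.exp (-s) * Real.exp (9 * κ) ≤ 1 / 2 := by
    rw [← Real.exp_add]
    have : Real.exp (-s + 9 * κ) ≤ Real.exp (-1) := Real.exp_le_exp.2 (by linarith)
    have h1 : Real.exp (-1) ≤ 1 / 2 := by
      have := Real.exp_neg_one_lt_d9
      linarith
    linarith
  have : Real.exp (-s) * ∏ p ∈ T, (1 + h p * (p : ℝ) ^ β) ≤ 1 / 2 * ∏ p ∈ T, (1 + h p) :=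
    (mul_le_mul_of_nonneg_left hprod (Real.exp_pos _).le).trans (by
      rw [← mul_assoc]; exact mul_le_mul_of_nonneg_right hexp hP)
  linarith

theorem card_le_of_sieve {D e : ℕ → ℤ → ℤ → ℝ} {T E : Finset ℕ} {κ s : ℝ} {z : ℕ} (hz : 2 ≤ z)
    (hT : ∀ p ∈ T, p.Prime ∧ p ≤ z) (hE : ∀ p ∈ E, p.Prime)
    (hTE : Disjoint T E) (hDp : ∀ p ∈ T, PeriodicMod (p ^ 2) (D p))
    (hep : ∀ p ∈ E, PeriodicMod (p ^ 2) (e p))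
    (hD : ∀ p ∈ T, ∀ u v, D p u v = 0 ∨ D p u v = 1)
    (he : ∀ p ∈ E, ∀ u v, e p u v = 0 ∨ e p u v = 1)
    (hg : ∀ p ∈ T, residueMean (p ^ 2) (D p) ≤ 1 / 2)
    (hgκ : ∀ p ∈ T, residueMean (p ^ 2) (D p) ≤ κ / p) (hκ0 : 0 ≤ κ) {M N L : ℕ} (hM : 1 ≤ M)
    (hMN : M ≤ N) (hL : 1 ≤ L) (hs : 18 * κ + 1 ≤ s)
    (hLz : s * Real.log z ≤ Real.log (L + 1)) {A : Finset (ℤ × ℤ)} (hA : A ⊆ intBox M N)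
    (hA1 : ∀ x ∈ A, ∀ p ∈ E, e p x.1 x.2 = 1) (hA2 : ∀ x ∈ A, ∀ p ∈ T, D p x.1 x.2 = 0) :
    (A.card : ℝ) ≤ 2 * ((2 * M + 1) * (2 * N + 1)) * (∏ p ∈ E, residueMean (p ^ 2) (e p))
        * ∏ p ∈ T, (1 - residueMean (p ^ 2) (D p))
      + 12 * N * ((∏ p ∈ E, p : ℕ) : ℝ) ^ 2 * (L : ℝ) ^ 6 := by
  have h1 := selberg_upper_bound (fun p hp => (hT p hp).1) hE hTE hDp hep hD he hg hM hMN hL hA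
    hA1 hA2
  have hg0 : ∀ p ∈ T, 0 ≤ residueMean (p ^ 2) (D p) := fun p hp =>
    residueMean_nonneg fun u v => by rcases hD p hp u v with h | h <;> norm_num [h]
  have hpos : ∀ p ∈ T, 0 < 1 - residueMean (p ^ 2) (D p) := fun p hp => by
    have := hg p hp; linarith
  have h0 : ∀ p ∈ T, 0 ≤ residueMean (p ^ 2) (D p) / (1 - residueMean (p ^ 2) (D p)) :=
    fun p hp => div_nonneg (hg0 p hp) (hpos p hp).le
  have h2 := half_prod_le_sum_smallSubsets
    (h := fun p => residueMean (p ^ 2) (D p) / (1 - residueMean (p ^ 2) (D p)))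
    (κ := 2 * κ) hz hT h0 (by positivity) (fun p hp => by
      rw [div_le_iff₀ (hpos p hp)]
      have a1 := hgκ p hp
      have a2 := hg p hp
      have a3 : 2 * κ / p * (1 / 2) ≤ 2 * κ / p * (1 - residueMean (p ^ 2) (D p)) :=
        mul_le_mul_of_nonneg_left (by linarith) (by positivity)
      have a4 : 2 * κ / p * (1 / 2) = κ / p := by ring
      linarith) (s := s) (by linarith) hLz
  set S := ∑ m ∈ smallSubsets T L,
    ∏ p ∈ m, (residueMean (p ^ 2) (D p) / (1 - residueMean (p ^ 2) (D p)))
  have hS1 : 1 ≤ S := by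
    have := Finset.single_le_sum (s := smallSubsets T L)
      (f := fun m => ∏ p ∈ m, (residueMean (p ^ 2) (D p) / (1 - residueMean (p ^ 2) (D p))))
      (fun m hm => Finset.prod_nonneg fun p hp => h0 p ((mem_smallSubsets.1 hm).1 hp))
      (mem_smallSubsets.2 ⟨Finset.empty_subset T, by simpa using hL⟩)
    simpa only [Finset.prod_empty] using this
  have h3 : ∏ p ∈ T, (1 + residueMean (p ^ 2) (D p) / (1 - residueMean (p ^ 2) (D p)))
      = (∏ p ∈ T, (1 - residueMean (p ^ 2) (D p)))⁻¹ := by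
    rw [← Finset.prod_inv_distrib]
    refine Finset.prod_congr rfl fun p hp => ?_
    have := (hpos p hp).ne'
    field_simp
    ring
  rw [h3] at h2
  set Q := ∏ p ∈ T, (1 - residueMean (p ^ 2) (D p)) with hQ
  have hQ0 : 0 < Q := Finset.prod_pos hpos
  set X := (2 * (M : ℝ) + 1) * (2 * N + 1) * ∏ p ∈ E, residueMean (p ^ 2) (e p) with hX
  have hX0 : 0 ≤ X := by
    refine mul_nonneg (by positivity) (Finset.prod_nonneg fun p hp => residueMean_nonneg fun u v => ?_)
    rcases he p hp u v with h | h <;> norm_num [h]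
  set R := 12 * (N : ℝ) * ((∏ p ∈ E, p : ℕ) : ℝ) ^ 2 * (L : ℝ) ^ 6 with hR
  have hR0 : 0 ≤ R := by positivity
  have h4 : 1 ≤ 2 * Q * S := by
    have := mul_le_mul_of_nonneg_left h2 (by positivity : 0 ≤ 2 * Q)
    have e : 2 * Q * (Q⁻¹ / 2) = 1 := by field_simp
    linarith
  have h5 : (A.card : ℝ) * S ≤ (2 * X * Q + R) * S := by
    have : X ≤ X * (2 * Q * S) := le_mul_of_one_le_right hX0 h4
    have : R ≤ R * S := le_mul_of_one_le_right hR0 hS1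
    linarith
  have h6 := le_of_mul_le_mul_right h5 (by linarith)
  calc (A.card : ℝ) ≤ 2 * X * Q + R := h6
    _ = _ := by rw [hX]; ring

/-- The primes in `(P, z]`. -/
noncomputable def goodPrimes (P z : ℕ) : Finset ℕ := (primesUpTo z).filter (P < ·)

theorem mem_goodPrimes {P z p : ℕ} : p ∈ goodPrimes P z ↔ (p ≤ z ∧ p.Prime) ∧ P < p := by
  rw [goodPrimes, Finset.mem_filter, mem_primesUpTo]

/-- The indicator function of `p ∣ n u v`. -/
noncomputable def dvdInd (n : ℤ → ℤ → ℕ) (p : ℕ) (u v : ℤ) : ℝ := if p ∣ n u v then 1 else 0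

/-- Hypotheses on the local densities of the divisibility conditions `p ∣ n u v` and of the
auxiliary conditions `e p u v = 1`, for primes `p > P`. -/
structure LocalDensities (n : ℤ → ℤ → ℕ) (e : ℕ → ℤ → ℤ → ℝ) (P k : ℕ) (κ C : ℝ) : Prop where
  two_le : 2 ≤ P
  nonneg : 0 ≤ κ
  periodic : ∀ p, p.Prime → P < p → PeriodicMod (p ^ 2) (dvdInd n p)
  periodic' : ∀ p, p.Prime → P < p → PeriodicMod (p ^ 2) (e p)
  zero_or_one : ∀ p, p.Prime → P < p → ∀ u v, e p u v = 0 ∨ e p u v = 1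
  le_half : ∀ p, p.Prime → P < p → residueMean (p ^ 2) (dvdInd n p) ≤ 1 / 2
  le_div : ∀ p, p.Prime → P < p → residueMean (p ^ 2) (dvdInd n p) ≤ κ / p
  le_div' : ∀ p, p.Prime → P < p → residueMean (p ^ 2) (e p) ≤ κ / p
  sum_le : ∀ z, 2 ≤ z → ∑ p ∈ goodPrimes P z,
    (2 * residueMean (p ^ 2) (e p) - residueMean (p ^ 2) (dvdInd n p))
      ≤ k * Real.log (Real.log z) + C

theorem dvdInd_zero_or_one (n : ℤ → ℤ → ℕ) (p : ℕ) (u v : ℤ) :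
    dvdInd n p u v = 0 ∨ dvdInd n p u v = 1 := by
  unfold dvdInd
  split_ifs <;> simp

namespace LocalDensities

variable {n : ℤ → ℤ → ℕ} {e : ℕ → ℤ → ℤ → ℝ} {P k : ℕ} {κ C : ℝ}

theorem mean_nonneg (h : LocalDensities n e P k κ C) {p : ℕ} (hp : p.Prime) (hP : P < p) :
    0 ≤ residueMean (p ^ 2) (e p) :=
  residueMean_nonneg fun u v => by rcases h.zero_or_one p hp hP u v with h | h <;> simp [h]

theorem prod_le (h : LocalDensities n e P k κ C) {B : ℝ} {z : ℕ} (hz : 2 ≤ z) {β : ℝ}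
    (hβ : 0 ≤ β) (hβB : β * Real.log z ≤ B) :
    ∏ p ∈ goodPrimes P z, (2 * (p : ℝ) ^ β * residueMean (p ^ 2) (e p)
        + (1 - residueMean (p ^ 2) (dvdInd n p)))
      ≤ Real.exp (C + 6 * κ * B * Real.exp B) * Real.log z ^ k := by
  have hlz : 0 < Real.log z := Real.log_pos (by exact_mod_cast hz)
  have hκ := h.nonneg
  have hterm : ∀ p ∈ goodPrimes P z, 2 * (p : ℝ) ^ β * residueMean (p ^ 2) (e p)
        + (1 - residueMean (p ^ 2) (dvdInd n p))
      ≤ Real.exp ((2 * residueMean (p ^ 2) (e p) - residueMean (p ^ 2) (dvdInd n p))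
        + 2 * κ * Real.exp B * β * (Real.log p / p)) := by
    intro p hp
    obtain ⟨⟨hpz, hpp⟩, hP⟩ := mem_goodPrimes.1 hp
    have hp1 : (1 : ℝ) ≤ p := by exact_mod_cast hpp.one_le
    have hp0 : (0 : ℝ) < p := by linarith
    have hlp := Real.log_nonneg hp1
    have h1 := rpow_sub_one_le (p := p) (B := B) hp1 hβ
      ((mul_le_mul_of_nonneg_left (Real.log_le_log hp0 (by exact_mod_cast hpz)) hβ).trans hβB)
    have h2 := h.mean_nonneg hpp hP
    have h3 : ((p : ℝ) ^ β - 1) * residueMean (p ^ 2) (e p)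
        ≤ Real.exp B * (β * Real.log p) * (κ / p) :=
      (mul_le_mul_of_nonneg_right h1 h2).trans
        (mul_le_mul_of_nonneg_left (h.le_div' p hpp hP) (by positivity))
    have h4 : Real.exp B * (β * Real.log p) * (κ / p) = κ * Real.exp B * β * (Real.log p / p) := by
      field_simp
    have h5 := Real.add_one_le_exp ((2 * residueMean (p ^ 2) (e p)
      - residueMean (p ^ 2) (dvdInd n p)) + 2 * κ * Real.exp B * β * (Real.log p / p))
    linarith
  refine (Finset.prod_le_prod (fun p hp => ?_) hterm).trans ?_
  · obtain ⟨⟨hpz, hpp⟩, hP⟩ := mem_goodPrimes.1 hp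
    have h2 := h.mean_nonneg hpp hP
    have h3 := h.le_half p hpp hP
    have : 0 ≤ 2 * (p : ℝ) ^ β * residueMean (p ^ 2) (e p) := by positivity
    linarith
  rw [← Real.exp_sum, Finset.sum_add_distrib, ← Finset.mul_sum]
  have h8 : ∑ p ∈ goodPrimes P z, Real.log p / p ≤ 3 * Real.log z :=
    (Finset.sum_le_sum_of_subset_of_nonneg (Finset.filter_subset _ _) fun p _ _ =>
      div_nonneg (Real.log_natCast_nonneg p) (by positivity)).trans (sum_log_div_le_mul_log hz)
  have h9 : 2 * κ * Real.exp B * β * ∑ p ∈ goodPrimes P z, Real.log p / p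
      ≤ 6 * κ * B * Real.exp B := by
    calc _ ≤ 2 * κ * Real.exp B * β * (3 * Real.log z) := by gcongr
      _ = 6 * κ * Real.exp B * (β * Real.log z) := by ring
      _ ≤ 6 * κ * Real.exp B * B := by gcongr
      _ = _ := by ring
  have h10 : Real.log z ^ k = Real.exp (k * Real.log (Real.log z)) := by
    rw [mul_comm, Real.exp_mul, Real.exp_log hlz, Real.rpow_natCast]
  rw [h10, ← Real.exp_add]
  have := h.sum_le z hz
  exact Real.exp_le_exp.2 (by linarith)

end LocalDensities

theorem sum_le_sum_card_mul {α ι : Type*} [DecidableEq α] {B : Finset α} {I : Finset ι}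
    {w : α → ℝ} {S : ι → Finset α} {b : ι → ℝ} (hS : ∀ x ∈ B, ∃ i ∈ I, x ∈ S i)
    (hb : ∀ i ∈ I, 0 ≤ b i) (hw : ∀ i ∈ I, ∀ x ∈ S i, w x ≤ b i) :
    ∑ x ∈ B, w x ≤ ∑ i ∈ I, b i * (S i).card := by
  have h1 : ∀ x ∈ B, w x ≤ ∑ i ∈ I, if x ∈ S i then b i else 0 := by
    intro x hx
    obtain ⟨i, hi, hxi⟩ := hS x hx
    have h := Finset.single_le_sum (f := fun i => if x ∈ S i then b i else 0) (s := I)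
      (fun j hj => by split_ifs; exacts [hb j hj, le_rfl]) hi
    simp only [hxi, if_true] at h
    exact (hw i hi x hxi).trans h
  refine (Finset.sum_le_sum h1).trans ?_
  rw [Finset.sum_comm]
  refine Finset.sum_le_sum fun i hi => ?_
  rw [← Finset.sum_filter, Finset.sum_const, nsmul_eq_mul, mul_comm]
  refine mul_le_mul_of_nonneg_left ?_ (hb i hi)
  exact_mod_cast Finset.card_le_card fun x hx => (Finset.mem_filter.1 hx).2

theorem two_pow_card_primeFactors_le {m P z : ℕ} {R : ℝ} (hm : m ≠ 0) (hz : 2 ≤ z)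
    (hR : Real.log m ≤ R) :
    (2 : ℝ) ^ m.primeFactors.card
      ≤ 2 ^ P * 2 ^ ((goodPrimes P z).filter (· ∣ m)).card * (2 : ℝ) ^ (R / Real.log z) := by
  have hlz : 0 < Real.log z := Real.log_pos (by exact_mod_cast hz)
  set Q := m.primeFactors.filter (z < ·) with hQ
  have hsub : m.primeFactors ⊆ Finset.Ioc 0 P ∪ (goodPrimes P z).filter (· ∣ m) ∪ Q := by
    intro p hp
    have hpp := Nat.prime_of_mem_primeFactors hp
    simp only [Finset.mem_union, Finset.mem_Ioc, Finset.mem_filter, mem_goodPrimes, hQ, hp,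
      true_and, hpp, Nat.dvd_of_mem_primeFactors hp, and_true]
    have := hpp.pos
    omega
  have hcard : m.primeFactors.card ≤ P + ((goodPrimes P z).filter (· ∣ m)).card + Q.card := by
    refine (Finset.card_le_card hsub).trans ((Finset.card_union_le _ _).trans ?_)
    gcongr
    refine (Finset.card_union_le _ _).trans ?_
    simp
  have hQc : (Q.card : ℝ) ≤ R / Real.log z := by
    rw [le_div_iff₀ hlz]
    calc (Q.card : ℝ) * Real.log z = ∑ p ∈ Q, Real.log z := by rw [Finset.sum_const, nsmul_eq_mul]
      _ ≤ ∑ p ∈ Q, Real.log p := Finset.sum_le_sum fun p hp => by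
        refine Real.log_le_log (by positivity) ?_
        exact_mod_cast (Finset.mem_filter.1 hp).2.le
      _ ≤ ∑ p ∈ m.primeFactors, Real.log p :=
        Finset.sum_le_sum_of_subset_of_nonneg (Finset.filter_subset _ _) fun p _ _ =>
          Real.log_natCast_nonneg p
      _ ≤ R := (sum_log_primeFactors_le_log hm).trans hR
  calc (2 : ℝ) ^ m.primeFactors.card
      ≤ 2 ^ (P + ((goodPrimes P z).filter (· ∣ m)).card + Q.card) :=
        pow_le_pow_right₀ (by norm_num) hcard
    _ = 2 ^ P * 2 ^ ((goodPrimes P z).filter (· ∣ m)).card * (2 : ℝ) ^ (Q.card : ℝ) := by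
        rw [pow_add, pow_add, Real.rpow_natCast]
    _ ≤ _ := by
        gcongr
        norm_num

theorem two_pow_card_le_prod {E : Finset ℕ} (hE : ∀ p ∈ E, p.Prime) : 2 ^ E.card ≤ ∏ p ∈ E, p := by
  rw [← Finset.prod_const]
  exact Finset.prod_le_prod' fun p hp => (hE p hp).two_le

namespace LocalDensities

variable {n : ℤ → ℤ → ℕ} {e : ℕ → ℤ → ℤ → ℝ} {P k : ℕ} {κ C : ℝ}

theorem card_le (h : LocalDensities n e P k κ C) {s : ℝ} (hs : 18 * κ + 1 ≤ s) {z L M N : ℕ}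
    (hz : 2 ≤ z) (hM : 1 ≤ M) (hMN : M ≤ N) (hL : 1 ≤ L)
    (hLz : s * Real.log z ≤ Real.log (L + 1)) {T E : Finset ℕ} (hT : T ⊆ goodPrimes P z)
    (hE : ∀ p ∈ E, p.Prime ∧ P < p) (hTE : Disjoint T E) {A : Finset (ℤ × ℤ)}
    (hA : A ⊆ intBox M N) (hA1 : ∀ x ∈ A, ∀ p ∈ E, e p x.1 x.2 = 1)
    (hA2 : ∀ x ∈ A, ∀ p ∈ T, ¬ p ∣ n x.1 x.2) :
    (A.card : ℝ) ≤ 18 * (M * N) * (∏ p ∈ E, residueMean (p ^ 2) (e p))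
        * ∏ p ∈ T, (1 - residueMean (p ^ 2) (dvdInd n p))
      + 12 * N * ((∏ p ∈ E, p : ℕ) : ℝ) ^ 2 * (L : ℝ) ^ 6 := by
  have hT' : ∀ p ∈ T, (p ≤ z ∧ p.Prime) ∧ P < p := fun p hp => mem_goodPrimes.1 (hT hp)
  have h1 := card_le_of_sieve (D := dvdInd n) (e := e) (T := T) (E := E) (κ := κ) (s := s) hz
    (fun p hp => ⟨(hT' p hp).1.2, (hT' p hp).1.1⟩) (fun p hp => (hE p hp).1) hTE
    (fun p hp => h.periodic p (hT' p hp).1.2 (hT' p hp).2)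
    (fun p hp => h.periodic' p (hE p hp).1 (hE p hp).2)
    (fun p _ => dvdInd_zero_or_one n p)
    (fun p hp => h.zero_or_one p (hE p hp).1 (hE p hp).2)
    (fun p hp => h.le_half p (hT' p hp).1.2 (hT' p hp).2)
    (fun p hp => h.le_div p (hT' p hp).1.2 (hT' p hp).2) h.nonneg hM hMN hL hs hLz hA hA1
    (fun x hx p hp => if_neg (hA2 x hx p hp))
  refine h1.trans (add_le_add_left ?_ _)
  have hM' : (1 : ℝ) ≤ M := by exact_mod_cast hM
  have hN' : (1 : ℝ) ≤ N := by exact_mod_cast hM.trans hMN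
  have h0 : 0 ≤ ∏ p ∈ E, residueMean (p ^ 2) (e p) :=
    Finset.prod_nonneg fun p hp => h.mean_nonneg (hE p hp).1 (hE p hp).2
  have h0' : 0 ≤ ∏ p ∈ T, (1 - residueMean (p ^ 2) (dvdInd n p)) :=
    Finset.prod_nonneg fun p hp => by
      have := h.le_half p (hT' p hp).1.2 (hT' p hp).2
      linarith
  have h2 : 2 * ((2 * (M : ℝ) + 1) * (2 * N + 1)) ≤ 18 * (M * N) := by
    have : (2 * (M : ℝ) + 1) * (2 * N + 1) ≤ (3 * M) * (3 * N) := by gcongr <;> linarith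
    linarith
  gcongr

theorem sum_smallSubsets_le (h : LocalDensities n e P k κ C) {B : ℝ} {z : ℕ}
    (hz : 2 ≤ z) {β : ℝ} (hβ : 0 ≤ β) (hβB : β * Real.log z ≤ B) (I : Finset (Finset ℕ))
    (hI : I ⊆ (goodPrimes P z).powerset) :
    ∑ E ∈ I, (2 : ℝ) ^ E.card * ((∏ p ∈ E, p : ℕ) : ℝ) ^ β
        * ((∏ p ∈ E, residueMean (p ^ 2) (e p))
          * ∏ p ∈ goodPrimes P z \ E, (1 - residueMean (p ^ 2) (dvdInd n p)))
      ≤ Real.exp (C + 6 * κ * B * Real.exp B) * Real.log z ^ k := by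
  refine le_trans ?_ (h.prod_le hz hβ hβB)
  rw [Finset.prod_add]
  have heq : ∀ E : Finset ℕ, (2 : ℝ) ^ E.card * ((∏ p ∈ E, p : ℕ) : ℝ) ^ β
        * ((∏ p ∈ E, residueMean (p ^ 2) (e p))
          * ∏ p ∈ goodPrimes P z \ E, (1 - residueMean (p ^ 2) (dvdInd n p)))
      = (∏ p ∈ E, 2 * (p : ℝ) ^ β * residueMean (p ^ 2) (e p))
        * ∏ p ∈ goodPrimes P z \ E, (1 - residueMean (p ^ 2) (dvdInd n p)) := by
    intro E
    rw [Finset.prod_mul_distrib, Finset.prod_mul_distrib, Finset.prod_const,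
      Real.finsetProd_rpow _ _ fun p _ => by positivity]
    push_cast
    ring
  simp only [heq]
  refine Finset.sum_le_sum_of_subset_of_nonneg hI fun E hE _ => mul_nonneg ?_ ?_
  · refine Finset.prod_nonneg fun p hp => ?_
    obtain ⟨⟨-, hpp⟩, hP⟩ := mem_goodPrimes.1 (Finset.mem_powerset.1 hE hp)
    have := h.mean_nonneg hpp hP
    positivity
  · refine Finset.prod_nonneg fun p hp => ?_
    obtain ⟨⟨-, hpp⟩, hP⟩ := mem_goodPrimes.1 (Finset.mem_sdiff.1 hp).1
    have := h.le_half p hpp hP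
    linarith

/-- The contribution of the points whose `W`-smooth part is small. -/
theorem sum_le_of_small (h : LocalDensities n e P k κ C) {s : ℝ} (hs : 18 * κ + 1 ≤ s)
    {W L M N : ℕ} (hW : 2 ≤ W) (hM : 1 ≤ M) (hMN : M ≤ N) (hL : 1 ≤ L)
    (hLW : s * Real.log W ≤ Real.log (L + 1)) {R : ℝ} {B : Finset (ℤ × ℤ)} (hB : B ⊆ intBox M N)
    {w : ℤ × ℤ → ℝ} (hn : ∀ x ∈ B, n x.1 x.2 ≠ 0 ∧ Real.log (n x.1 x.2) ≤ R)
    (hw : ∀ x ∈ B, w x ≤ 2 ^ (n x.1 x.2).primeFactors.card)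
    (he : ∀ x ∈ B, ∀ p, p.Prime → P < p → p ∣ n x.1 x.2 → e p x.1 x.2 = 1)
    (hsmall : ∀ x ∈ B, ∏ p ∈ (goodPrimes P W).filter (· ∣ n x.1 x.2), p ≤ L) :
    ∑ x ∈ B, w x ≤ 2 ^ P * (2 : ℝ) ^ (R / Real.log W)
      * (18 * (M * N) * (Real.exp C * Real.log W ^ k) + 12 * N * (L : ℝ) ^ 10) := by
  set I := smallSubsets (goodPrimes P W) L with hI
  set b : Finset ℕ → ℝ := fun E => 2 ^ P * 2 ^ E.card * (2 : ℝ) ^ (R / Real.log W) with hb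
  set S : Finset ℕ → Finset (ℤ × ℤ) := fun E =>
    B.filter fun x => (goodPrimes P W).filter (· ∣ n x.1 x.2) = E with hS
  have h1 : ∑ x ∈ B, w x ≤ ∑ E ∈ I, b E * (S E).card := by
    refine sum_le_sum_card_mul (fun x hx => ?_) (fun E _ => by positivity) fun E _ x hx => ?_
    · exact ⟨(goodPrimes P W).filter (· ∣ n x.1 x.2),
        mem_smallSubsets.2 ⟨Finset.filter_subset _ _, hsmall x hx⟩,
        Finset.mem_filter.2 ⟨hx, rfl⟩⟩
    · obtain ⟨hxB, hxE⟩ := Finset.mem_filter.1 hx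
      refine (hw x hxB).trans ?_
      have := two_pow_card_primeFactors_le (P := P) (hn x hxB).1 hW (hn x hxB).2
      rwa [hxE] at this
  have hE : ∀ E ∈ I, E ⊆ goodPrimes P W ∧ ∏ p ∈ E, p ≤ L := fun E hE => mem_smallSubsets.1 hE
  have hEp : ∀ E ∈ I, ∀ p ∈ E, p.Prime ∧ P < p := fun E hE' p hp => by
    obtain ⟨⟨-, a⟩, b⟩ := mem_goodPrimes.1 ((hE E hE').1 hp)
    exact ⟨a, b⟩
  have h2 : ∀ E ∈ I, b E * (S E).card ≤ 2 ^ P * (2 : ℝ) ^ (R / Real.log W) *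
      (18 * (M * N) * (2 ^ E.card * ((∏ p ∈ E, p : ℕ) : ℝ) ^ (0 : ℝ)
        * ((∏ p ∈ E, residueMean (p ^ 2) (e p))
          * ∏ p ∈ goodPrimes P W \ E, (1 - residueMean (p ^ 2) (dvdInd n p))))
        + 12 * N * (L : ℝ) ^ 9) := by
    intro E hEI
    have h3 := h.card_le hs hW hM hMN hL hLW (T := goodPrimes P W \ E) (E := E)
      Finset.sdiff_subset (hEp E hEI) Finset.sdiff_disjoint (A := S E)
      ((Finset.filter_subset _ _).trans hB)
      (fun x hx p hp => by
        obtain ⟨hxB, hxE⟩ := Finset.mem_filter.1 hx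
        rw [← hxE] at hp
        exact he x hxB p (hEp E hEI p (hxE ▸ hp)).1 (hEp E hEI p (hxE ▸ hp)).2
          (Finset.mem_filter.1 hp).2)
      (fun x hx p hp hdvd => by
        obtain ⟨hxB, hxE⟩ := Finset.mem_filter.1 hx
        obtain ⟨hp1, hp2⟩ := Finset.mem_sdiff.1 hp
        exact hp2 (hxE ▸ Finset.mem_filter.2 ⟨hp1, hdvd⟩))
    have hEL : ((∏ p ∈ E, p : ℕ) : ℝ) ≤ L := by exact_mod_cast (hE E hEI).2
    have h2E : (2 : ℝ) ^ E.card ≤ L := by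
      have := (two_pow_card_le_prod fun p hp => (hEp E hEI p hp).1).trans (hE E hEI).2
      exact_mod_cast this
    have h4 : 12 * (N : ℝ) * ((∏ p ∈ E, p : ℕ) : ℝ) ^ 2 * (L : ℝ) ^ 6 * 2 ^ E.card
        ≤ 12 * N * (L : ℝ) ^ 2 * (L : ℝ) ^ 6 * L := by gcongr
    rw [Real.rpow_zero]
    calc b E * (S E).card ≤ b E * _ := mul_le_mul_of_nonneg_left h3 (by positivity)
      _ = 2 ^ P * (2 : ℝ) ^ (R / Real.log W) * (18 * (M * N) * (2 ^ E.card * 1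
          * ((∏ p ∈ E, residueMean (p ^ 2) (e p))
          * ∏ p ∈ goodPrimes P W \ E, (1 - residueMean (p ^ 2) (dvdInd n p))))
          + 12 * (N : ℝ) * ((∏ p ∈ E, p : ℕ) : ℝ) ^ 2 * (L : ℝ) ^ 6 * 2 ^ E.card) := by
          simp only [hb]; ring
      _ ≤ _ := by
          refine mul_le_mul_of_nonneg_left ?_ (by positivity)
          have : 12 * N * (L : ℝ) ^ 2 * (L : ℝ) ^ 6 * L = 12 * N * (L : ℝ) ^ 9 := by ring
          linarith
  refine h1.trans ((Finset.sum_le_sum h2).trans ?_)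
  rw [← Finset.mul_sum, Finset.sum_add_distrib, ← Finset.mul_sum, Finset.sum_const, nsmul_eq_mul]
  refine mul_le_mul_of_nonneg_left ?_ (by positivity)
  have h5 := h.sum_smallSubsets_le (B := 0) hW le_rfl (by simp) I (Finset.filter_subset _ _)
  have h6 : (I.card : ℝ) ≤ L := by
    exact_mod_cast card_smallSubsets_le (fun p hp => (mem_goodPrimes.1 hp).1.2) L
  simp only [mul_zero, zero_mul, add_zero] at h5
  have h7 : (I.card : ℝ) * (12 * N * (L : ℝ) ^ 9) ≤ L * (12 * N * (L : ℝ) ^ 9) := by gcongr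
  have h8 : 18 * ((M : ℝ) * N) * ∑ E ∈ I, 2 ^ E.card * ((∏ p ∈ E, p : ℕ) : ℝ) ^ (0 : ℝ)
        * ((∏ p ∈ E, residueMean (p ^ 2) (e p))
          * ∏ p ∈ goodPrimes P W \ E, (1 - residueMean (p ^ 2) (dvdInd n p)))
      ≤ 18 * (M * N) * (Real.exp C * Real.log W ^ k) :=
    mul_le_mul_of_nonneg_left h5 (by positivity)
  linarith

end LocalDensities

theorem filter_goodPrimes_succ (P z : ℕ) (Q : ℕ → Prop) [DecidablePred Q] :
    (goodPrimes P (z + 1)).filter Q = if (z + 1).Prime ∧ P < z + 1 ∧ Q (z + 1)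
      then insert (z + 1) ((goodPrimes P z).filter Q) else (goodPrimes P z).filter Q := by
  ext p
  split_ifs with h
  · simp only [Finset.mem_filter, mem_goodPrimes, Finset.mem_insert]
    constructor
    · rintro ⟨⟨⟨h1, h2⟩, h3⟩, h4⟩
      rcases Nat.lt_or_ge z p with h5 | h5
      · left; omega
      · exact Or.inr ⟨⟨⟨h5, h2⟩, h3⟩, h4⟩
    · rintro (rfl | ⟨⟨⟨h1, h2⟩, h3⟩, h4⟩)
      · exact ⟨⟨⟨le_rfl, h.1⟩, h.2.1⟩, h.2.2⟩
      · exact ⟨⟨⟨by omega, h2⟩, h3⟩, h4⟩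
  · simp only [Finset.mem_filter, mem_goodPrimes]
    constructor
    · rintro ⟨⟨⟨h1, h2⟩, h3⟩, h4⟩
      refine ⟨⟨⟨?_, h2⟩, h3⟩, h4⟩
      rcases Nat.lt_or_ge z p with h5 | h5
      · have : p = z + 1 := by omega
        subst this
        exact absurd ⟨h2, h3, h4⟩ h
      · exact h5
    · rintro ⟨⟨⟨h1, h2⟩, h3⟩, h4⟩
      exact ⟨⟨⟨by omega, h2⟩, h3⟩, h4⟩

theorem exists_first_prime_exceeding {P W L m : ℕ} (hL : 1 ≤ L)
    (h : L < ∏ p ∈ (goodPrimes P W).filter (· ∣ m), p) :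
    ∃ q ∈ goodPrimes P W, q ∣ m ∧ ∏ p ∈ (goodPrimes P (q - 1)).filter (· ∣ m), p ≤ L ∧
      L < q * ∏ p ∈ (goodPrimes P (q - 1)).filter (· ∣ m), p := by
  induction W with
  | zero =>
    have : goodPrimes P 0 = ∅ := by
      ext p
      simp only [mem_goodPrimes, Finset.notMem_empty, iff_false]
      omega
    simp [this] at h
    omega
  | succ z ih =>
    have hmono : goodPrimes P z ⊆ goodPrimes P (z + 1) := fun p hp => by
      rw [mem_goodPrimes] at hp ⊢
      exact ⟨⟨by omega, hp.1.2⟩, hp.2⟩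
    by_cases hz : L < ∏ p ∈ (goodPrimes P z).filter (· ∣ m), p
    · obtain ⟨q, h1, h2⟩ := ih hz
      exact ⟨q, hmono h1, h2⟩
    · rw [filter_goodPrimes_succ] at h
      split_ifs at h with hc
      · rw [Finset.prod_insert (by simp [mem_goodPrimes])] at h
        exact ⟨z + 1, mem_goodPrimes.2 ⟨⟨le_rfl, hc.1⟩, hc.2.1⟩, hc.2.2, not_lt.1 hz, h⟩
      · exact absurd h hz

theorem exp_neg_le_inv {t : ℝ} (ht : 0 < t) : Real.exp (-t) ≤ t⁻¹ := by
  rw [Real.exp_neg]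
  exact inv_anti₀ ht (by have := Real.add_one_le_exp t; linarith)

namespace LocalDensities

variable {n : ℤ → ℤ → ℕ} {e : ℕ → ℤ → ℤ → ℝ} {P k : ℕ} {κ C : ℝ}

/-- The weight factor of Rankin's trick for a point whose smooth part first exceeds `L` at `q`. -/
theorem rankin_weight_le {A δ ℓ q Q L : ℝ} (hA : 0 ≤ A) (hδ : 0 < δ) (hℓ : 0 < ℓ) (hq : 1 < q)
    (hL : 0 < L) (hLδ : δ * ℓ ≤ Real.log L) (hQ : 0 < Q) (hLQ : L ≤ q * Q) :
    (2 : ℝ) ^ (A * ℓ / Real.log q)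
      ≤ Real.exp ((A + 1) / δ) * (Real.log q / ℓ) * Q ^ ((A + 1) / δ / Real.log q) := by
  have hlq : 0 < Real.log q := Real.log_pos hq
  have h1 : (2 : ℝ) ^ (A * ℓ / Real.log q) ≤ Real.exp (A * ℓ / Real.log q) := by
    rw [Real.rpow_def_of_pos (by norm_num)]
    apply Real.exp_le_exp.2
    have : Real.log 2 ≤ 1 := by have := Real.log_two_lt_d9; linarith
    exact mul_le_of_le_one_left (by positivity) this
  refine h1.trans ?_
  have h2 : Real.log q / ℓ ≥ Real.exp (-(ℓ / Real.log q)) := by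
    have := exp_neg_le_inv (t := ℓ / Real.log q) (by positivity)
    rwa [inv_div] at this
  have h3 : Real.log L ≤ Real.log q + Real.log Q := by
    rw [← Real.log_mul (by linarith) hQ.ne']
    exact Real.log_le_log hL hLQ
  have h4 : Q ^ ((A + 1) / δ / Real.log q) = Real.exp (Real.log Q * ((A + 1) / δ / Real.log q)) :=
    Real.rpow_def_of_pos hQ _
  rw [h4]
  calc Real.exp (A * ℓ / Real.log q) ≤ Real.exp ((A + 1) / δ + -(ℓ / Real.log q)
        + Real.log Q * ((A + 1) / δ / Real.log q)) := by
        apply Real.exp_le_exp.2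
        have h5 : (A + 1) / δ / Real.log q * (δ * ℓ) ≤
            (A + 1) / δ / Real.log q * (Real.log q + Real.log Q) :=
          mul_le_mul_of_nonneg_left (hLδ.trans h3) (by positivity)
        have h6 : (A + 1) / δ / Real.log q * (δ * ℓ) = A * ℓ / Real.log q + ℓ / Real.log q := by
          field_simp
        have h7 : (A + 1) / δ / Real.log q * (Real.log q + Real.log Q) = (A + 1) / δ
            + Real.log Q * ((A + 1) / δ / Real.log q) := by
          field_simp
        linarith
    _ = Real.exp ((A + 1) / δ) * Real.exp (-(ℓ / Real.log q))
        * Real.exp (Real.log Q * ((A + 1) / δ / Real.log q)) := by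
        rw [Real.exp_add, Real.exp_add]
    _ ≤ _ := by gcongr

set_option maxHeartbeats 1000000 in
/-- The contribution of the points whose `W`-smooth part is large. -/
theorem sum_le_of_large (h : LocalDensities n e P k κ C) {s : ℝ} (hs : 18 * κ + 1 ≤ s)
    {W L M N : ℕ} (hM : 2 ≤ M) (hMN : M ≤ N) (hL : 1 ≤ L) (hWM : W ≤ M)
    (hLW : s * Real.log W ≤ Real.log (L + 1)) {A δ K : ℝ} (hA : 0 ≤ A) (hδ : 0 < δ)
    (hLδ : δ * Real.log M ≤ Real.log (L + 1))
    (hK0 : 0 ≤ K) (hK : ∀ q : ℕ, 2 ≤ q → Real.log (L + 1) ≤ Real.log 4 * q →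
      (2 : ℝ) ^ (A * Real.log M / Real.log q) ≤ K) {B : Finset (ℤ × ℤ)} (hB : B ⊆ intBox M N)
    {w : ℤ × ℤ → ℝ}
    (hn : ∀ x ∈ B, n x.1 x.2 ≠ 0 ∧ Real.log (n x.1 x.2) ≤ A * Real.log M)
    (hw : ∀ x ∈ B, w x ≤ 2 ^ (n x.1 x.2).primeFactors.card)
    (he : ∀ x ∈ B, ∀ p, p.Prime → P < p → p ∣ n x.1 x.2 → e p x.1 x.2 = 1)
    (hlarge : ∀ x ∈ B, L < ∏ p ∈ (goodPrimes P W).filter (· ∣ n x.1 x.2), p) :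
    ∑ x ∈ B, w x ≤ 2 ^ (P + 1) *
      (54 * κ * Real.exp ((A + 1) / δ)
        * Real.exp (C + 6 * κ * ((A + 1) / δ) * Real.exp ((A + 1) / δ))
        * (M * N) * Real.log M ^ k + 12 * K * N * (W : ℝ) ^ 3 * (L : ℝ) ^ 10) := by
  have hM1 : (1 : ℝ) < M := by exact_mod_cast hM
  have hlM : 0 < Real.log M := Real.log_pos hM1
  have hκ := h.nonneg
  set R := A * Real.log M with hR
  set b₀ := (A + 1) / δ with hb₀
  have hb₀0 : 0 < b₀ := by positivity
  set Γ := Real.exp (C + 6 * κ * b₀ * Real.exp b₀) with hΓ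
  set Sm : ℕ → Finset (Finset ℕ) := fun q =>
    (smallSubsets (goodPrimes P (q - 1)) L).filter fun E => L < q * ∏ p ∈ E, p with hSm
  set I : Finset (Σ _ : ℕ, Finset ℕ) := (goodPrimes P W).sigma Sm with hI
  set b : (Σ _ : ℕ, Finset ℕ) → ℝ := fun i =>
    2 ^ P * 2 ^ (i.2.card + 1) * (2 : ℝ) ^ (R / Real.log i.1) with hb
  set S : (Σ _ : ℕ, Finset ℕ) → Finset (ℤ × ℤ) := fun i => B.filter fun x =>
    (goodPrimes P (i.1 - 1)).filter (· ∣ n x.1 x.2) = i.2 ∧ i.1 ∣ n x.1 x.2 with hS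
  have hq : ∀ q ∈ goodPrimes P W, q.Prime ∧ P < q ∧ 3 ≤ q ∧ q ≤ W := fun q hq => by
    obtain ⟨⟨a, b⟩, c⟩ := mem_goodPrimes.1 hq
    have := h.two_le
    exact ⟨b, c, by omega, a⟩
  have h1 : ∑ x ∈ B, w x ≤ ∑ i ∈ I, b i * (S i).card := by
    refine sum_le_sum_card_mul (fun x hx => ?_) (fun i _ => by positivity) fun i hi x hx => ?_
    · obtain ⟨q, hq1, hq2, hq3, hq4⟩ := exists_first_prime_exceeding hL (hlarge x hx)
      exact ⟨⟨q, _⟩, Finset.mem_sigma.2 ⟨hq1, Finset.mem_filter.2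
        ⟨mem_smallSubsets.2 ⟨Finset.filter_subset _ _, hq3⟩, hq4⟩⟩,
        Finset.mem_filter.2 ⟨hx, rfl, hq2⟩⟩
    · obtain ⟨hxB, hxE, -⟩ := Finset.mem_filter.1 hx
      obtain ⟨hi1, -⟩ := Finset.mem_sigma.1 hi
      obtain ⟨-, -, hq3, -⟩ := hq _ hi1
      refine (hw x hxB).trans ((two_pow_card_primeFactors_le (P := P) (z := i.1) (hn x hxB).1
        (by omega) (hn x hxB).2).trans ?_)
      have hc : ((goodPrimes P i.1).filter (· ∣ n x.1 x.2)).card ≤ i.2.card + 1 := by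
        obtain ⟨z, hz⟩ : ∃ z, i.1 = z + 1 := ⟨i.1 - 1, by omega⟩
        rw [← hxE, hz, filter_goodPrimes_succ, Nat.add_sub_cancel]
        split_ifs
        · exact Finset.card_insert_le _ _
        · omega
      simp only [hb]
      gcongr
      norm_num
  have hmem : ∀ q ∈ goodPrimes P W, ∀ E ∈ Sm q, E ⊆ goodPrimes P (q - 1) ∧ ∏ p ∈ E, p ≤ L ∧
      L < q * ∏ p ∈ E, p ∧ (∀ p ∈ E, p.Prime ∧ P < p) ∧ q ∉ E := by
    intro q hqq E hE
    obtain ⟨hE1, hE2⟩ := Finset.mem_filter.1 hE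
    obtain ⟨hE3, hE4⟩ := mem_smallSubsets.1 hE1
    refine ⟨hE3, hE4, hE2, fun p hp => ?_, fun hqE => ?_⟩
    · obtain ⟨⟨-, a⟩, b⟩ := mem_goodPrimes.1 (hE3 hp)
      exact ⟨a, b⟩
    · have := (mem_goodPrimes.1 (hE3 hqE)).1.1
      have := (hq q hqq).2.2.1
      omega
  have h2 : ∀ q ∈ goodPrimes P W, ∀ E ∈ Sm q, b ⟨q, E⟩ * (S ⟨q, E⟩).card ≤ 2 ^ (P + 1) *
      (18 * (M * N) * (κ * Real.exp b₀ / Real.log M) * (Real.log q / q)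
        * (2 ^ E.card * ((∏ p ∈ E, p : ℕ) : ℝ) ^ (b₀ / Real.log q)
          * ((∏ p ∈ E, residueMean (p ^ 2) (e p))
            * ∏ p ∈ goodPrimes P (q - 1) \ E, (1 - residueMean (p ^ 2) (dvdInd n p))))
        + 12 * K * N * (W : ℝ) ^ 2 * (L : ℝ) ^ 9) := by
    intro q hqq E hES
    obtain ⟨hqp, hqP, hq3, hqW⟩ := hq q hqq
    obtain ⟨hEsub, hEL, hLE, hEp, hqE⟩ := hmem q hqq E hES
    have hq1 : (1 : ℝ) < q := by exact_mod_cast hqp.one_lt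
    have hlq : 0 < Real.log q := Real.log_pos hq1
    have hEpos : 0 < ∏ p ∈ E, p := Finset.prod_pos fun p hp => (hEp p hp).1.pos
    have h3 := h.card_le hs (z := q) (by omega) (by omega) hMN hL
      ((mul_le_mul_of_nonneg_left (Real.log_le_log (by linarith) (by exact_mod_cast hqW))
        (by linarith)).trans hLW)
      (T := goodPrimes P (q - 1) \ E) (E := insert q E)
      (fun p hp => by
        obtain ⟨⟨a, b⟩, c⟩ := mem_goodPrimes.1 (Finset.mem_sdiff.1 hp).1
        exact mem_goodPrimes.2 ⟨⟨by omega, b⟩, c⟩)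
      (fun p hp => by
        rcases Finset.mem_insert.1 hp with rfl | hp
        · exact ⟨hqp, hqP⟩
        · exact hEp p hp)
      (Finset.disjoint_left.2 fun p hp hp' => by
        obtain ⟨hp1, hp2⟩ := Finset.mem_sdiff.1 hp
        rcases Finset.mem_insert.1 hp' with rfl | hp'
        · have := (mem_goodPrimes.1 hp1).1.1
          omega
        · exact hp2 hp')
      (A := S ⟨q, E⟩) ((Finset.filter_subset _ _).trans hB)
      (fun x hx p hp => by
        obtain ⟨hxB, hxE, hxq⟩ := Finset.mem_filter.1 hx
        rcases Finset.mem_insert.1 hp with rfl | hp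
        · exact he x hxB p hqp hqP hxq
        · have hp' := hp
          change _ = E at hxE
          rw [← hxE] at hp'
          exact he x hxB p (hEp p hp).1 (hEp p hp).2 (Finset.mem_filter.1 hp').2)
      (fun x hx p hp hdvd => by
        obtain ⟨hxB, hxE, -⟩ := Finset.mem_filter.1 hx
        obtain ⟨hp1, hp2⟩ := Finset.mem_sdiff.1 hp
        change _ = E at hxE
        exact hp2 (hxE ▸ Finset.mem_filter.2 ⟨hp1, hdvd⟩))
    rw [Finset.prod_insert hqE, Finset.prod_insert hqE] at h3
    have hEL' : ((∏ p ∈ E, p : ℕ) : ℝ) ≤ L := by exact_mod_cast hEL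
    have h2E : (2 : ℝ) ^ E.card ≤ L := by
      have := (two_pow_card_le_prod fun p hp => (hEp p hp).1).trans hEL
      exact_mod_cast this
    have hqW' : (q : ℝ) ≤ W := by exact_mod_cast hqW
    have hLE' : (L : ℝ) + 1 ≤ q * ((∏ p ∈ E, p : ℕ) : ℝ) := by exact_mod_cast hLE
    have hEpos' : (0 : ℝ) < ((∏ p ∈ E, p : ℕ) : ℝ) := by exact_mod_cast hEpos
    have hKq : (2 : ℝ) ^ (R / Real.log q) ≤ K := by
      refine hK q (by omega) ?_
      refine (Real.log_le_log (by positivity) hLE').trans ?_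
      have : (q : ℝ) * ((∏ p ∈ E, p : ℕ) : ℝ) = ∏ p ∈ insert q E, (p : ℝ) := by
        rw [Finset.prod_insert hqE, Nat.cast_prod]
      rw [this, Real.log_prod fun p hp => by
        rcases Finset.mem_insert.1 hp with rfl | hp
        · exact_mod_cast hqp.ne_zero
        · exact_mod_cast (hEp p hp).1.ne_zero]
      refine (Finset.sum_le_sum_of_subset_of_nonneg (fun p hp => ?_) fun p _ _ =>
        Real.log_natCast_nonneg p).trans (sum_log_primesUpTo_le q)
      rcases Finset.mem_insert.1 hp with rfl | hp
      · exact mem_primesUpTo.2 ⟨le_rfl, hqp⟩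
      · have := mem_goodPrimes.1 (hEsub hp)
        exact mem_primesUpTo.2 ⟨by omega, this.1.2⟩
    have hwt := rankin_weight_le hA hδ hlM hq1 (L := (L : ℝ) + 1) (by positivity) hLδ hEpos' hLE'
    rw [← hR, ← hb₀] at hwt
    set G := ∏ p ∈ E, residueMean (p ^ 2) (e p) with hG
    set H := ∏ p ∈ goodPrimes P (q - 1) \ E, (1 - residueMean (p ^ 2) (dvdInd n p)) with hH
    have hG0 : 0 ≤ G := Finset.prod_nonneg fun p hp => h.mean_nonneg (hEp p hp).1 (hEp p hp).2
    have hH0 : 0 ≤ H := Finset.prod_nonneg fun p hp => by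
      obtain ⟨⟨-, a⟩, c⟩ := mem_goodPrimes.1 (Finset.mem_sdiff.1 hp).1
      have := h.le_half p a c
      linarith
    have hgq0 := h.mean_nonneg hqp hqP
    have hgq := h.le_div' q hqp hqP
    have hmain : (2 : ℝ) ^ (R / Real.log q) * (18 * (M * N)
          * (residueMean (q ^ 2) (e q) * G) * H) * 2 ^ E.card
        ≤ (Real.exp b₀ * (Real.log q / Real.log M)
            * ((∏ p ∈ E, p : ℕ) : ℝ) ^ (b₀ / Real.log q)) * (18 * (M * N)
          * (κ / q * G) * H) * 2 ^ E.card := by gcongr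
    have herr : (2 : ℝ) ^ (R / Real.log q) * (12 * N * ((q * ∏ p ∈ E, p : ℕ) : ℝ) ^ 2
          * (L : ℝ) ^ 6) * 2 ^ E.card
        ≤ K * (12 * N * (W * L : ℝ) ^ 2 * (L : ℝ) ^ 6) * L := by
      rw [Nat.cast_mul]
      gcongr
    calc b ⟨q, E⟩ * (S ⟨q, E⟩).card ≤ b ⟨q, E⟩ * _ := mul_le_mul_of_nonneg_left h3 (by positivity)
      _ = 2 ^ (P + 1) * ((2 : ℝ) ^ (R / Real.log q) * (18 * (M * N)
          * (residueMean (q ^ 2) (e q) * G) * H) * 2 ^ E.card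
          + (2 : ℝ) ^ (R / Real.log q) * (12 * N * ((q * ∏ p ∈ E, p : ℕ) : ℝ) ^ 2
          * (L : ℝ) ^ 6) * 2 ^ E.card) := by
          simp only [hb]; ring
      _ ≤ 2 ^ (P + 1) * ((Real.exp b₀ * (Real.log q / Real.log M)
            * ((∏ p ∈ E, p : ℕ) : ℝ) ^ (b₀ / Real.log q)) * (18 * (M * N)
          * (κ / q * G) * H) * 2 ^ E.card + K * (12 * N * (W * L : ℝ) ^ 2 * (L : ℝ) ^ 6) * L) := by
          gcongr
      _ = _ := by ring
  have h3 : ∀ q ∈ goodPrimes P W, ∑ E ∈ Sm q, b ⟨q, E⟩ * (S ⟨q, E⟩).card ≤ 2 ^ (P + 1) *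
      (18 * (M * N) * (κ * Real.exp b₀ / Real.log M) * (Γ * Real.log M ^ k) * (Real.log q / q)
        + 12 * K * N * (W : ℝ) ^ 2 * (L : ℝ) ^ 10) := by
    intro q hqq
    obtain ⟨hqp, hqP, hq3, hqW⟩ := hq q hqq
    have hq1 : (1 : ℝ) < q := by exact_mod_cast hqp.one_lt
    have hlq : 0 < Real.log q := Real.log_pos hq1
    refine (Finset.sum_le_sum (h2 q hqq)).trans ?_
    rw [← Finset.mul_sum, Finset.sum_add_distrib, ← Finset.mul_sum, Finset.sum_const, nsmul_eq_mul]
    refine mul_le_mul_of_nonneg_left ?_ (by positivity)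
    have hlq' : Real.log ((q - 1 : ℕ) : ℝ) ≤ Real.log q := by
      refine Real.log_le_log ?_ (by exact_mod_cast Nat.sub_le q 1)
      exact_mod_cast (by omega : 0 < q - 1)
    have h5 := h.sum_smallSubsets_le (B := b₀) (z := q - 1) (by omega) (β := b₀ / Real.log q)
      (by positivity) (by
        refine (mul_le_mul_of_nonneg_left hlq' (by positivity)).trans ?_
        rw [div_mul_cancel₀ _ hlq.ne']) (Sm q)
      ((Finset.filter_subset _ _).trans (Finset.filter_subset _ _))
    have h6 : Real.log ((q - 1 : ℕ) : ℝ) ^ k ≤ Real.log M ^ k := by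
      refine pow_le_pow_left₀ (Real.log_natCast_nonneg _) (hlq'.trans ?_) k
      exact Real.log_le_log (by linarith) (by exact_mod_cast hqW.trans hWM)
    have h7 := h5.trans (mul_le_mul_of_nonneg_left h6 (Real.exp_pos _).le)
    have h8 : ((Sm q).card : ℝ) ≤ L := by
      exact_mod_cast (Finset.card_le_card (Finset.filter_subset _ _)).trans
        (card_smallSubsets_le (fun p hp => (mem_goodPrimes.1 hp).1.2) L)
    have h9 : ((Sm q).card : ℝ) * (12 * K * N * (W : ℝ) ^ 2 * (L : ℝ) ^ 9)
        ≤ L * (12 * K * N * (W : ℝ) ^ 2 * (L : ℝ) ^ 9) := by gcongr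
    have h10 := mul_le_mul_of_nonneg_left h7 (by positivity :
      0 ≤ 18 * ((M : ℝ) * N) * (κ * Real.exp b₀ / Real.log M) * (Real.log q / q))
    linarith
  refine h1.trans ?_
  rw [hI, Finset.sum_sigma]
  refine (Finset.sum_le_sum h3).trans ?_
  rw [← Finset.mul_sum, Finset.sum_add_distrib, ← Finset.mul_sum, Finset.sum_const, nsmul_eq_mul]
  refine mul_le_mul_of_nonneg_left ?_ (by positivity)
  have h4 : ∑ q ∈ goodPrimes P W, Real.log q / q ≤ 3 * Real.log M :=
    (Finset.sum_le_sum_of_subset_of_nonneg (fun q hqq => mem_primesUpTo.2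
      ⟨(hq q hqq).2.2.2.trans hWM, (hq q hqq).1⟩) fun p _ _ =>
      div_nonneg (Real.log_natCast_nonneg p) (by positivity)).trans (sum_log_div_le_mul_log hM)
  have h5 : ((goodPrimes P W).card : ℝ) ≤ W := by
    have : (goodPrimes P W).card ≤ (Finset.Ioc 0 W).card := Finset.card_le_card fun q hqq =>
      Finset.mem_Ioc.2 ⟨(hq q hqq).1.pos, (hq q hqq).2.2.2⟩
    rw [Nat.card_Ioc] at this
    exact_mod_cast this
  have h6 : ((goodPrimes P W).card : ℝ) * (12 * K * N * (W : ℝ) ^ 2 * (L : ℝ) ^ 10)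
      ≤ W * (12 * K * N * (W : ℝ) ^ 2 * (L : ℝ) ^ 10) := by gcongr
  have h7 : 18 * ((M : ℝ) * N) * (κ * Real.exp b₀ / Real.log M) * (Γ * Real.log M ^ k)
      * ∑ q ∈ goodPrimes P W, Real.log q / q
      ≤ 18 * ((M : ℝ) * N) * (κ * Real.exp b₀ / Real.log M) * (Γ * Real.log M ^ k)
        * (3 * Real.log M) := by gcongr
  have h8 : 18 * ((M : ℝ) * N) * (κ * Real.exp b₀ / Real.log M) * (Γ * Real.log M ^ k)
        * (3 * Real.log M) = 54 * κ * Real.exp b₀ * Γ * (M * N) * Real.log M ^ k := by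
    field_simp
    ring
  linarith

/-- A Nair–Tenenbaum type bound for sums of weights over the lattice points of a box. -/
theorem exists_sum_le (h : LocalDensities n e P k κ C) {A : ℝ} (hA : 0 ≤ A) :
    ∃ C' : ℝ, 0 < C' ∧ ∃ M₀ : ℕ, ∀ M N : ℕ, M₀ ≤ M → M ≤ N → ∀ B ⊆ intBox M N, ∀ w : ℤ × ℤ → ℝ,
      (∀ x ∈ B, n x.1 x.2 ≠ 0 ∧ Real.log (n x.1 x.2) ≤ A * Real.log M) →
      (∀ x ∈ B, w x ≤ 2 ^ (n x.1 x.2).primeFactors.card) →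
      (∀ x ∈ B, ∀ p, p.Prime → P < p → p ∣ n x.1 x.2 → e p x.1 x.2 = 1) →
      ∑ x ∈ B, w x ≤ C' * (M * N * (1 + Real.log M) ^ k) := by
  have hκ := h.nonneg
  set δ : ℝ := 1 / 16 with hδ
  set s : ℝ := 18 * κ + 1 with hs
  have hs1 : 1 ≤ s := by rw [hs]; linarith
  set η : ℝ := δ / s with hη
  have hη0 : 0 < η := by rw [hη, hδ]; positivity
  have hηδ : η ≤ δ := div_le_self (by norm_num [hδ]) hs1
  set Λ : ℝ := max 1 (max (2 / η) (2 * Real.exp (A / δ) / δ)) with hΛ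
  set c₀ : ℝ := 2 ^ P * (2 : ℝ) ^ (2 * A / η) * (18 * Real.exp C + 12) with hc₀
  set c₁ : ℝ := 2 ^ (P + 1) * (54 * κ * Real.exp ((A + 1) / δ)
        * Real.exp (C + 6 * κ * ((A + 1) / δ) * Real.exp ((A + 1) / δ)) + 12) with hc₁
  refine ⟨c₀ + c₁, by positivity, ⌈Real.exp Λ⌉₊, fun M N hM₀ hMN B hB w hn hw he => ?_⟩
  have hMΛ : Real.exp Λ ≤ M := (Nat.le_ceil _).trans (by exact_mod_cast hM₀)
  have hM0 : (0 : ℝ) < M := (Real.exp_pos Λ).trans_le hMΛ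
  have hlM : Λ ≤ Real.log M := (Real.le_log_iff_exp_le hM0).2 hMΛ
  have hlM1 : 1 ≤ Real.log M := (le_max_left _ _).trans hlM
  have hlM2 : 2 / η ≤ Real.log M := (le_max_left _ _).trans ((le_max_right _ _).trans hlM)
  have hlM3 : 2 * Real.exp (A / δ) / δ ≤ Real.log M :=
    (le_max_right _ _).trans ((le_max_right _ _).trans hlM)
  have hM1 : (1 : ℝ) < M := by
    have := Real.add_one_le_exp Λ
    have : 1 ≤ Λ := le_max_left _ _
    linarith
  have hM2 : 2 ≤ M := by
    have : 1 < M := by exact_mod_cast hM1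
    omega
  set L := ⌊(M : ℝ) ^ δ⌋₊ with hLdef
  set W := ⌊(M : ℝ) ^ η⌋₊ with hWdef
  have hL1 : 1 ≤ L := Nat.le_floor (by simpa using Real.one_le_rpow hM1.le (by norm_num [hδ]))
  have hLM : (L : ℝ) ≤ (M : ℝ) ^ δ := Nat.floor_le (by positivity)
  have hWM : (W : ℝ) ≤ (M : ℝ) ^ η := Nat.floor_le (by positivity)
  have hWδ : (W : ℝ) ≤ (M : ℝ) ^ δ := hWM.trans (Real.rpow_le_rpow_of_exponent_le hM1.le hηδ)
  have hrpow : ∀ t : ℝ, t ≤ 1 → (M : ℝ) ^ t ≤ M := fun t ht => by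
    simpa using Real.rpow_le_rpow_of_exponent_le hM1.le ht
  have hWM' : W ≤ M := by
    exact_mod_cast hWδ.trans (hrpow δ (by norm_num [hδ]))
  have hhalf : 2 ≤ (M : ℝ) ^ (η / 2) := by
    rw [Real.rpow_def_of_pos hM0]
    have h1 : 1 ≤ Real.log M * (η / 2) := by
      rw [div_le_iff₀ hη0] at hlM2
      linarith
    have := Real.add_one_le_exp (Real.log M * (η / 2))
    linarith
  have hsq : (M : ℝ) ^ η = (M : ℝ) ^ (η / 2) * (M : ℝ) ^ (η / 2) := by
    rw [← Real.rpow_add hM0, add_halves]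
  have hWlow : (M : ℝ) ^ (η / 2) ≤ W := by
    have := Nat.lt_floor_add_one ((M : ℝ) ^ η)
    rw [← hWdef] at this
    nlinarith
  have hW2 : 2 ≤ W := by exact_mod_cast hhalf.trans hWlow
  have hlW : η / 2 * Real.log M ≤ Real.log W := by
    rw [← Real.log_rpow hM0]
    exact Real.log_le_log (by positivity) hWlow
  have hlW' : Real.log W ≤ η * Real.log M := by
    rw [← Real.log_rpow hM0]
    exact Real.log_le_log (by positivity) hWM
  have hlL : δ * Real.log M ≤ Real.log (L + 1) := by
    rw [← Real.log_rpow hM0]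
    exact Real.log_le_log (by positivity) (Nat.lt_floor_add_one _).le
  have hLW : s * Real.log W ≤ Real.log (L + 1) := by
    refine le_trans ?_ hlL
    calc s * Real.log W ≤ s * (η * Real.log M) := by gcongr
      _ = δ * Real.log M := by rw [hη]; field_simp
  have hL10 : (L : ℝ) ^ 10 ≤ M := by
    calc (L : ℝ) ^ 10 ≤ ((M : ℝ) ^ δ) ^ 10 := by gcongr
      _ = (M : ℝ) ^ (δ * (10 : ℕ)) := by rw [Real.rpow_mul hM0.le, Real.rpow_natCast]
      _ ≤ M := hrpow _ (by norm_num [hδ])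
  have hLK : (M : ℝ) ^ δ * (W : ℝ) ^ 3 * (L : ℝ) ^ 10 ≤ M := by
    calc (M : ℝ) ^ δ * (W : ℝ) ^ 3 * (L : ℝ) ^ 10
        ≤ (M : ℝ) ^ δ * ((M : ℝ) ^ δ) ^ 3 * ((M : ℝ) ^ δ) ^ 10 := by gcongr
      _ = ((M : ℝ) ^ δ) ^ 14 := by ring
      _ = (M : ℝ) ^ (δ * (14 : ℕ)) := by rw [Real.rpow_mul hM0.le, Real.rpow_natCast]
      _ ≤ M := hrpow _ (by norm_num [hδ])
  have hK : ∀ q : ℕ, 2 ≤ q → Real.log (L + 1) ≤ Real.log 4 * q →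
      (2 : ℝ) ^ (A * Real.log M / Real.log q) ≤ (M : ℝ) ^ δ := by
    intro q hq hLq
    have hδ0 : 0 < δ := by norm_num [hδ]
    have hq0 : (0 : ℝ) < q := by positivity
    have hlq : 0 < Real.log q := Real.log_pos (by exact_mod_cast hq)
    have h4 : Real.log 4 ≤ 2 := by
      rw [show (4 : ℝ) = 2 ^ 2 by norm_num, Real.log_pow]
      have := Real.log_two_lt_d9
      push_cast
      linarith
    have h1 : Real.exp (A / δ) ≤ q := by
      have a1 : δ * Real.log M ≤ 2 * q := hlL.trans (hLq.trans (by gcongr))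
      rw [div_le_iff₀ hδ0, mul_comm _ δ] at hlM3
      exact le_of_mul_le_mul_left (hlM3.trans a1) two_pos
    have h2 : A / δ ≤ Real.log q := (Real.le_log_iff_exp_le hq0).2 h1
    rw [Real.rpow_def_of_pos (by norm_num : (0 : ℝ) < 2), Real.rpow_def_of_pos hM0]
    apply Real.exp_le_exp.2
    have h3 : A / Real.log q ≤ δ := by
      rw [div_le_iff₀ hlq]
      rwa [div_le_iff₀ hδ0, mul_comm] at h2
    have h5 : A * Real.log M / Real.log q = Real.log M * (A / Real.log q) := by ring
    have h6 : Real.log 2 ≤ 1 := by have := Real.log_two_lt_d9; linarith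
    calc Real.log 2 * (A * Real.log M / Real.log q) ≤ 1 * (A * Real.log M / Real.log q) := by
          gcongr
      _ = Real.log M * (A / Real.log q) := by rw [one_mul, h5]
      _ ≤ _ := by gcongr
  have hlogk : Real.log M ^ k ≤ (1 + Real.log M) ^ k := by gcongr; linarith
  have hone : 1 ≤ (1 + Real.log M) ^ k := one_le_pow₀ (by linarith)
  have hlogW : Real.log W ^ k ≤ (1 + Real.log M) ^ k := by
    refine pow_le_pow_left₀ (Real.log_natCast_nonneg _) ?_ k
    have : Real.log W ≤ Real.log M := Real.log_le_log (by positivity) (by exact_mod_cast hWM')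
    linarith
  have hsmall := h.sum_le_of_small (s := s) le_rfl (W := W) (L := L) (M := M) (N := N) hW2
    (by omega) hMN hL1 hLW (R := A * Real.log M)
    (B := B.filter fun x => ∏ p ∈ (goodPrimes P W).filter (· ∣ n x.1 x.2), p ≤ L)
    ((Finset.filter_subset _ _).trans hB) (w := w)
    (fun x hx => hn x (Finset.mem_filter.1 hx).1) (fun x hx => hw x (Finset.mem_filter.1 hx).1)
    (fun x hx => he x (Finset.mem_filter.1 hx).1) (fun x hx => (Finset.mem_filter.1 hx).2)
  have hlarge := h.sum_le_of_large (s := s) le_rfl (W := W) (L := L) (M := M) (N := N) hM2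
    hMN hL1 hWM' hLW hA (δ := δ) (by norm_num [hδ]) hlL (by positivity) hK
    (B := B.filter fun x => ¬ ∏ p ∈ (goodPrimes P W).filter (· ∣ n x.1 x.2), p ≤ L)
    ((Finset.filter_subset _ _).trans hB) (w := w)
    (fun x hx => hn x (Finset.mem_filter.1 hx).1) (fun x hx => hw x (Finset.mem_filter.1 hx).1)
    (fun x hx => he x (Finset.mem_filter.1 hx).1)
    (fun x hx => not_le.1 (Finset.mem_filter.1 hx).2)
  rw [← Finset.sum_filter_add_sum_filter_not B
    (fun x => ∏ p ∈ (goodPrimes P W).filter (· ∣ n x.1 x.2), p ≤ L)]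
  have hN0 : (0 : ℝ) ≤ N := by positivity
  have hR : A * Real.log M / Real.log W ≤ 2 * A / η := by
    rw [div_le_div_iff₀ (Real.log_pos (by exact_mod_cast hW2)) hη0]
    have : A * (η / 2 * Real.log M) ≤ A * Real.log W := mul_le_mul_of_nonneg_left hlW hA
    linarith
  set ℒ := (1 + Real.log M) ^ k
  have hsmall' := hsmall.trans (calc
    _ ≤ 2 ^ P * (2 : ℝ) ^ (2 * A / η) * (18 * (M * N) * (Real.exp C * ℒ) + 12 * N * M) := by
          gcongr
          norm_num
    _ ≤ 2 ^ P * (2 : ℝ) ^ (2 * A / η) * (18 * (M * N) * (Real.exp C * ℒ) + 12 * N * M * ℒ) :=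
          mul_le_mul_of_nonneg_left (add_le_add le_rfl
            (le_mul_of_one_le_right (by positivity) hone)) (by positivity)
    _ = c₀ * (M * N * ℒ) := by rw [hc₀]; ring)
  have hlarge' := hlarge.trans (calc
    _ = 2 ^ (P + 1) * (54 * κ * Real.exp ((A + 1) / δ)
            * Real.exp (C + 6 * κ * ((A + 1) / δ) * Real.exp ((A + 1) / δ)) * (M * N)
              * Real.log M ^ k
            + 12 * N * ((M : ℝ) ^ δ * (W : ℝ) ^ 3 * (L : ℝ) ^ 10)) := by ring
    _ ≤ 2 ^ (P + 1) * (54 * κ * Real.exp ((A + 1) / δ)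
            * Real.exp (C + 6 * κ * ((A + 1) / δ) * Real.exp ((A + 1) / δ)) * (M * N) * ℒ
            + 12 * N * M * ℒ) := by
          refine mul_le_mul_of_nonneg_left (add_le_add (by gcongr) ?_) (by positivity)
          calc 12 * (N : ℝ) * ((M : ℝ) ^ δ * (W : ℝ) ^ 3 * (L : ℝ) ^ 10) ≤ 12 * N * M := by gcongr
            _ ≤ _ := le_mul_of_one_le_right (by positivity) hone
    _ = c₁ * (M * N * ℒ) := by rw [hc₁]; ring)
  rw [add_mul]
  exact add_le_add hsmall' hlarge'

end LocalDensities

section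

open NumberField Ideal Filter Topology

section PrimeIdeals

variable {R : Type*} [CommRing R] [IsDedekindDomain R]

theorem prod_injOn_primes {T : Finset (Ideal R)} (hT : ∀ P ∈ T, Prime P) :
    Set.InjOn (fun t : Finset (Ideal R) => ∏ P ∈ t, P) (T.powerset : Set (Finset (Ideal R))) := by
  intro t ht t' ht' h
  simp only [Finset.coe_powerset, Set.mem_preimage, Set.mem_powerset_iff, Finset.coe_subset]
    at ht ht'
  have key : ∀ {t t' : Finset (Ideal R)}, t ⊆ T → t' ⊆ T → ∏ P ∈ t, P = ∏ P ∈ t', P → t ⊆ t' := by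
    intro t t' ht ht' h P hP
    have hd : P ∣ ∏ Q ∈ t', Q := h ▸ Finset.dvd_prod_of_mem _ hP
    obtain ⟨Q, hQ, hPQ⟩ := (Prime.dvd_finsetProd_iff (hT P (ht hP)) _).1 hd
    rwa [(associated_iff_eq.1 ((hT P (ht hP)).associated_of_dvd (hT Q (ht' hQ)) hPQ))]
  exact (key ht ht' h).antisymm (key ht' ht h.symm)

end PrimeIdeals

section Euler

variable {K : Type*} [Field K] [NumberField K]

theorem prod_one_add_absNorm_le {s B : ℝ}
    (hB : ∀ S : Finset (Ideal (𝓞 K)), (∀ I ∈ S, I ≠ 0) → ∑ I ∈ S, (absNorm I : ℝ) ^ (-s) ≤ B)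
    {T : Finset (Ideal (𝓞 K))} (hT : ∀ P ∈ T, Prime P) :
    ∏ P ∈ T, (1 + (absNorm P : ℝ) ^ (-s)) ≤ B := by
  classical
  have h := hB (T.powerset.image fun t => ∏ P ∈ t, P) (by
    intro I hI
    obtain ⟨t, ht, rfl⟩ := Finset.mem_image.1 hI
    exact Finset.prod_ne_zero_iff.2 fun P hP => (hT P (Finset.mem_powerset.1 ht hP)).ne_zero)
  rw [Finset.sum_image (prod_injOn_primes hT)] at h
  rw [Finset.prod_one_add]
  refine le_trans (le_of_eq (Finset.sum_congr rfl fun t _ => ?_)) h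
  rw [map_prod, Nat.cast_prod, ← Real.finsetProd_rpow _ _ fun _ _ => Nat.cast_nonneg _]

theorem two_le_absNorm {P : Ideal (𝓞 K)} (hP : Prime P) : 2 ≤ absNorm P := by
  have h0 : absNorm P ≠ 0 := fun h => hP.ne_zero (absNorm_eq_zero_iff.1 h)
  have h1 : absNorm P ≠ 1 := fun h => hP.not_isUnit (Ideal.isUnit_iff.2 (absNorm_eq_one_iff.1 h))
  omega

theorem absNorm_rpow_le_half {P : Ideal (𝓞 K)} (hP : Prime P) {s : ℝ} (hs : 1 ≤ s) :
    (absNorm P : ℝ) ^ (-s) ≤ 1 / 2 := by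
  have h2 : (2 : ℝ) ≤ absNorm P := by exact_mod_cast two_le_absNorm hP
  rw [Real.rpow_neg (by linarith), one_div]
  refine inv_anti₀ two_pos (h2.trans ?_)
  simpa using Real.rpow_le_rpow_of_exponent_le (by linarith) hs

theorem sum_absNorm_rpow_le_prod {s : ℝ} (hs : 1 ≤ s) {S T : Finset (Ideal (𝓞 K))}
    (hS : ∀ I ∈ S, I ≠ 0) (hT : ∀ P ∈ T, Prime P)
    (hST : ∀ I ∈ S, ∀ P, Prime P → P ∣ I → P ∈ T) :
    ∑ I ∈ S, (absNorm I : ℝ) ^ (-s) ≤ ∏ P ∈ T, (1 - (absNorm P : ℝ) ^ (-s))⁻¹ := by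
  classical
  open UniqueFactorizationMonoid in
  have hcount : ∀ I ∈ S, I = ∏ P ∈ T, P ^ (normalizedFactors I).count P := by
    intro I hI
    have h1 : I = (normalizedFactors I).prod :=
      (associated_iff_eq.1 (prod_normalizedFactors (hS I hI))).symm
    conv_lhs => rw [h1]
    refine Finset.prod_multiset_count_of_subset _ _ fun P hP => ?_
    rw [Multiset.mem_toFinset] at hP
    exact hST I hI P (prime_of_normalized_factor P hP) (dvd_of_mem_normalizedFactors hP)
  let D := S.sup fun I => (normalizedFactors I).card
  let φ : Ideal (𝓞 K) → (∀ P ∈ T, ℕ) := fun I P _ => (normalizedFactors I).count P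
  have hφ : ∀ I ∈ S, φ I ∈ T.pi fun _ => Finset.range (D + 1) := by
    intro I hI
    rw [Finset.mem_pi]
    intro P _
    rw [Finset.mem_range, Nat.lt_succ_iff]
    exact (Multiset.count_le_card _ _).trans
      (Finset.le_sup (f := fun I => (normalizedFactors I).card) hI)
  have hinj : Set.InjOn φ S := by
    intro I hI J hJ hIJ
    rw [hcount I hI, hcount J hJ]
    refine Finset.prod_congr rfl fun P hP => ?_
    rw [show (normalizedFactors I).count P = (normalizedFactors J).count P from
      congrFun (congrFun hIJ P) hP]
  have hterm : ∀ I ∈ S, (absNorm I : ℝ) ^ (-s)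
      = ∏ P ∈ T.attach, ((absNorm P.1 : ℝ) ^ (-s)) ^ (φ I P.1 P.2) := by
    intro I hI
    conv_lhs => rw [hcount I hI]
    rw [map_prod, Nat.cast_prod, ← Real.finsetProd_rpow _ _ fun _ _ => Nat.cast_nonneg _,
      ← Finset.prod_attach]
    refine Finset.prod_congr rfl fun P _ => ?_
    rw [map_pow, Nat.cast_pow, ← Real.rpow_natCast, ← Real.rpow_natCast, ← Real.rpow_mul
      (Nat.cast_nonneg _), ← Real.rpow_mul (Nat.cast_nonneg _), mul_comm]
  calc ∑ I ∈ S, (absNorm I : ℝ) ^ (-s)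
      = ∑ g ∈ S.image φ, ∏ P ∈ T.attach, ((absNorm P.1 : ℝ) ^ (-s)) ^ (g P.1 P.2) := by
        rw [Finset.sum_image hinj]
        exact Finset.sum_congr rfl hterm
    _ ≤ ∑ g ∈ T.pi fun _ => Finset.range (D + 1),
          ∏ P ∈ T.attach, ((absNorm P.1 : ℝ) ^ (-s)) ^ (g P.1 P.2) := by
        refine Finset.sum_le_sum_of_subset_of_nonneg (Finset.image_subset_iff.2 hφ)
          fun _ _ _ => by positivity
    _ = ∏ P ∈ T, ∑ j ∈ Finset.range (D + 1), ((absNorm P : ℝ) ^ (-s)) ^ j := by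
        rw [Finset.prod_sum]
    _ ≤ ∏ P ∈ T, (1 - (absNorm P : ℝ) ^ (-s))⁻¹ := by
        refine Finset.prod_le_prod (fun P _ => by positivity) fun P hP => ?_
        have h := absNorm_rpow_le_half (hT P hP) hs
        have h0 : (0 : ℝ) ≤ (absNorm P : ℝ) ^ (-s) := by positivity
        rw [← tsum_geometric_of_lt_one h0 (by linarith)]
        exact (summable_geometric_of_lt_one h0 (by linarith)).sum_le_tsum _
          fun _ _ => by positivity

/-- At most `[K : ℚ]` prime ideals lie above a rational prime. -/
theorem card_primes_over_le {p : ℕ} (hp : p.Prime) {T : Finset (Ideal (𝓞 K))}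
    (hT : ∀ P ∈ T, Prime P ∧ (p : 𝓞 K) ∈ P) : T.card ≤ Module.finrank ℚ K := by
  have hd : ∏ P ∈ T, P ∣ Ideal.span {(p : 𝓞 K)} :=
    Finset.prod_primes_dvd _ (fun P hP => (hT P hP).1) fun P hP =>
      Ideal.dvd_iff_le.2 ((Ideal.span_singleton_le_iff_mem _).2 (hT P hP).2)
  have hn : absNorm (Ideal.span {(p : 𝓞 K)}) = p ^ Module.finrank ℚ K := by
    rw [absNorm_span_natCast, RingOfIntegers.rank]
  have h1 : ∏ P ∈ T, absNorm P ∣ p ^ Module.finrank ℚ K := by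
    rw [← map_prod, ← hn]
    exact map_dvd absNorm hd
  have h2 : p ^ T.card ≤ ∏ P ∈ T, absNorm P := by
    rw [← Finset.prod_const]
    refine Finset.prod_le_prod' fun P hP => ?_
    have h3 : absNorm P ∣ p ^ Module.finrank ℚ K := (Finset.dvd_prod_of_mem _ hP).trans h1
    obtain ⟨j, -, hj⟩ := (Nat.dvd_prime_pow hp).1 h3
    have h4 := two_le_absNorm (hT P hP).1
    rw [hj] at h4 ⊢
    refine Nat.le_self_pow ?_ p
    rintro rfl
    simp at h4
  exact (Nat.pow_le_pow_iff_right hp.one_lt).1 (h2.trans (Nat.le_of_dvd (by positivity [hp.pos]) h1))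

end Euler

section Zeta

variable (K : Type*) [Field K] [NumberField K]

/-- The number of integral ideals of norm `n` in the number field `K`. -/
noncomputable def idealCount (n : ℕ) : ℕ := Nat.card {I : Ideal (𝓞 K) // absNorm I = n}

/-- The integral ideals of norm `n`, as a finset. -/
noncomputable def idealsOfNorm (n : ℕ) : Finset (Ideal (𝓞 K)) :=
  (finite_setOfPred_absNorm_eq (S := 𝓞 K) n).toFinset

variable {K}

theorem mem_idealsOfNorm {n : ℕ} {I : Ideal (𝓞 K)} : I ∈ idealsOfNorm K n ↔ absNorm I = n := by
  simp [idealsOfNorm]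

theorem card_idealsOfNorm (n : ℕ) : (idealsOfNorm K n).card = idealCount K n := by
  rw [idealCount, idealsOfNorm, ← Set.ncard_eq_toFinset_card _ (finite_setOfPred_absNorm_eq n)]
  rfl

theorem idealCount_le_finrank {p : ℕ} (hp : p.Prime) : idealCount K p ≤ Module.finrank ℚ K := by
  rw [← card_idealsOfNorm]
  refine card_primes_over_le hp fun P hP => ?_
  rw [mem_idealsOfNorm] at hP
  have hirr : Irreducible (absNorm P) := hP ▸ hp
  exact ⟨UniqueFactorizationMonoid.irreducible_iff_prime.1 (irreducible_of_irreducible_absNorm hirr),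
    hP ▸ absNorm_mem P⟩

theorem sum_idealCount_mul_rpow (S : Finset ℕ) (s : ℝ) :
    ∑ n ∈ S, (idealCount K n : ℝ) * (n : ℝ) ^ (-s)
      = ∑ I ∈ S.biUnion (idealsOfNorm K), (absNorm I : ℝ) ^ (-s) := by
  classical
  rw [Finset.sum_biUnion]
  · refine Finset.sum_congr rfl fun n _ => ?_
    rw [← card_idealsOfNorm, ← nsmul_eq_mul, ← Finset.sum_const]
    exact Finset.sum_congr rfl fun I hI => by rw [mem_idealsOfNorm.1 hI]
  · intro m _ n _ hmn
    refine Finset.disjoint_left.2 fun I hm hn => hmn ?_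
    rw [← mem_idealsOfNorm.1 hm, mem_idealsOfNorm.1 hn]

theorem hasSum_dedekindZeta_re {s : ℝ} (hs : dedekindZeta K s ≠ 0) :
    HasSum (fun n : ℕ => if n = 0 then 0 else (idealCount K n : ℝ) * (n : ℝ) ^ (-s))
      (dedekindZeta K s).re := by
  have hsum : Summable
      (LSeries.term (fun n ↦ (Nat.card {I : Ideal (𝓞 K) // absNorm I = n} : ℂ)) s) := by
    by_contra h
    exact hs (tsum_eq_zero_of_not_summable h)
  have h : HasSum _ (dedekindZeta K s).re := Complex.hasSum_re hsum.hasSum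
  convert h using 2 with n
  rw [LSeries.term_def]
  split_ifs with hn
  · simp
  · rw [div_eq_mul_inv, ← Complex.ofReal_natCast n, ← Complex.ofReal_cpow (Nat.cast_nonneg _),
      ← Complex.ofReal_inv, ← Complex.ofReal_natCast, ← Complex.ofReal_mul, Complex.ofReal_re,
      Real.rpow_neg (Nat.cast_nonneg _)]
    rfl

theorem sum_absNorm_rpow_le_dedekindZeta {s : ℝ} (hs : dedekindZeta K s ≠ 0)
    {S : Finset (Ideal (𝓞 K))} (hS : ∀ I ∈ S, I ≠ 0) :
    ∑ I ∈ S, (absNorm I : ℝ) ^ (-s) ≤ (dedekindZeta K s).re := by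
  classical
  have h0 : ∀ n ∈ S.image absNorm, n ≠ 0 := by
    intro n hn
    obtain ⟨I, hI, rfl⟩ := Finset.mem_image.1 hn
    exact fun h => hS I hI (absNorm_eq_zero_iff.1 h)
  calc ∑ I ∈ S, (absNorm I : ℝ) ^ (-s)
      ≤ ∑ I ∈ (S.image absNorm).biUnion (idealsOfNorm K), (absNorm I : ℝ) ^ (-s) := by
        refine Finset.sum_le_sum_of_subset_of_nonneg (fun I hI => ?_) fun _ _ _ => by positivity
        exact Finset.mem_biUnion.2 ⟨_, Finset.mem_image_of_mem _ hI, mem_idealsOfNorm.2 rfl⟩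
    _ = ∑ n ∈ S.image absNorm, if n = 0 then 0 else (idealCount K n : ℝ) * (n : ℝ) ^ (-s) := by
        rw [← sum_idealCount_mul_rpow]
        exact Finset.sum_congr rfl fun n hn => by rw [if_neg (h0 n hn)]
    _ ≤ _ := sum_le_hasSum _ (fun n _ => by positivity) (hasSum_dedekindZeta_re hs)

theorem dedekindZeta_re_le {s B : ℝ} (hs : dedekindZeta K s ≠ 0)
    (hB : ∀ S : Finset (Ideal (𝓞 K)), (∀ I ∈ S, I ≠ 0) → ∑ I ∈ S, (absNorm I : ℝ) ^ (-s) ≤ B) :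
    (dedekindZeta K s).re ≤ B := by
  classical
  refine hasSum_le_of_sum_le (hasSum_dedekindZeta_re hs) fun S => ?_
  calc ∑ n ∈ S, (if n = 0 then 0 else (idealCount K n : ℝ) * (n : ℝ) ^ (-s))
      = ∑ n ∈ S.filter (· ≠ 0), (idealCount K n : ℝ) * (n : ℝ) ^ (-s) := by
        rw [Finset.sum_filter]
        exact Finset.sum_congr rfl fun n _ => by split_ifs <;> simp_all
    _ ≤ B := by
        rw [sum_idealCount_mul_rpow]
        refine hB _ fun I hI h0 => ?_
        obtain ⟨n, hn, hI⟩ := Finset.mem_biUnion.1 hI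
        rw [mem_idealsOfNorm, h0, zero_eq_bot, absNorm_bot] at hI
        exact (Finset.mem_filter.1 hn).2 hI.symm

/-- `log ζ_K(s) = log (1 / (s - 1)) + O(1)` for `s` close to `1`. -/
theorem exists_log_dedekindZeta (K : Type*) [Field K] [NumberField K] :
    ∃ C : ℝ, ∃ s₀ : ℝ, 1 < s₀ ∧ ∀ s : ℝ, 1 < s → s < s₀ → dedekindZeta K s ≠ 0 ∧
      0 < (dedekindZeta K s).re ∧
      |Real.log (dedekindZeta K s).re - Real.log (1 / (s - 1))| ≤ C := by
  have hpos := dedekindZeta_residue_pos K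
  have h1 := (Complex.continuous_re.tendsto _).comp (tendsto_sub_one_mul_dedekindZeta_nhdsGT K)
  rw [Complex.ofReal_re] at h1
  have h2 : ∀ᶠ s : ℝ in 𝓝[>] 1, (s - 1) * (dedekindZeta K s).re ∈
      Set.Ioo (dedekindZeta_residue K / 2) (2 * dedekindZeta_residue K) := by
    refine (h1.eventually (Ioo_mem_nhds (a := dedekindZeta_residue K / 2)
      (b := 2 * dedekindZeta_residue K) (by linarith) (by linarith))).mono fun s hs => ?_
    have : ((s : ℂ) - 1) * dedekindZeta K s = ((s - 1 : ℝ) : ℂ) * dedekindZeta K s := by push_cast; rfl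
    rw [Function.comp_apply, this, Complex.re_ofReal_mul] at hs
    exact hs
  rw [eventually_nhdsWithin_iff, Metric.eventually_nhds_iff] at h2
  obtain ⟨δ, hδ, h2⟩ := h2
  set c := dedekindZeta_residue K
  refine ⟨|Real.log (c / 2)| + |Real.log (2 * c)|, 1 + δ, by linarith, fun s hs hs' => ?_⟩
  have h3 := h2 (y := s) (by rw [Real.dist_eq, abs_of_pos (by linarith)]; linarith) hs
  have hs1 : 0 < s - 1 := by linarith
  have hz : 0 < (dedekindZeta K s).re := by
    have : 0 < (s - 1) * (dedekindZeta K s).re := lt_trans (by linarith) h3.1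
    exact (pos_iff_pos_of_mul_pos this).1 hs1
  refine ⟨fun h => by simp [h] at hz, hz, ?_⟩
  have e : Real.log (dedekindZeta K s).re - Real.log (1 / (s - 1))
      = Real.log ((s - 1) * (dedekindZeta K s).re) := by
    rw [Real.log_mul hs1.ne' hz.ne', one_div, Real.log_inv]
    ring
  have l1 : Real.log (c / 2) ≤ Real.log ((s - 1) * (dedekindZeta K s).re) :=
    Real.log_le_log (by linarith) h3.1.le
  have l2 : Real.log ((s - 1) * (dedekindZeta K s).re) ≤ Real.log (2 * c) :=
    Real.log_le_log (by positivity) h3.2.le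
  rw [e, abs_le]
  constructor
  · linarith [neg_abs_le (Real.log (c / 2)), abs_nonneg (Real.log (2 * c))]
  · linarith [le_abs_self (Real.log (2 * c)), abs_nonneg (Real.log (c / 2))]

end Zeta

section Mertens

variable {K : Type*} [Field K] [NumberField K]

theorem prime_of_absNorm_prime {P : Ideal (𝓞 K)} (h : (absNorm P).Prime) : Prime P :=
  UniqueFactorizationMonoid.irreducible_iff_prime.1 (irreducible_of_irreducible_absNorm h)

theorem exists_prime_absNorm_eq_pow {P : Ideal (𝓞 K)} (hP : Prime P) :
    (absNorm P).minFac.Prime ∧ ((absNorm P).minFac : 𝓞 K) ∈ P ∧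
      ∃ j, 0 < j ∧ absNorm P = (absNorm P).minFac ^ j := by
  have := Ideal.isPrime_of_prime hP
  have : P.IsMaximal := this.isMaximal hP.ne_zero
  obtain ⟨p, j, hj, hpP, hp, h⟩ := exists_prime_and_absNorm_eq_pow P
  have hm : (absNorm P).minFac = p := by rw [h, hp.pow_minFac hj.ne']
  rw [hm]
  exact ⟨hp, hpP, j, hj, h⟩

theorem sum_idealCount_mul_inv_sq_le {T : Finset ℕ} (hT : ∀ p ∈ T, p.Prime) :
    ∑ p ∈ T, (idealCount K p : ℝ) * (1 / (p : ℝ) ^ 2) ≤ 2 * (Module.finrank ℚ K : ℝ) := by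
  calc ∑ p ∈ T, (idealCount K p : ℝ) * (1 / (p : ℝ) ^ 2)
      ≤ ∑ p ∈ T, (Module.finrank ℚ K : ℝ) * (1 / (p : ℝ) ^ 2) := by
        refine Finset.sum_le_sum fun p hp => ?_
        gcongr
        exact idealCount_le_finrank (hT p hp)
    _ ≤ _ := by
        rw [← Finset.mul_sum, mul_comm]
        exact mul_le_mul_of_nonneg_right (sum_primes_inv_sq_le T hT) (Nat.cast_nonneg _)

theorem sum_primes_minFac_inv_sq_le {T : Finset (Ideal (𝓞 K))} (hT : ∀ P ∈ T, Prime P) :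
    ∑ P ∈ T, 1 / ((absNorm P).minFac : ℝ) ^ 2 ≤ 2 * (Module.finrank ℚ K : ℝ) := by
  classical
  set φ : Ideal (𝓞 K) → ℕ := fun P => (absNorm P).minFac
  have himg : ∀ p ∈ T.image φ, p.Prime := by
    intro p hp
    obtain ⟨P, hP, rfl⟩ := Finset.mem_image.1 hp
    exact (exists_prime_absNorm_eq_pow (hT P hP)).1
  calc ∑ P ∈ T, 1 / (φ P : ℝ) ^ 2
      = ∑ p ∈ T.image φ, ∑ P ∈ T.filter (φ · = p), 1 / (φ P : ℝ) ^ 2 :=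
        (Finset.sum_fiberwise_of_maps_to (fun P hP => Finset.mem_image_of_mem φ hP) _).symm
    _ ≤ ∑ p ∈ T.image φ, (Module.finrank ℚ K : ℝ) * (1 / (p : ℝ) ^ 2) := by
        refine Finset.sum_le_sum fun p hp => ?_
        rw [Finset.sum_congr rfl (g := fun _ => 1 / (p : ℝ) ^ 2)
          (fun P hP => by rw [(Finset.mem_filter.1 hP).2]), Finset.sum_const, nsmul_eq_mul]
        gcongr
        refine card_primes_over_le (himg p hp) fun P hP => ?_
        obtain ⟨hPT, hPp⟩ := Finset.mem_filter.1 hP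
        exact ⟨hT P hPT, hPp ▸ (exists_prime_absNorm_eq_pow (hT P hPT)).2.1⟩
    _ ≤ _ := by
        rw [← Finset.mul_sum, mul_comm]
        exact mul_le_mul_of_nonneg_right (sum_primes_inv_sq_le _ himg) (Nat.cast_nonneg _)

theorem sub_sq_le_log_one_add {x : ℝ} (hx : 0 ≤ x) :
    x - x ^ 2 ≤ Real.log (1 + x) := by
  refine le_trans ?_ (Real.one_sub_inv_le_log_of_pos (by linarith))
  rw [← sub_nonneg]
  have : 1 - (1 + x)⁻¹ - (x - x ^ 2) = x ^ 3 / (1 + x) := by field_simp; ring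
  rw [this]
  positivity

theorem neg_log_one_sub_le {x : ℝ} (hx' : x ≤ 1 / 2) :
    -Real.log (1 - x) ≤ x + 2 * x ^ 2 := by
  have h := Real.one_sub_inv_le_log_of_pos (x := 1 - x) (by linarith)
  have h1 : (1 - x)⁻¹ ≤ 1 + x + 2 * x ^ 2 := by
    rw [inv_le_iff_one_le_mul₀ (by linarith)]
    nlinarith [mul_nonneg (sq_nonneg x) (by linarith : 0 ≤ 1 - 2 * x)]
  linarith

theorem sum_idealCount_mul_rpow_le {s : ℝ} (hs : 1 < s) (hζ : dedekindZeta K s ≠ 0)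
    {T : Finset ℕ} (hT : ∀ p ∈ T, p.Prime) :
    ∑ p ∈ T, (idealCount K p : ℝ) * (p : ℝ) ^ (-s)
      ≤ Real.log (dedekindZeta K s).re + 2 * Module.finrank ℚ K := by
  classical
  have hprime : ∀ P ∈ T.biUnion (idealsOfNorm K), Prime P := by
    intro P hP
    obtain ⟨p, hp, hP⟩ := Finset.mem_biUnion.1 hP
    rw [mem_idealsOfNorm] at hP
    exact prime_of_absNorm_prime (hP ▸ hT p hp)
  have h1 := prod_one_add_absNorm_le (s := s)
    (fun S hS => sum_absNorm_rpow_le_dedekindZeta hζ hS) hprime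
  have h2 := Real.log_le_log (Finset.prod_pos fun P _ => by positivity) h1
  rw [Real.log_prod fun P _ => by positivity] at h2
  have h3 : ∑ P ∈ T.biUnion (idealsOfNorm K), ((absNorm P : ℝ) ^ (-s)) ^ 2
      ≤ 2 * Module.finrank ℚ K := by
    refine le_trans ?_ (sum_idealCount_mul_inv_sq_le (K := K) hT)
    have e : ∀ P : Ideal (𝓞 K), ((absNorm P : ℝ) ^ (-s)) ^ 2 = (absNorm P : ℝ) ^ (-(2 * s)) := by
      intro P
      rw [← Real.rpow_natCast, ← Real.rpow_mul (Nat.cast_nonneg _)]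
      congr 1
      push_cast
      ring
    simp_rw [e]
    rw [← sum_idealCount_mul_rpow]
    refine Finset.sum_le_sum fun p hp => ?_
    have hp1 : (1 : ℝ) ≤ p := by exact_mod_cast (hT p hp).one_le
    gcongr
    rw [Real.rpow_neg (by linarith), one_div, ← Real.rpow_natCast]
    gcongr
    push_cast
    linarith
  rw [sum_idealCount_mul_rpow]
  have h4 : ∑ P ∈ T.biUnion (idealsOfNorm K), ((absNorm P : ℝ) ^ (-s) - ((absNorm P : ℝ) ^ (-s)) ^ 2)
      ≤ ∑ P ∈ T.biUnion (idealsOfNorm K), Real.log (1 + (absNorm P : ℝ) ^ (-s)) :=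
    Finset.sum_le_sum fun P _ => sub_sq_le_log_one_add (by positivity)
  rw [Finset.sum_sub_distrib] at h4
  linarith

theorem log_dedekindZeta_re_le {s B : ℝ} (hs : 1 < s) (hζ : dedekindZeta K s ≠ 0)
    (hζ' : 0 < (dedekindZeta K s).re)
    (hB : ∀ T : Finset ℕ, (∀ p ∈ T, p.Prime) →
      ∑ p ∈ T, (idealCount K p : ℝ) * (p : ℝ) ^ (-s) ≤ B) :
    Real.log (dedekindZeta K s).re ≤ B + 6 * Module.finrank ℚ K := by
  classical
  rw [Real.log_le_iff_le_exp hζ']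
  refine dedekindZeta_re_le hζ fun S hS => ?_
  open UniqueFactorizationMonoid in
  set T := S.biUnion fun I => (normalizedFactors I).toFinset with hTdef
  have hT : ∀ P ∈ T, Prime P := by
    intro P hP
    obtain ⟨I, hI, hP⟩ := Finset.mem_biUnion.1 hP
    exact UniqueFactorizationMonoid.prime_of_normalized_factor P (Multiset.mem_toFinset.1 hP)
  have hST : ∀ I ∈ S, ∀ P, Prime P → P ∣ I → P ∈ T := by
    intro I hI P hP hd
    refine Finset.mem_biUnion.2 ⟨I, hI, Multiset.mem_toFinset.2 ?_⟩
    rw [UniqueFactorizationMonoid.mem_normalizedFactors_iff (hS I hI)]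
    exact ⟨hP, hd⟩
  refine (sum_absNorm_rpow_le_prod hs.le hS hT hST).trans ?_
  have hx : ∀ P ∈ T, (absNorm P : ℝ) ^ (-s) ≤ 1 / 2 := fun P hP => absNorm_rpow_le_half (hT P hP) hs.le
  have hprod : ∏ P ∈ T, (1 - (absNorm P : ℝ) ^ (-s))⁻¹
      = Real.exp (∑ P ∈ T, -Real.log (1 - (absNorm P : ℝ) ^ (-s))) := by
    rw [Real.exp_sum]
    refine Finset.prod_congr rfl fun P hP => ?_
    have := hx P hP
    rw [Real.exp_neg, Real.exp_log (by linarith)]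
  rw [hprod]
  refine Real.exp_le_exp.2 ?_
  have hle : ∀ P ∈ T, (absNorm P : ℝ) ^ (-s) ≤ 1 / ((absNorm P).minFac : ℝ) := by
    intro P hP
    obtain ⟨hp, -, -⟩ := exists_prime_absNorm_eq_pow (hT P hP)
    have h1 : ((absNorm P).minFac : ℝ) ≤ absNorm P := by
      exact_mod_cast Nat.minFac_le (by have := two_le_absNorm (hT P hP); omega)
    have h0 : (1 : ℝ) ≤ (absNorm P).minFac := by exact_mod_cast hp.one_le
    rw [Real.rpow_neg (by positivity), one_div]
    refine inv_anti₀ (by linarith) (h1.trans ?_)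
    simpa using Real.rpow_le_rpow_of_exponent_le (h0.trans h1) hs.le
  have hsq : ∀ P ∈ T, ((absNorm P : ℝ) ^ (-s)) ^ 2 ≤ 1 / ((absNorm P).minFac : ℝ) ^ 2 := by
    intro P hP
    calc ((absNorm P : ℝ) ^ (-s)) ^ 2 ≤ (1 / ((absNorm P).minFac : ℝ)) ^ 2 := by
          gcongr
          exact hle P hP
      _ = _ := by rw [div_pow, one_pow]
  have hdeg : ∀ P ∈ T, ¬ (absNorm P).Prime →
      (absNorm P : ℝ) ^ (-s) ≤ 1 / ((absNorm P).minFac : ℝ) ^ 2 := by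
    intro P hP hnp
    obtain ⟨hp, -, j, hj, h⟩ := exists_prime_absNorm_eq_pow (hT P hP)
    have hj2 : 2 ≤ j := by
      by_contra hlt
      obtain rfl : j = 1 := by omega
      exact hnp (by rw [h, pow_one]; exact hp)
    have h0 : (1 : ℝ) ≤ (absNorm P).minFac := by exact_mod_cast hp.one_le
    have h1 : ((absNorm P).minFac : ℝ) ^ 2 ≤ absNorm P := by
      calc ((absNorm P).minFac : ℝ) ^ 2 ≤ ((absNorm P).minFac : ℝ) ^ j := by gcongr
        _ = absNorm P := by exact_mod_cast h.symm
    rw [Real.rpow_neg (by positivity), one_div]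
    refine inv_anti₀ (by positivity) (h1.trans ?_)
    have h2 : (1 : ℝ) ≤ absNorm P := (one_le_pow₀ h0).trans h1
    simpa using Real.rpow_le_rpow_of_exponent_le h2 hs.le
  have hone : ∑ P ∈ T.filter (fun P => (absNorm P).Prime), (absNorm P : ℝ) ^ (-s) ≤ B := by
    refine le_trans ?_ (hB ((T.filter fun P => (absNorm P).Prime).image absNorm) ?_)
    · rw [sum_idealCount_mul_rpow]
      refine Finset.sum_le_sum_of_subset_of_nonneg (fun P hP => ?_) fun _ _ _ => by positivity
      exact Finset.mem_biUnion.2 ⟨_, Finset.mem_image_of_mem _ hP, mem_idealsOfNorm.2 rfl⟩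
    · intro p hp
      obtain ⟨P, hP, rfl⟩ := Finset.mem_image.1 hp
      exact (Finset.mem_filter.1 hP).2
  have hbase := sum_primes_minFac_inv_sq_le hT
  have htwo : ∑ P ∈ T.filter (fun P => ¬ (absNorm P).Prime), (absNorm P : ℝ) ^ (-s)
      ≤ 2 * Module.finrank ℚ K := by
    refine le_trans ?_ (sum_primes_minFac_inv_sq_le (T := T.filter fun P => ¬ (absNorm P).Prime)
      fun P hP => hT P (Finset.mem_filter.1 hP).1)
    exact Finset.sum_le_sum fun P hP => hdeg P (Finset.mem_filter.1 hP).1 (Finset.mem_filter.1 hP).2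
  have hall : ∑ P ∈ T, -Real.log (1 - (absNorm P : ℝ) ^ (-s))
      ≤ ∑ P ∈ T, ((absNorm P : ℝ) ^ (-s) + 2 * ((absNorm P : ℝ) ^ (-s)) ^ 2) :=
    Finset.sum_le_sum fun P hP => neg_log_one_sub_le (hx P hP)
  rw [Finset.sum_add_distrib, ← Finset.mul_sum,
    ← Finset.sum_filter_add_sum_filter_not T (fun P => (absNorm P).Prime)
      (fun P => (absNorm P : ℝ) ^ (-s))] at hall
  have hsq' := Finset.sum_le_sum hsq
  linarith

end Mertens

/-- **Mertens' second theorem** for the primes of degree one of a number field. -/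
theorem exists_abs_sum_idealCount_div_sub_le (K : Type*) [Field K] [NumberField K] :
    ∃ C : ℝ, ∀ N : ℕ, 2 ≤ N →
      |∑ p ∈ primesUpTo N, (idealCount K p : ℝ) / p - Real.log (Real.log N)| ≤ C := by
  obtain ⟨C₀, s₀, hs₀, hζ⟩ := exists_log_dedekindZeta K
  set d : ℝ := (Module.finrank ℚ K : ℝ) with hd
  set g : ℕ → ℝ := fun N =>
    |∑ p ∈ primesUpTo N, (idealCount K p : ℝ) / p - Real.log (Real.log N)| with hg
  set N₀ := ⌈Real.exp (1 / (s₀ - 1) + 1)⌉₊ with hN₀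
  refine ⟨∑ N ∈ Finset.range N₀, g N + (|C₀| + 20 * d), fun N hN => ?_⟩
  have hd0 : 0 ≤ d := Nat.cast_nonneg _
  have hg0 : 0 ≤ ∑ N ∈ Finset.range N₀, g N := Finset.sum_nonneg fun _ _ => abs_nonneg _
  rcases lt_or_ge N N₀ with hlt | hge
  · have h1 : g N ≤ ∑ N ∈ Finset.range N₀, g N :=
      Finset.single_le_sum (f := g) (fun _ _ => abs_nonneg _) (Finset.mem_range.2 hlt)
    have : 0 ≤ |C₀| + 20 * d := by positivity
    exact h1.trans (by linarith)
  suffices h : g N ≤ |C₀| + 20 * d from h.trans (by linarith)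
  have hN1 : (1 : ℝ) < N := by exact_mod_cast hN
  have hlN : 0 < Real.log N := Real.log_pos hN1
  have hs1 : 0 < s₀ - 1 := by linarith
  have hlN' : 1 / (s₀ - 1) < Real.log N := by
    rw [Real.lt_log_iff_exp_lt (by linarith)]
    calc Real.exp (1 / (s₀ - 1)) < Real.exp (1 / (s₀ - 1) + 1) := Real.exp_lt_exp.2 (by linarith)
      _ ≤ N := (Nat.le_ceil _).trans (by exact_mod_cast hge)
  set s : ℝ := 1 + 1 / Real.log N with hs
  have hss : 1 < s := by rw [hs]; linarith [one_div_pos.2 hlN]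
  have hss₀ : s < s₀ := by
    have := one_div_lt_one_div_of_lt (one_div_pos.2 hs1) hlN'
    rw [one_div_one_div] at this
    linarith
  obtain ⟨hz, hz', hz''⟩ := hζ s hss hss₀
  have hlog : Real.log (1 / (s - 1)) = Real.log (Real.log N) := by
    rw [hs, add_sub_cancel_left, one_div_one_div]
  rw [hlog, abs_le] at hz''
  have hprimes : ∀ p ∈ primesUpTo N, p.Prime := fun p hp => (mem_primesUpTo.1 hp).2
  have hcount : ∀ p, p.Prime → (idealCount K p : ℝ) ≤ d := fun p hp => by
    rw [hd]
    exact_mod_cast idealCount_le_finrank hp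
  have hup := sum_idealCount_mul_rpow_le hss hz hprimes
  have hdiff : ∑ p ∈ primesUpTo N, (idealCount K p : ℝ) / p
      ≤ ∑ p ∈ primesUpTo N, (idealCount K p : ℝ) * (p : ℝ) ^ (-s) + 3 * d := by
    have h3 : ∑ p ∈ primesUpTo N, Real.log p / p * (d / Real.log N) ≤ 3 * d := by
      rw [← Finset.sum_mul]
      calc _ ≤ (3 * Real.log N) * (d / Real.log N) := by
            gcongr
            exact sum_log_div_le_mul_log hN
        _ = 3 * d := by field_simp
    refine le_trans ?_ (add_le_add le_rfl h3)
    rw [← Finset.sum_add_distrib]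
    refine Finset.sum_le_sum fun p hp => ?_
    have hp2 := hprimes p hp
    have hp0 : (0 : ℝ) < p := by exact_mod_cast hp2.pos
    have e1 : (p : ℝ) ^ (-s) = (1 / p) * Real.exp (-(Real.log p / Real.log N)) := by
      rw [hs, neg_add, Real.rpow_add hp0, Real.rpow_neg_one, ← one_div, Real.rpow_def_of_pos hp0]
      congr 2
      ring
    have e2 := Real.add_one_le_exp (-(Real.log p / Real.log N))
    have e3 : 0 ≤ Real.log p / Real.log N :=
      div_nonneg (Real.log_natCast_nonneg _) hlN.le
    calc (idealCount K p : ℝ) / p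
        = (idealCount K p : ℝ) * ((1 / p) * (1 - Real.log p / Real.log N))
          + idealCount K p * ((1 / p) * (Real.log p / Real.log N)) := by ring
      _ ≤ (idealCount K p : ℝ) * ((1 / p) * Real.exp (-(Real.log p / Real.log N)))
          + d * ((1 / p) * (Real.log p / Real.log N)) := by
          gcongr
          · linarith
          · exact hcount p hp2
      _ = _ := by rw [e1]; ring
  have hlow := log_dedekindZeta_re_le (B := ∑ p ∈ primesUpTo N, (idealCount K p : ℝ) / p + 12 * d)
    hss hz hz' fun T hT => by
      rw [← Finset.sum_filter_add_sum_filter_not T (· ≤ N)]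
      refine add_le_add ?_ ?_
      · calc _ ≤ ∑ p ∈ T.filter (· ≤ N), (idealCount K p : ℝ) / p := by
              refine Finset.sum_le_sum fun p hp => ?_
              have hp2 := hT p (Finset.mem_filter.1 hp).1
              have hp1 : (1 : ℝ) ≤ p := by exact_mod_cast hp2.one_le
              rw [div_eq_mul_inv, ← Real.rpow_neg_one]
              gcongr
          _ ≤ _ := by
              refine Finset.sum_le_sum_of_subset_of_nonneg (fun p hp => ?_)
                fun _ _ _ => by positivity
              obtain ⟨hp, hpN⟩ := Finset.mem_filter.1 hp
              exact mem_primesUpTo.2 ⟨hpN, hT p hp⟩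
      · calc _ ≤ ∑ p ∈ T.filter (¬ · ≤ N), d * (p : ℝ) ^ (-s) := by
              refine Finset.sum_le_sum fun p hp => ?_
              gcongr
              exact hcount p (hT p (Finset.mem_filter.1 hp).1)
          _ ≤ d * 12 := by
              rw [← Finset.mul_sum]
              gcongr
              refine sum_rpow_tail_le (by exact_mod_cast hN) _ fun p hp => ?_
              obtain ⟨hp, hpN⟩ := Finset.mem_filter.1 hp
              exact ⟨hT p hp, by exact_mod_cast not_le.1 hpN⟩
          _ = 12 * d := mul_comm _ _
  rw [hg, abs_le]
  have hC := le_abs_self C₀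
  constructor <;> linarith

section RingHoms

theorem exists_forall_smul_mem_range {S A : Type*} [CommRing S] [CommRing A] [Module.Finite ℤ A]
    (i : S →+* A) (h : ∀ y : A, ∃ n : ℤ, n ≠ 0 ∧ ∃ s, i s = n * y) :
    ∃ n : ℤ, n ≠ 0 ∧ ∀ y : A, ∃ s, i s = n * y := by
  classical
  obtain ⟨G, hG⟩ := Module.Finite.fg_top (R := ℤ) (M := A)
  choose d hd t ht using h
  refine ⟨∏ g ∈ G, d g, Finset.prod_ne_zero_iff.2 fun g _ => hd g, fun y => ?_⟩
  have hy : y ∈ Submodule.span ℤ (G : Set A) := hG ▸ Submodule.mem_top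
  induction hy using Submodule.span_induction with
  | mem g hg =>
    refine ⟨((∏ g' ∈ G.erase g, d g' : ℤ) : S) * t g, ?_⟩
    rw [map_mul, ht, map_intCast, ← Finset.mul_prod_erase G d hg]
    push_cast
    ring
  | zero => exact ⟨0, by simp⟩
  | add x y _ _ hx hy =>
    obtain ⟨s, hs⟩ := hx
    obtain ⟨s', hs'⟩ := hy
    exact ⟨s + s', by rw [map_add, hs, hs', mul_add]⟩
  | smul m x _ hx =>
    obtain ⟨s, hs⟩ := hx
    exact ⟨m * s, by rw [map_mul, hs, map_intCast, zsmul_eq_mul]; ring⟩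

theorem bijective_comp_of_smul_mem_range {S A F : Type*} [CommRing S] [CommRing A] [Field F]
    {i : S →+* A} (hi : Function.Injective i) {n : ℤ} (hn : (n : F) ≠ 0)
    (h : ∀ y : A, ∃ s, i s = n * y) :
    Function.Bijective fun φ : A →+* F => φ.comp i := by
  constructor
  · intro φ φ' hφ
    ext y
    obtain ⟨s, hs⟩ := h y
    have h1 : φ (n * y) = φ' (n * y) := by
      rw [← hs]
      exact DFunLike.congr_fun hφ s
    rw [map_mul, map_mul, map_intCast, map_intCast] at h1
    exact mul_left_cancel₀ hn h1
  · intro ψ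
    choose t ht using h
    have ht1 : t 1 = n := hi (by rw [ht, map_intCast, mul_one])
    have ht0 : t 0 = 0 := hi (by rw [ht, map_zero, mul_zero])
    have htadd : ∀ x y, t (x + y) = t x + t y := fun x y =>
      hi (by rw [ht, map_add, ht, ht, mul_add])
    have htmul : ∀ x y, n * t (x * y) = t x * t y := fun x y =>
      hi (by rw [map_mul, map_mul, ht, ht, ht, map_intCast]; ring)
    refine ⟨{ toFun := fun y => ψ (t y) / n
              map_one' := by rw [ht1, map_intCast, div_self hn]
              map_mul' := fun x y => ?_
              map_zero' := by rw [ht0, map_zero, zero_div]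
              map_add' := fun x y => by rw [htadd, map_add, add_div] }, ?_⟩
    · have h1 := congrArg ψ (htmul x y)
      rw [map_mul, map_mul, map_intCast] at h1
      rw [div_mul_div_comm, ← h1, mul_div_mul_left _ _ hn]
    · ext s
      have : t (i s) = n * s := hi (by rw [ht, map_mul, map_intCast])
      change ψ (t (i s)) / n = ψ s
      rw [this, map_mul, map_intCast, mul_div_cancel_left₀ _ hn]

variable {K : Type*} [Field K] [NumberField K]

theorem absNorm_ker_ringHom {p : ℕ} (hp : p.Prime) (φ : 𝓞 K →+* ZMod p) :
    absNorm (RingHom.ker φ) = p := by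
  have := Fact.mk hp
  rw [absNorm_apply, Submodule.cardQuot_apply,
    Nat.card_congr (RingHom.quotientKerEquivOfSurjective (ZMod.ringHom_surjective φ)).toEquiv,
    Nat.card_zmod]

theorem idealCount_eq_card_ringHom {p : ℕ} (hp : p.Prime) :
    idealCount K p = Nat.card (𝓞 K →+* ZMod p) := by
  have := Fact.mk hp
  refine (Nat.card_congr (Equiv.ofBijective
    (fun φ : 𝓞 K →+* ZMod p => (⟨RingHom.ker φ, absNorm_ker_ringHom hp φ⟩ :
      {I : Ideal (𝓞 K) // absNorm I = p})) ⟨fun φ φ' h => ?_, fun ⟨I, hI⟩ => ?_⟩)).symm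
  · exact ZMod.ringHom_eq_of_ker_eq _ _ (congrArg Subtype.val h)
  · have hcard : Nat.card (𝓞 K ⧸ I) = p := by
      rw [← hI, absNorm_apply, Submodule.cardQuot_apply]
    have : Finite (𝓞 K ⧸ I) := Nat.finite_of_card_ne_zero (hcard ▸ hp.ne_zero)
    have := Fintype.ofFinite (𝓞 K ⧸ I)
    let e := ZMod.ringEquivOfPrime (𝓞 K ⧸ I) hp (by rw [← Nat.card_eq_fintype_card, hcard])
    refine ⟨(e.symm : 𝓞 K ⧸ I →+* ZMod p).comp (Ideal.Quotient.mk I), Subtype.ext ?_⟩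
    change RingHom.ker ((e.symm : 𝓞 K ⧸ I →+* ZMod p).comp (Ideal.Quotient.mk I)) = I
    rw [← RingHom.comap_ker, (RingHom.injective_iff_ker_eq_bot (e.symm : 𝓞 K ⧸ I →+* ZMod p)).1
      e.symm.injective,
      ← RingHom.ker_eq_comap_bot, Ideal.mk_ker]

end RingHoms

end

section

open NumberField Ideal Polynomial

/-- The number of roots of `g` modulo `p`. -/
noncomputable def rootCount (g : ℤ[X]) (p : ℕ) : ℕ :=
  Nat.card {x : ZMod p // g.eval₂ (Int.castRingHom (ZMod p)) x = 0}

theorem card_adjoinRoot_ringHom (g : ℤ[X]) (p : ℕ) :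
    Nat.card (AdjoinRoot g →+* ZMod p) = rootCount g p := by
  have key : ∀ φ : AdjoinRoot g →+* ZMod p,
      g.eval₂ (Int.castRingHom (ZMod p)) (φ (AdjoinRoot.root g)) = 0 := by
    intro φ
    have h := congrArg φ (AdjoinRoot.eval₂_root g)
    rw [map_zero, Polynomial.hom_eval₂] at h
    rwa [Subsingleton.elim (φ.comp (AdjoinRoot.of g)) (Int.castRingHom (ZMod p))] at h
  refine Nat.card_congr (Equiv.ofBijective (fun φ => (⟨φ (AdjoinRoot.root g), key φ⟩ :
    {x : ZMod p // g.eval₂ (Int.castRingHom (ZMod p)) x = 0})) ⟨fun φ φ' h => ?_, fun ⟨x, hx⟩ => ?_⟩)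
  · refine AdjoinRoot.ringHom_ext (Subsingleton.elim _ _) (congrArg Subtype.val h)
  · exact ⟨AdjoinRoot.lift _ x hx, Subtype.ext (AdjoinRoot.lift_root hx)⟩

section

variable {K : Type*} [Field K] [NumberField K]

theorem exists_idealCount_eq_rootCount (β : 𝓞 K)
    (hβ : ∀ y : K, ∃ G : ℚ[X], aeval (β : K) G = y) :
    ∃ n : ℤ, n ≠ 0 ∧ ∀ p : ℕ, p.Prime → (n : ZMod p) ≠ 0 →
      idealCount K p = rootCount (minpoly ℤ β) p := by
  let i : AdjoinRoot (minpoly ℤ β) →+* 𝓞 K :=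
    AdjoinRoot.lift (algebraMap ℤ (𝓞 K)) β (minpoly.aeval ℤ β)
  have himk : ∀ G : ℤ[X], i (AdjoinRoot.mk _ G) = aeval β G := fun G => AdjoinRoot.lift_mk _ _
  have hintegral : IsIntegral ℤ β := IsIntegral.of_finite ℤ β
  have hi : Function.Injective i := by
    rw [injective_iff_map_eq_zero]
    intro s hs
    obtain ⟨G, rfl⟩ := AdjoinRoot.mk_surjective s
    rw [himk] at hs
    exact AdjoinRoot.mk_eq_zero.2 (minpoly.isIntegrallyClosed_dvd hintegral hs)
  obtain ⟨n, hn, h⟩ := exists_forall_smul_mem_range i fun y => by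
    obtain ⟨G, hG⟩ := hβ y
    obtain ⟨b, hb, hbG⟩ := IsLocalization.integerNormalization_spec (nonZeroDivisors ℤ) G
    refine ⟨b, nonZeroDivisors.ne_zero hb, AdjoinRoot.mk _
      (IsLocalization.integerNormalization (nonZeroDivisors ℤ) G), RingOfIntegers.coe_injective ?_⟩
    rw [himk]
    have h1 : ((aeval β (IsLocalization.integerNormalization (nonZeroDivisors ℤ) G) : 𝓞 K) : K) =
        aeval (β : K) ((IsLocalization.integerNormalization (nonZeroDivisors ℤ) G).map
          (algebraMap ℤ ℚ)) := by
      rw [aeval_map_algebraMap]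
      exact (aeval_algebraMap_apply K β _).symm
    refine h1.trans ?_
    rw [hbG, map_zsmul, hG, zsmul_eq_mul, map_mul, map_intCast]
  refine ⟨n, hn, fun p hp hpn => ?_⟩
  have := Fact.mk hp
  rw [idealCount_eq_card_ringHom hp, ← card_adjoinRoot_ringHom]
  exact Nat.card_congr (Equiv.ofBijective _ (bijective_comp_of_smul_mem_range hi hpn h))

theorem finite_ringHom_zmod {p : ℕ} (hp : p.Prime) : Finite (𝓞 K →+* ZMod p) := by
  have := Fact.mk hp
  have hfin : Finite {I : Ideal (𝓞 K) // absNorm I = p} :=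
    (finite_setOfPred_absNorm_eq p).to_subtype
  refine Finite.of_injective (fun φ : 𝓞 K →+* ZMod p =>
    (⟨RingHom.ker φ, absNorm_ker_ringHom hp φ⟩ : {I : Ideal (𝓞 K) // absNorm I = p})) ?_
  exact fun φ φ' h => ZMod.ringHom_eq_of_ker_eq _ _ (congrArg Subtype.val h)

theorem exists_int_mul_eq_coe (k : K) : ∃ n : ℤ, n ≠ 0 ∧ ∃ k' : 𝓞 K, (k' : K) = n * k := by
  have : Algebra.IsAlgebraic ℤ K :=
    (IsFractionRing.comap_isAlgebraic_iff (A := ℤ) (K := ℚ)).2 inferInstance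
  obtain ⟨n, hn, h⟩ := (Algebra.IsAlgebraic.isAlgebraic (R := ℤ) k).exists_integral_multiple
  exact ⟨n, hn, ⟨⟨_, h⟩, by simp⟩⟩

/-- `X ^ 2 - a` over the ring of integers of `K`. -/
noncomputable def sqSub (K : Type*) [Field K] (a : ℤ) : (𝓞 K)[X] := X ^ 2 - C (a : 𝓞 K)

omit [NumberField K] in
theorem exists_eq_add_mul_root (a : ℤ) (s : AdjoinRoot (sqSub K a)) : ∃ k l : 𝓞 K,
    s = AdjoinRoot.of _ k + AdjoinRoot.of _ l * AdjoinRoot.root (sqSub K a) := by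
  have hg : (sqSub K a).Monic := monic_X_pow_sub_C _ two_ne_zero
  obtain ⟨G, rfl⟩ := AdjoinRoot.mk_surjective s
  have h2 : (sqSub K a).natDegree = 2 := natDegree_X_pow_sub_C
  have hdeg : (G %ₘ sqSub K a).natDegree ≤ 1 := by
    have h1 := natDegree_modByMonic_lt G hg (fun h => by
      rw [h, natDegree_one] at h2
      exact absurd h2 (by norm_num))
    omega
  obtain ⟨l, k, hlk⟩ := exists_eq_X_add_C_of_natDegree_le_one hdeg
  refine ⟨k, l, ?_⟩
  have h3 : AdjoinRoot.mk (sqSub K a) G = AdjoinRoot.mk _ (G %ₘ sqSub K a) := by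
    rw [AdjoinRoot.mk_eq_mk]
    refine ⟨G /ₘ sqSub K a, ?_⟩
    rw [sub_eq_iff_eq_add, add_comm, modByMonic_add_div]
  rw [h3, hlk, map_add, map_mul, AdjoinRoot.mk_C, AdjoinRoot.mk_C, AdjoinRoot.mk_X, add_comm]

section Quadratic

variable {L : Type*} [Field L] [NumberField L] [Algebra K L] {a : ℤ} {α : L}

theorem exists_injective_adjoinRoot (hα : α ^ 2 = a) (hα' : ∀ k : K, algebraMap K L k ≠ α)
    (hgen : ∀ y : L, ∃ k l : K, y = algebraMap K L k + algebraMap K L l * α) :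
    ∃ i : AdjoinRoot (sqSub K a) →+* 𝓞 L, Function.Injective i ∧
      ∃ n : ℤ, n ≠ 0 ∧ ∀ y, ∃ s, i s = n * y := by
  have hintegral : IsIntegral ℤ α := by
    refine ⟨X ^ 2 - C a, monic_X_pow_sub_C a two_ne_zero, ?_⟩
    rw [eval₂_sub, eval₂_pow, eval₂_X, eval₂_C, hα]
    simp
  let α' : 𝓞 L := ⟨α, hintegral⟩
  have hα2 : α' ^ 2 = a := by
    apply RingOfIntegers.coe_injective
    rw [map_pow, map_intCast]
    exact hα
  let i : AdjoinRoot (sqSub K a) →+* 𝓞 L := AdjoinRoot.lift (algebraMap (𝓞 K) (𝓞 L)) α' (by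
    rw [sqSub, eval₂_sub, eval₂_pow, eval₂_X, eval₂_C, hα2, map_intCast, sub_self])
  have hi_eq : ∀ k l : 𝓞 K, ((i (AdjoinRoot.of _ k + AdjoinRoot.of _ l * AdjoinRoot.root _) : 𝓞 L) : L)
      = algebraMap K L k + algebraMap K L l * α := by
    intro k l
    simp only [i, map_add, map_mul, AdjoinRoot.lift_of, AdjoinRoot.lift_root]
    rfl
  refine ⟨i, ?_, exists_forall_smul_mem_range i fun y => ?_⟩
  · rw [injective_iff_map_eq_zero]
    intro s hs
    obtain ⟨k, l, rfl⟩ := exists_eq_add_mul_root a s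
    have h : 0 = algebraMap K L k + algebraMap K L l * α := by
      rw [← hi_eq, hs]
      simp
    have hl : (l : K) = 0 := by
      by_contra hl
      refine hα' (-k / l) ?_
      have hl' : algebraMap K L l ≠ 0 := by simpa using hl
      rw [map_div₀, map_neg, div_eq_iff hl']
      linear_combination h
    rw [hl, map_zero, zero_mul, add_zero] at h
    have hk : (k : K) = 0 := by simpa using h.symm
    rw [RingOfIntegers.coe_eq_zero_iff] at hl hk
    rw [hk, hl]
    simp
  · obtain ⟨k, l, hy⟩ := hgen y
    obtain ⟨m, hm, k', hk⟩ := exists_int_mul_eq_coe k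
    obtain ⟨m', hm', l', hl⟩ := exists_int_mul_eq_coe l
    refine ⟨m * m', mul_ne_zero hm hm', AdjoinRoot.of _ (m' * k') +
      AdjoinRoot.of _ (m * l') * AdjoinRoot.root _, RingOfIntegers.coe_injective ?_⟩
    refine (hi_eq _ _).trans ?_
    simp only [RingOfIntegers.coe_eq_algebraMap] at hy hk hl ⊢
    simp only [map_mul, map_intCast, Int.cast_mul, hy, hk, hl]
    ring

theorem exists_two_mul_idealCount_le (hα : α ^ 2 = a) (hα' : ∀ k : K, algebraMap K L k ≠ α)
    (hgen : ∀ y : L, ∃ k l : K, y = algebraMap K L k + algebraMap K L l * α) :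
    ∃ n : ℤ, n ≠ 0 ∧ ∀ p : ℕ, p.Prime → (n : ZMod p) ≠ 0 → p ≠ 2 → (a : ZMod p) ≠ 0 →
      IsSquare (a : ZMod p) → 2 * idealCount K p ≤ idealCount L p := by
  obtain ⟨i, hi, n, hn, h⟩ := exists_injective_adjoinRoot hα hα' hgen
  refine ⟨n, hn, fun p hp hpn hp2 hpa hsq => ?_⟩
  have := Fact.mk hp
  obtain ⟨b, hb⟩ := hsq
  have hb0 : b ≠ 0 := by
    rintro rfl
    exact hpa (by rw [hb, mul_zero])
  have hbn : b ≠ -b := by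
    intro h
    have h2 : (2 : ZMod p) * b = 0 := by linear_combination h
    rcases mul_eq_zero.1 h2 with h3 | h3
    · have : ((2 : ℕ) : ZMod p) = 0 := by exact_mod_cast h3
      rw [ZMod.natCast_eq_zero_iff] at this
      exact hp2 ((Nat.prime_dvd_prime_iff_eq hp Nat.prime_two).1 this)
    · exact hb0 h3
  have hlift : ∀ φ : 𝓞 K →+* ZMod p, ∀ t : Bool,
      (sqSub K a).eval₂ φ (if t then b else -b) = 0 := by
    intro φ t
    rw [sqSub, eval₂_sub, eval₂_pow, eval₂_X, eval₂_C, map_intCast, hb]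
    split_ifs <;> ring
  have hfin : Finite (𝓞 L →+* ZMod p) := finite_ringHom_zmod hp
  let E := Equiv.ofBijective _ (bijective_comp_of_smul_mem_range hi hpn h)
  have hcard : Nat.card ((𝓞 K →+* ZMod p) × Bool) = 2 * Nat.card (𝓞 K →+* ZMod p) := by
    rw [Nat.card_prod, mul_comm, Nat.card_eq_fintype_card (α := Bool), Fintype.card_bool]
  rw [idealCount_eq_card_ringHom hp, idealCount_eq_card_ringHom hp, ← hcard, Nat.card_congr E]
  have : Finite (AdjoinRoot (sqSub K a) →+* ZMod p) := Finite.of_equiv _ E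
  refine Nat.card_le_card_of_injective
    (fun x : (𝓞 K →+* ZMod p) × Bool => AdjoinRoot.lift x.1 _ (hlift x.1 x.2)) ?_
  rintro ⟨φ, t⟩ ⟨φ', t'⟩ hxx
  have h1 : φ = φ' := by
    ext k
    have := DFunLike.congr_fun hxx (AdjoinRoot.of _ k)
    simpa only [AdjoinRoot.lift_of] using this
  have h2 := DFunLike.congr_fun hxx (AdjoinRoot.root _)
  simp only [AdjoinRoot.lift_root] at h2
  refine Prod.ext h1 ?_
  cases t <;> cases t'
  · rfl
  · exact absurd h2.symm (by simpa using hbn)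
  · exact absurd h2 (by simpa using hbn)
  · rfl

end Quadratic

end

theorem chiA_le_one (a : ℤ) (p : ℕ) : chiA a p ≤ 1 := by
  unfold chiA
  split_ifs <;> norm_num

theorem neg_one_le_chiA (a : ℤ) (p : ℕ) : -1 ≤ chiA a p := by
  unfold chiA
  split_ifs <;> norm_num

section

universe u

variable (K : Type u) [Field K] [NumberField K]

theorem exists_quadratic_extension {a : ℤ} (ha : ¬ IsSquare (a : K)) :
    ∃ (L : Type u) (_ : Field L) (_ : NumberField L) (_ : Algebra K L) (α : L),
      α ^ 2 = a ∧ (∀ k : K, algebraMap K L k ≠ α) ∧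
      ∀ y : L, ∃ k l : K, y = algebraMap K L k + algebraMap K L l * α := by
  have hirr : Irreducible (X ^ 2 - C (a : K)) :=
    X_pow_sub_C_irreducible_of_prime Nat.prime_two fun b hb => ha ⟨b, by rw [← hb, sq]⟩
  have := Fact.mk hirr
  have hcast : AdjoinRoot.of (X ^ 2 - C (a : K)) (a : K) = (a : AdjoinRoot (X ^ 2 - C (a : K))) :=
    map_intCast _ a
  have hroot : (AdjoinRoot.root (X ^ 2 - C (a : K))) ^ 2 =
      (a : AdjoinRoot (X ^ 2 - C (a : K))) := by
    have h := AdjoinRoot.eval₂_root (X ^ 2 - C (a : K))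
    simp only [eval₂_sub, eval₂_pow, eval₂_X, eval₂_C] at h
    exact (sub_eq_zero.1 h).trans hcast
  have hchar : CharZero (AdjoinRoot (X ^ 2 - C (a : K))) :=
    charZero_of_injective_algebraMap (algebraMap K _).injective
  have hfin : FiniteDimensional K (AdjoinRoot (X ^ 2 - C (a : K))) :=
    (AdjoinRoot.powerBasis hirr.ne_zero).finite
  have hfin' : FiniteDimensional ℚ (AdjoinRoot (X ^ 2 - C (a : K))) :=
    FiniteDimensional.trans ℚ K _
  refine ⟨AdjoinRoot (X ^ 2 - C (a : K)), inferInstance, ⟨⟩, inferInstance,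
    AdjoinRoot.root _, hroot, fun k hk => ha ⟨k, ?_⟩, fun y => ?_⟩
  · have h : algebraMap K (AdjoinRoot (X ^ 2 - C (a : K))) (k * k) = algebraMap K _ (a : K) := by
      rw [map_mul, hk, ← sq, hroot]
      exact hcast.symm
    exact ((algebraMap K _).injective h).symm
  · have hg : (X ^ 2 - C (a : K)).Monic := monic_X_pow_sub_C _ two_ne_zero
    obtain ⟨G, rfl⟩ := AdjoinRoot.mk_surjective y
    have h2 : (X ^ 2 - C (a : K)).natDegree = 2 := natDegree_X_pow_sub_C
    have hdeg : (G %ₘ (X ^ 2 - C (a : K))).natDegree ≤ 1 := by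
      have h1 := natDegree_modByMonic_lt G hg (fun h => by
        rw [h, natDegree_one] at h2
        exact absurd h2 (by norm_num))
      omega
    obtain ⟨l, k, hlk⟩ := exists_eq_X_add_C_of_natDegree_le_one hdeg
    refine ⟨k, l, ?_⟩
    have h3 : AdjoinRoot.mk (X ^ 2 - C (a : K)) G = AdjoinRoot.mk _ (G %ₘ (X ^ 2 - C (a : K))) := by
      rw [AdjoinRoot.mk_eq_mk]
      refine ⟨G /ₘ (X ^ 2 - C (a : K)), ?_⟩
      rw [sub_eq_iff_eq_add, add_comm, modByMonic_add_div]
    rw [h3, hlk, map_add, map_mul, AdjoinRoot.mk_C, AdjoinRoot.mk_C, AdjoinRoot.mk_X, add_comm,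
      AdjoinRoot.algebraMap_eq]

open Classical in
theorem exists_sum_chiA_mul_idealCount_le (a : ℤ) (ha : a ≠ 0) :
    ∃ C : ℝ, ∀ N : ℕ, 2 ≤ N → ∑ p ∈ primesUpTo N, chiA a p * idealCount K p / p
      ≤ (if IsSquare (a : K) then 1 else 0) * Real.log (Real.log N) + C := by
  obtain ⟨C, hC⟩ := exists_abs_sum_idealCount_div_sub_le K
  by_cases hsq : IsSquare (a : K)
  · refine ⟨C, fun N hN => ?_⟩
    rw [if_pos hsq, one_mul]
    have h1 := (abs_le.1 (hC N hN)).2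
    refine le_trans (Finset.sum_le_sum fun p _ => ?_) (sub_le_iff_le_add'.1 h1)
    have := chiA_le_one a p
    gcongr
    exact mul_le_of_le_one_left (Nat.cast_nonneg _) this
  · obtain ⟨L, _, _, _, α, hα, hα', hgen⟩ := exists_quadratic_extension K hsq
    obtain ⟨C', hC'⟩ := exists_abs_sum_idealCount_div_sub_le L
    obtain ⟨n, hn, h⟩ := exists_two_mul_idealCount_le hα hα' hgen
    set m : ℕ := (2 * n * a).natAbs with hm
    have hm0 : m ≠ 0 := by
      rw [hm, Int.natAbs_ne_zero]
      exact mul_ne_zero (mul_ne_zero two_ne_zero hn) ha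
    set d : ℝ := (Module.finrank ℚ K : ℝ) with hd
    have hd0 : 0 ≤ d := Nat.cast_nonneg _
    have key : ∀ p : ℕ, p.Prime → chiA a p * idealCount K p / p ≤
        ((idealCount L p : ℝ) / p - (idealCount K p : ℝ) / p)
          + if p ∈ m.primeFactors then 2 * d else 0 := by
      intro p hp
      have hp0 : (0 : ℝ) < p := by exact_mod_cast hp.pos
      have hp1 : (1 : ℝ) ≤ p := by exact_mod_cast hp.one_le
      have hL : (0 : ℝ) ≤ idealCount L p := Nat.cast_nonneg _
      have hK : (0 : ℝ) ≤ idealCount K p := Nat.cast_nonneg _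
      split_ifs with hpm
      · have h1 : (idealCount K p : ℝ) ≤ d :=
          Nat.cast_le.2 (idealCount_le_finrank hp)
        have h2 : chiA a p * idealCount K p / p ≤ d := by
          rw [div_le_iff₀ hp0]
          nlinarith [chiA_le_one a p]
        have h3 : (idealCount K p : ℝ) / p ≤ d := by
          rw [div_le_iff₀ hp0]
          nlinarith
        have h4 : 0 ≤ (idealCount L p : ℝ) / p := by positivity
        linarith
      · have hpm' : ¬ (p : ℤ) ∣ 2 * n * a := by
          rw [Int.natCast_dvd]
          exact fun hdvd => hpm (Nat.mem_primeFactors.2 ⟨hp, hdvd, hm0⟩)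
        have ha' : (a : ZMod p) ≠ 0 := fun h0 =>
          hpm' (((ZMod.intCast_zmod_eq_zero_iff_dvd _ _).1 h0).mul_left _)
        have hn' : (n : ZMod p) ≠ 0 := fun h0 => hpm'
          ((((ZMod.intCast_zmod_eq_zero_iff_dvd _ _).1 h0).mul_left _).mul_right _)
        have h2' : p ≠ 2 := by
          rintro rfl
          exact hpm' ((dvd_mul_right _ _).mul_right _)
        rw [add_zero, ← sub_div, chiA, if_neg h2', if_neg ha']
        gcongr
        split_ifs with hsq'
        · have : (2 : ℝ) * idealCount K p ≤ idealCount L p := by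
            exact_mod_cast h p hp hn' h2' ha' hsq'
          linarith
        · linarith
    refine ⟨C' + C + m.primeFactors.card * (2 * d), fun N hN => ?_⟩
    rw [if_neg hsq, zero_mul, zero_add]
    have h1 := (abs_le.1 (hC N hN)).1
    have h2 := (abs_le.1 (hC' N hN)).2
    have h3 : ∑ p ∈ primesUpTo N, (if p ∈ m.primeFactors then 2 * d else 0)
        ≤ m.primeFactors.card * (2 * d) := by
      rw [← Finset.sum_filter, Finset.sum_const, nsmul_eq_mul]
      gcongr
      intro p hp
      exact (Finset.mem_filter.1 hp).2
    refine (Finset.sum_le_sum fun p hp => key p (mem_primesUpTo.1 hp).2).trans ?_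
    rw [Finset.sum_add_distrib, Finset.sum_sub_distrib]
    linarith

end

theorem rootCount_comp_C_mul_X (h : ℤ[X]) {d : ℤ} {p : ℕ} (hp : p.Prime) (hd : (d : ZMod p) ≠ 0) :
    rootCount (h.comp (C d * X)) p = rootCount h p := by
  have := Fact.mk hp
  have key : ∀ x : ZMod p, (h.comp (C d * X)).eval₂ (Int.castRingHom (ZMod p)) x =
      h.eval₂ (Int.castRingHom (ZMod p)) (d * x) := by
    intro x
    rw [eval₂_comp, eval₂_mul, eval₂_C, eval₂_X]
    rfl
  refine Nat.card_congr ((Equiv.mulLeft₀ (d : ZMod p) hd).subtypeEquiv fun x => ?_)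
  rw [key]
  rfl

theorem eval₂_of_root_eq_mk {g : ℚ[X]} (G : ℚ[X]) :
    eval₂ (AdjoinRoot.of g) (AdjoinRoot.root g) G = AdjoinRoot.mk g G :=
  AdjoinRoot.aeval_eq G

theorem aeval_root_eq_mk {g : ℚ[X]} {A : Algebra ℚ (AdjoinRoot g)} (G : ℚ[X]) :
    aeval (AdjoinRoot.root g) G = AdjoinRoot.mk g G := by
  rw [aeval_def, Subsingleton.elim (algebraMap ℚ (AdjoinRoot g)) (AdjoinRoot.of g)]
  exact eval₂_of_root_eq_mk G

theorem exists_integer_model (g : ℚ[X]) (hg : Irreducible g) [Fact (Irreducible g)] :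
    ∃ F : ℤ[X], (∃ q : ℚ, q ≠ 0 ∧ F.map (Int.castRingHom ℚ) = C q * g) ∧
      ∃ n : ℤ, n ≠ 0 ∧ ∀ p : ℕ, p.Prime → (n : ZMod p) ≠ 0 →
        rootCount F p = idealCount (AdjoinRoot g) p := by
  obtain ⟨d, hd, β, hβ⟩ := exists_int_mul_eq_coe (AdjoinRoot.root g)
  have hdK : (d : AdjoinRoot g) ≠ 0 := by exact_mod_cast hd
  obtain ⟨n, hn, h⟩ := exists_idealCount_eq_rootCount β fun y => by
    obtain ⟨G, rfl⟩ := AdjoinRoot.mk_surjective y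
    refine ⟨G.comp (C (d : ℚ)⁻¹ * X), ?_⟩
    rw [aeval_comp, ← aeval_root_eq_mk, hβ]
    congr 2
    simp [hdK]
  have hintegral : IsIntegral ℤ β := IsIntegral.of_finite ℤ β
  refine ⟨(minpoly ℤ β).comp (C d * X), ?_, d * n, mul_ne_zero hd hn, fun p hp hpn => ?_⟩
  · set F := ((minpoly ℤ β).comp (C d * X)).map (Int.castRingHom ℚ) with hF
    have hnat : F.natDegree = (minpoly ℤ β).natDegree := by
      rw [hF, natDegree_map_eq_of_injective (RingHom.injective_int _), natDegree_comp,
        natDegree_C_mul_X _ hd, mul_one]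
    have h0 : aeval (AdjoinRoot.root g) F = 0 := by
      rw [hF, ← algebraMap_int_eq, aeval_map_algebraMap, aeval_comp, map_mul, aeval_X, aeval_C]
      have h1 := congrArg (algebraMap (𝓞 (AdjoinRoot g)) (AdjoinRoot g)) (minpoly.aeval ℤ β)
      rw [← aeval_algebraMap_apply, map_zero] at h1
      rw [← h1]
      congr 2
      rw [← RingOfIntegers.coe_eq_algebraMap, hβ]
      simp
    have hdvd : g ∣ F := by
      rwa [aeval_root_eq_mk, AdjoinRoot.mk_eq_zero] at h0
    have hdeg : F.natDegree ≤ g.natDegree := by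
      have h1 := minpoly.isIntegrallyClosed_eq_field_fractions ℚ (AdjoinRoot g) hintegral
      have h2 := minpoly.natDegree_le (A := ℚ) (algebraMap (𝓞 (AdjoinRoot g)) (AdjoinRoot g) β)
      rw [h1, natDegree_map_eq_of_injective (RingHom.injective_int _), ← hnat] at h2
      refine h2.trans (le_of_eq ?_)
      convert! (AdjoinRoot.powerBasis hg.ne_zero).finrank
    have hF0 : F ≠ 0 := by
      intro h0
      rw [h0, natDegree_zero] at hnat
      exact (minpoly.natDegree_pos hintegral).ne hnat
    obtain ⟨q, hq⟩ := hdvd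
    have hq0 : q ≠ 0 := by
      rintro rfl
      exact hF0 (by rw [hq, mul_zero])
    have hqd : q.natDegree = 0 := by
      rw [hq, natDegree_mul hg.ne_zero hq0] at hdeg
      omega
    obtain ⟨c, rfl⟩ := natDegree_eq_zero.1 hqd
    exact ⟨c, by rintro rfl; simp at hq0, by rw [hq, mul_comm]⟩
  · rw [Int.cast_mul] at hpn
    rw [rootCount_comp_C_mul_X _ hp (left_ne_zero_of_mul hpn), h p hp (right_ne_zero_of_mul hpn)]

open Classical in
theorem exists_sum_chiA_mul_rootCount_le (a : ℤ) (ha : a ≠ 0) (g : ℚ[X]) (hg : Irreducible g) :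
    ∃ F : ℤ[X], (∃ q : ℚ, q ≠ 0 ∧ F.map (Int.castRingHom ℚ) = C q * g) ∧
      ∃ P₀ : ℕ, ∀ P, P₀ ≤ P → ∃ B : ℝ, ∀ z, 2 ≤ z →
        ∑ p ∈ goodPrimes P z, chiA a p * rootCount F p / p
          ≤ (if IsSquare (a : AdjoinRoot g) then 1 else 0) * Real.log (Real.log z) + B := by
  have := Fact.mk hg
  obtain ⟨F, hF, n, hn, h⟩ := exists_integer_model g hg
  obtain ⟨B, hB⟩ := exists_sum_chiA_mul_idealCount_le (AdjoinRoot g) a ha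
  refine ⟨F, hF, n.natAbs, fun P hP => ⟨B + (primesUpTo P).card *
    (Module.finrank ℚ (AdjoinRoot g) : ℝ), fun z hz => ?_⟩⟩
  have h1 : ∑ p ∈ goodPrimes P z, chiA a p * rootCount F p / p =
      ∑ p ∈ goodPrimes P z, chiA a p * idealCount (AdjoinRoot g) p / p := by
    refine Finset.sum_congr rfl fun p hp => ?_
    obtain ⟨⟨-, hp⟩, hPp⟩ := mem_goodPrimes.1 hp
    rw [h p hp]
    rw [Ne, ZMod.intCast_zmod_eq_zero_iff_dvd, Int.natCast_dvd]
    intro hdvd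
    have := Nat.le_of_dvd (Int.natAbs_pos.2 hn) hdvd
    omega
  have h2 := Finset.sum_filter_add_sum_filter_not (primesUpTo z) (P < ·)
    fun p : ℕ => chiA a p * idealCount (AdjoinRoot g) p / p
  have h3 : -((primesUpTo P).card * (Module.finrank ℚ (AdjoinRoot g) : ℝ)) ≤
      ∑ p ∈ primesUpTo z with ¬ P < p, chiA a p * idealCount (AdjoinRoot g) p / p := by
    have h4 : ∑ p ∈ primesUpTo z with ¬ P < p, -(Module.finrank ℚ (AdjoinRoot g) : ℝ) ≤
        ∑ p ∈ primesUpTo z with ¬ P < p, chiA a p * idealCount (AdjoinRoot g) p / p := by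
      refine Finset.sum_le_sum fun p hp => ?_
      have hp' := (mem_primesUpTo.1 (Finset.mem_filter.1 hp).1).2
      have hp1 : (1 : ℝ) ≤ p := by exact_mod_cast hp'.one_le
      have h5 : (idealCount (AdjoinRoot g) p : ℝ) ≤ Module.finrank ℚ (AdjoinRoot g) := by
        exact_mod_cast idealCount_le_finrank hp'
      have h6 : (0 : ℝ) ≤ idealCount (AdjoinRoot g) p := Nat.cast_nonneg _
      rw [le_div_iff₀ (by linarith)]
      nlinarith [neg_one_le_chiA a p]
    refine le_trans ?_ h4
    rw [Finset.sum_const, nsmul_eq_mul, mul_neg, neg_le_neg_iff]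
    gcongr
    intro p hp
    rw [Finset.mem_filter, mem_primesUpTo] at hp
    exact mem_primesUpTo.2 ⟨not_lt.1 hp.2, hp.1.2⟩
  have h4 := hB z hz
  rw [h1]
  change ∑ p ∈ primesUpTo z with P < p, _ ≤ _
  linarith

end

section

open Polynomial

theorem sum_range_mul_of_periodic {q : ℕ} {f : ℤ → ℝ} (hf : ∀ x, f (x + q) = f x) (k : ℕ) :
    ∑ i ∈ Finset.range (q * k), f i = k * ∑ i ∈ Finset.range q, f i := by
  induction k with
  | zero => simp
  | succ k ih =>
    have h : ∑ x ∈ Finset.range q, f ((q * k + x : ℕ) : ℤ) = ∑ i ∈ Finset.range q, f i := by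
      rw [← sum_shift_eq_of_periodic hf (q * k)]
      refine Finset.sum_congr rfl fun i _ => ?_
      push_cast
      rfl
    rw [Nat.mul_succ, Finset.sum_range_add, ih, h]
    push_cast
    ring

theorem sum_range_intCast_zmod {p : ℕ} [NeZero p] (h : ZMod p → ℝ) :
    ∑ i ∈ Finset.range p, h ((i : ℤ) : ZMod p) = ∑ x, h x := by
  refine Finset.sum_nbij' (fun i => ((i : ℤ) : ZMod p)) ZMod.val ?_ ?_ ?_ ?_ ?_
  · simp
  · intro x _
    exact Finset.mem_range.2 (ZMod.val_lt x)
  · intro i hi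
    simp [ZMod.val_natCast, Nat.mod_eq_of_lt (Finset.mem_range.1 hi)]
  · intro x _
    simp
  · simp

theorem residueMean_sq_intCast {p : ℕ} [NeZero p] (h : ZMod p → ZMod p → ℝ) :
    residueMean (p ^ 2) (fun u v => h u v) = (∑ x, ∑ y, h x y) / (p : ℝ) ^ 2 := by
  have hp : (p : ℝ) ≠ 0 := by exact_mod_cast NeZero.ne p
  have hsum : ∀ k : ZMod p → ℝ, ∑ i ∈ Finset.range (p ^ 2), k ((i : ℤ) : ZMod p)
      = p * ∑ x, k x := by
    intro k
    rw [sq, sum_range_mul_of_periodic (f := fun x => k x) (fun x => by simp),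
      sum_range_intCast_zmod]
  rw [residueMean, hsum (fun x => ∑ v ∈ Finset.range (p ^ 2), h x ((v : ℤ) : ZMod p)),
    Finset.sum_congr rfl fun x _ => hsum (h x), ← Finset.mul_sum]
  push_cast
  field_simp

section

variable {p : ℕ}

/-- The binary quartic form with the reduction modulo `p` of the coefficients of `f`. -/
noncomputable def binQuarticMod (f : ℤ[X]) (p : ℕ) (x y : ZMod p) : ZMod p :=
  ∑ i ∈ Finset.range 5, (f.coeff i : ZMod p) * x ^ i * y ^ (4 - i)

theorem binQuartic_intCast (f : ℤ[X]) (u v : ℤ) :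
    (binQuartic f u v : ZMod p) = binQuarticMod f p u v := by
  simp [binQuartic, binQuarticMod]

theorem eval₂_eq_sum_range_five {R : Type*} [CommRing R] {f : ℤ[X]} (hf : f.natDegree ≤ 4) (x : R) :
    f.eval₂ (Int.castRingHom R) x = ∑ i ∈ Finset.range 5, (f.coeff i : R) * x ^ i :=
  eval₂_eq_sum_range' _ (by omega) _

theorem binQuarticMod_mul {f : ℤ[X]} (hf : f.natDegree ≤ 4) (x y : ZMod p) :
    binQuarticMod f p (x * y) y = y ^ 4 * f.eval₂ (Int.castRingHom (ZMod p)) x := by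
  rw [eval₂_eq_sum_range_five hf]
  simp only [binQuarticMod, Finset.sum_range_succ, Finset.sum_range_zero]
  ring

theorem binQuarticMod_zero (f : ℤ[X]) (x : ZMod p) :
    binQuarticMod f p x 0 = f.coeff 4 * x ^ 4 := by
  simp [binQuarticMod, Finset.sum_range_succ]

variable [Fact p.Prime]

theorem rootCount_le {f : ℤ[X]} (h : f.map (Int.castRingHom (ZMod p)) ≠ 0) :
    rootCount f p ≤ f.natDegree := by
  classical
  have h1 : Nat.card {x : ZMod p // f.eval₂ (Int.castRingHom (ZMod p)) x = 0} =
      (f.map (Int.castRingHom (ZMod p))).roots.toFinset.card := by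
    rw [← Fintype.card_coe, ← Nat.card_eq_fintype_card]
    refine Nat.card_congr (Equiv.subtypeEquivRight fun x => ?_)
    simp [h, IsRoot, eval_map]
  rw [rootCount, h1]
  exact (Multiset.toFinset_card_le _).trans ((card_roots' _).trans natDegree_map_le)

open Classical in
theorem sum_binQuarticMod_eq_zero {f : ℤ[X]} (hf : f.natDegree ≤ 4) :
    ∑ x : ZMod p, ∑ y : ZMod p, (if binQuarticMod f p x y = 0 then (1 : ℝ) else 0)
      = 1 + (p - 1) * (rootCount f p + if (f.coeff 4 : ZMod p) = 0 then 1 else 0) := by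
  have hp := (Fact.out : p.Prime)
  rw [Finset.sum_comm, ← Finset.add_sum_erase _ _ (Finset.mem_univ (0 : ZMod p))]
  have h0 : ∑ x : ZMod p, (if binQuarticMod f p x 0 = 0 then (1 : ℝ) else 0) =
      1 + (p - 1) * if (f.coeff 4 : ZMod p) = 0 then 1 else 0 := by
    simp only [binQuarticMod_zero]
    split_ifs with h4
    · simp [h4, ZMod.card]
    · simp [h4]
  have h1 : ∀ y ∈ Finset.univ.erase (0 : ZMod p),
      ∑ x : ZMod p, (if binQuarticMod f p x y = 0 then (1 : ℝ) else 0) = rootCount f p := by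
    intro y hy
    have hy0 : y ≠ 0 := Finset.ne_of_mem_erase hy
    rw [← Equiv.sum_comp (Equiv.mulRight₀ y hy0)]
    simp only [Equiv.mulRight₀_apply, binQuarticMod_mul hf, mul_eq_zero, pow_eq_zero_iff four_ne_zero,
      hy0, false_or]
    rw [← Finset.sum_filter, Finset.sum_const, nsmul_eq_mul, mul_one, rootCount,
      Nat.card_eq_fintype_card, Fintype.card_subtype]
  rw [h0, Finset.sum_congr rfl h1, Finset.sum_const, Finset.card_erase_of_mem (Finset.mem_univ _),
    Finset.card_univ, ZMod.card, nsmul_eq_mul, Nat.cast_sub hp.one_le]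
  push_cast
  ring

theorem dvd_natAbs_binQuartic_iff (f : ℤ[X]) (u v : ℤ) :
    p ∣ (binQuartic f u v).natAbs ↔ binQuarticMod f p u v = 0 := by
  rw [← Int.natCast_dvd, ← ZMod.intCast_zmod_eq_zero_iff_dvd, binQuartic_intCast]

theorem binQuartic_modEq (f : ℤ[X]) {q : ℤ} {u u' v v' : ℤ} (hu : u ≡ u' [ZMOD q])
    (hv : v ≡ v' [ZMOD q]) : binQuartic f u v ≡ binQuartic f u' v' [ZMOD q] := by
  simp only [binQuartic, Finset.sum_range_succ, Finset.sum_range_zero]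
  gcongr

open Classical in
theorem residueMean_dvdInd_binQuartic {f : ℤ[X]} (hf : f.natDegree ≤ 4) :
    residueMean (p ^ 2) (dvdInd (fun u v => (binQuartic f u v).natAbs) p) =
      (1 + (p - 1) * (rootCount f p + if (f.coeff 4 : ZMod p) = 0 then 1 else 0)) / (p : ℝ) ^ 2 := by
  rw [← sum_binQuarticMod_eq_zero hf, ← residueMean_sq_intCast]
  congr 1
  ext u v
  simp only [dvdInd, dvd_natAbs_binQuartic_iff]

end

theorem exists_int_smul_eq_map (G : ℚ[X]) :
    ∃ b : ℤ, b ≠ 0 ∧ ∃ H : ℤ[X], H.map (Int.castRingHom ℚ) = C (b : ℚ) * G := by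
  obtain ⟨b, hb, hbG⟩ := IsLocalization.integerNormalization_spec (nonZeroDivisors ℤ) G
  refine ⟨b, nonZeroDivisors.ne_zero hb, _, hbG.trans ?_⟩
  rw [zsmul_eq_mul, map_intCast]

theorem exists_eval₂_derivative_ne_zero {f : ℤ[X]}
    (hsf : Squarefree (f.map (Int.castRingHom ℚ))) :
    ∃ n : ℤ, n ≠ 0 ∧ ∀ p : ℕ, (n : ZMod p) ≠ 0 → ∀ x : ZMod p,
      f.eval₂ (Int.castRingHom (ZMod p)) x = 0 →
      f.derivative.eval₂ (Int.castRingHom (ZMod p)) x ≠ 0 := by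
  obtain ⟨A, B, hAB⟩ := PerfectField.separable_iff_squarefree.2 hsf
  obtain ⟨a, ha, A', hA'⟩ := exists_int_smul_eq_map A
  obtain ⟨b, hb, B', hB'⟩ := exists_int_smul_eq_map B
  refine ⟨a * b, mul_ne_zero ha hb, fun p hp x hx hx' => hp ?_⟩
  have h : C b * A' * f + C a * B' * f.derivative = C (a * b) := by
    apply map_injective _ (RingHom.injective_int (Int.castRingHom ℚ))
    rw [derivative_map] at hAB
    simp only [Polynomial.map_add, Polynomial.map_mul, Polynomial.map_C, hA', hB', C_mul,
      Int.coe_castRingHom]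
    linear_combination (C (a : ℚ) * C (b : ℚ)) * hAB
  have h2 := congrArg (eval₂ (Int.castRingHom (ZMod p)) x) h
  simp only [eval₂_add, eval₂_mul, eval₂_C, hx, hx', mul_zero, add_zero] at h2
  exact h2.symm

/-- The partial derivative of the binary quartic form with respect to its first variable. -/
noncomputable def binQuarticDeriv (f : ℤ[X]) (u v : ℤ) : ℤ :=
  ∑ i ∈ Finset.range 4, f.coeff (i + 1) * (i + 1) * u ^ i * v ^ (3 - i)

theorem exists_binQuartic_add (f : ℤ[X]) (u v t : ℤ) : ∃ k,
    binQuartic f (u + t) v = binQuartic f u v + t * binQuarticDeriv f u v + t ^ 2 * k := by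
  refine ⟨f.coeff 2 * v ^ 2 + f.coeff 3 * (3 * u + t) * v
    + f.coeff 4 * (6 * u ^ 2 + 4 * u * t + t ^ 2), ?_⟩
  simp only [binQuartic, binQuarticDeriv, Finset.sum_range_succ, Finset.sum_range_zero]
  push_cast
  ring

section

variable {p : ℕ} [Fact p.Prime] {f : ℤ[X]}

theorem binQuarticDeriv_intCast (hf : f.natDegree ≤ 4) {u v : ℤ} {x : ZMod p}
    (hx : (u : ZMod p) = x * v) : (binQuarticDeriv f u v : ZMod p) =
      v ^ 3 * f.derivative.eval₂ (Int.castRingHom (ZMod p)) x := by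
  have hd : f.derivative.natDegree < 4 := by
    have := natDegree_derivative_le f
    omega
  rw [eval₂_eq_sum_range' _ hd]
  simp only [binQuarticDeriv, Finset.sum_range_succ, Finset.sum_range_zero, coeff_derivative]
  push_cast
  rw [hx]
  simp
  ring

theorem card_fiber_le (hf : f.natDegree ≤ 4) (hlead : f.map (Int.castRingHom (ZMod p)) ≠ 0)
    (hroot : ∀ x : ZMod p, f.eval₂ (Int.castRingHom (ZMod p)) x = 0 →
      f.derivative.eval₂ (Int.castRingHom (ZMod p)) x ≠ 0)
    {v : ℤ} (hv : (v : ZMod p) ≠ 0) :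
    ((Finset.range (p ^ 2)).filter fun u : ℕ => ((p ^ 2 : ℕ) : ℤ) ∣ binQuartic f u v).card ≤ 4 := by
  classical
  have hp := (Fact.out : p.Prime)
  have hpZ : Prime (p : ℤ) := Nat.prime_iff_prime_int.1 hp
  refine le_trans ?_ ((rootCount_le hlead).trans hf)
  rw [rootCount, Nat.card_eq_fintype_card, Fintype.card_subtype]
  have hdiv : ∀ u : ℕ, ((p ^ 2 : ℕ) : ℤ) ∣ binQuartic f u v →
      f.eval₂ (Int.castRingHom (ZMod p)) (((u : ℤ) : ZMod p) / v) = 0 := by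
    intro u hu
    have h1 : (binQuartic f u v : ZMod p) = 0 := by
      rw [ZMod.intCast_zmod_eq_zero_iff_dvd]
      exact (Int.natCast_dvd_natCast.2 (Dvd.intro_left _ (sq p).symm)).trans hu
    rw [binQuartic_intCast, ← div_mul_cancel₀ ((u : ℤ) : ZMod p) hv, binQuarticMod_mul hf] at h1
    exact (mul_eq_zero.1 h1).resolve_left (pow_ne_zero _ hv)
  refine Finset.card_le_card_of_injOn (fun u : ℕ => ((u : ℤ) : ZMod p) / v) ?_ ?_
  · intro u hu
    simp only [Finset.coe_filter, Set.mem_ofPred_eq] at hu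
    simpa using hdiv u hu.2
  · intro u hu u' hu' huu
    simp only [Finset.coe_filter, Set.mem_ofPred_eq, Finset.mem_range] at hu hu'
    have h1 : ((u : ℤ) : ZMod p) = ((u' : ℤ) : ZMod p) := (div_left_inj' hv).1 huu
    rw [← sub_eq_zero, ← Int.cast_sub, ZMod.intCast_zmod_eq_zero_iff_dvd] at h1
    obtain ⟨s, hs⟩ := h1
    obtain ⟨k, hk⟩ := exists_binQuartic_add f u' v (p * s)
    rw [← hs, add_sub_cancel, hs] at hk
    have hD : ¬ (p : ℤ) ∣ binQuarticDeriv f u' v := by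
      rw [← ZMod.intCast_zmod_eq_zero_iff_dvd,
        binQuarticDeriv_intCast hf (div_mul_cancel₀ ((u' : ℤ) : ZMod p) hv).symm]
      exact mul_ne_zero (pow_ne_zero _ hv) (hroot _ (hdiv u' hu'.2))
    have h2 : (p : ℤ) * p ∣ p * (s * binQuarticDeriv f u' v) := by
      have h3 := (dvd_sub (dvd_sub hu.2 hu'.2) (dvd_mul_right ((p ^ 2 : ℕ) : ℤ) (s ^ 2 * k)))
      rw [hk] at h3
      push_cast at h3
      rwa [← sq, show (p : ℤ) * (s * binQuarticDeriv f u' v) = binQuartic f u' v +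
        p * s * binQuarticDeriv f u' v + (p * s) ^ 2 * k - binQuartic f u' v - p ^ 2 * (s ^ 2 * k)
        by ring]
    rw [mul_dvd_mul_iff_left hpZ.ne_zero] at h2
    obtain ⟨s', rfl⟩ := (hpZ.dvd_or_dvd h2).resolve_right hD
    have h4 : ((p ^ 2 : ℕ) : ℤ) ∣ (u : ℤ) - u' := ⟨s', by rw [hs]; push_cast; ring⟩
    have h5 : u' ≡ u [MOD p ^ 2] := (Nat.modEq_iff_dvd).2 h4
    exact (Nat.ModEq.eq_of_lt_of_lt h5 hu'.1 hu.1).symm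

theorem dvd_of_sq_dvd_binQuartic (hlead : (f.coeff 4 : ZMod p) ≠ 0 ∨
      (f.coeff 4 = 0 ∧ (f.coeff 3 : ZMod p) ≠ 0)) {u v : ℤ} (hv : (p : ℤ) ∣ v)
    (h : ((p ^ 2 : ℕ) : ℤ) ∣ binQuartic f u v) : (p : ℤ) ∣ u ∨ ((p ^ 2 : ℕ) : ℤ) ∣ v := by
  have hp := (Fact.out : p.Prime)
  have hpZ : Prime (p : ℤ) := Nat.prime_iff_prime_int.1 hp
  obtain ⟨w, rfl⟩ := hv
  rw [Ne, Ne, ZMod.intCast_zmod_eq_zero_iff_dvd, ZMod.intCast_zmod_eq_zero_iff_dvd] at hlead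
  push_cast at h ⊢
  rcases hlead with h4 | ⟨h4, h3⟩
  · left
    have h1 : (p : ℤ) ∣ f.coeff 4 * u ^ 4 := by
      have h2 : (p : ℤ) ∣ binQuartic f u (p * w) := (dvd_pow_self _ two_ne_zero).trans h
      have h3 : binQuartic f u (p * w) = f.coeff 4 * u ^ 4 + p * (f.coeff 0 * p ^ 3 * w ^ 4
          + f.coeff 1 * u * p ^ 2 * w ^ 3 + f.coeff 2 * u ^ 2 * p * w ^ 2
          + f.coeff 3 * u ^ 3 * w) := by
        simp only [binQuartic, Finset.sum_range_succ, Finset.sum_range_zero]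
        ring
      rw [h3] at h2
      exact (dvd_add_left (dvd_mul_right _ _)).1 h2
    exact hpZ.dvd_of_dvd_pow ((hpZ.dvd_or_dvd h1).resolve_left h4)
  · have h1 : (p : ℤ) ∣ f.coeff 3 * (u ^ 3 * w) := by
      have h5 : binQuartic f u (p * w) = p * (f.coeff 3 * (u ^ 3 * w)) +
          p ^ 2 * (f.coeff 0 * p ^ 2 * w ^ 4
          + f.coeff 1 * u * p * w ^ 3 + f.coeff 2 * u ^ 2 * w ^ 2) := by
        simp only [binQuartic, Finset.sum_range_succ, Finset.sum_range_zero, h4]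
        ring
      rw [h5, dvd_add_left (dvd_mul_right _ _), sq, mul_dvd_mul_iff_left hpZ.ne_zero] at h
      exact h
    rcases hpZ.dvd_or_dvd ((hpZ.dvd_or_dvd h1).resolve_left h3) with h6 | h6
    · exact Or.inl (hpZ.dvd_of_dvd_pow h6)
    · right
      rw [sq]
      exact mul_dvd_mul_left _ h6

theorem map_ne_zero_of_leading (hlead : (f.coeff 4 : ZMod p) ≠ 0 ∨
      (f.coeff 4 = 0 ∧ (f.coeff 3 : ZMod p) ≠ 0)) : f.map (Int.castRingHom (ZMod p)) ≠ 0 := by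
  intro h
  have h3 := congrArg (coeff · 3) h
  have h4 := congrArg (coeff · 4) h
  simp only [coeff_map, coeff_zero, eq_intCast] at h3 h4
  rcases hlead with h' | ⟨-, h'⟩
  · exact h' h4
  · exact h' h3

theorem card_sq_dvd_le (hf : f.natDegree ≤ 4) (hlead : (f.coeff 4 : ZMod p) ≠ 0 ∨
      (f.coeff 4 = 0 ∧ (f.coeff 3 : ZMod p) ≠ 0))
    (hroot : ∀ x : ZMod p, f.eval₂ (Int.castRingHom (ZMod p)) x = 0 →
      f.derivative.eval₂ (Int.castRingHom (ZMod p)) x ≠ 0) :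
    ((Finset.range (p ^ 2) ×ˢ Finset.range (p ^ 2)).filter fun x : ℕ × ℕ =>
      ((p ^ 2 : ℕ) : ℤ) ∣ binQuartic f x.1 x.2).card ≤ 6 * p ^ 2 := by
  classical
  have hp := (Fact.out : p.Prime)
  set S := (Finset.range (p ^ 2) ×ˢ Finset.range (p ^ 2)).filter fun x : ℕ × ℕ =>
      ((p ^ 2 : ℕ) : ℤ) ∣ binQuartic f x.1 x.2 with hS
  have hmem : ∀ x, x ∈ S ↔ (x.1 < p ^ 2 ∧ x.2 < p ^ 2) ∧ ((p ^ 2 : ℕ) : ℤ) ∣ binQuartic f x.1 x.2 := by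
    intro x
    simp [hS]
  have h1 : (S.filter fun x => ¬ p ∣ x.2).card ≤ 4 * (p ^ 2) := by
    rw [← Finset.card_range (p ^ 2)]
    refine Finset.card_le_mul_card_image_of_maps_to (f := Prod.snd) (fun x hx => ?_) 4
      fun v hv => ?_
    · exact Finset.mem_range.2 ((hmem x).1 (Finset.mem_filter.1 hx).1).1.2
    · by_cases hpv : p ∣ v
      · rw [Finset.filter_eq_empty_iff.2, Finset.card_empty]
        · exact Nat.zero_le _
        · rintro x hx rfl
          exact (Finset.mem_filter.1 hx).2 hpv
      · refine le_trans ?_ (card_fiber_le hf (map_ne_zero_of_leading hlead) hroot (v := v) ?_)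
        · refine Finset.card_le_card_of_injOn Prod.fst ?_ ?_
          · rintro ⟨x, y⟩ hx
            simp only [Finset.coe_filter, Finset.mem_filter, hmem, Set.mem_ofPred_eq] at hx
            obtain ⟨⟨h, -⟩, rfl⟩ := hx
            simp only [Finset.coe_filter, Finset.mem_range, Set.mem_ofPred_eq]
            exact ⟨h.1.1, h.2⟩
          · rintro ⟨x, y⟩ hx ⟨x', y'⟩ hx' h
            simp only [Finset.coe_filter, Set.mem_ofPred_eq] at hx hx'
            exact Prod.ext h (hx.2.trans hx'.2.symm)
        · rw [Int.cast_natCast, Ne, ZMod.natCast_eq_zero_iff]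
          exact hpv
  have h2 : ((S.filter fun x => p ∣ x.2).filter fun x => p ∣ x.1).card ≤ p ^ 2 := by
    have h3 : (Finset.range p ×ˢ Finset.range p).card = p ^ 2 := by
      rw [Finset.card_product, Finset.card_range, sq]
    rw [← h3]
    refine Finset.card_le_card_of_injOn (fun x => (x.1 / p, x.2 / p)) ?_ ?_
    · intro x hx
      simp only [Finset.coe_filter, Finset.mem_filter, hmem, Set.mem_ofPred_eq] at hx
      simp only [Finset.coe_product, Finset.coe_range, Set.mem_prod, Set.mem_Iio]
      rw [Nat.div_lt_iff_lt_mul hp.pos, Nat.div_lt_iff_lt_mul hp.pos, ← sq]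
      exact hx.1.1.1
    · intro x hx y hy h
      simp only [Finset.coe_filter, Finset.mem_filter, Set.mem_ofPred_eq] at hx hy
      rw [Prod.mk.injEq] at h
      exact Prod.ext ((Nat.div_left_inj hx.2 hy.2).1 h.1) ((Nat.div_left_inj hx.1.2 hy.1.2).1 h.2)
  have h3 : ((S.filter fun x => p ∣ x.2).filter fun x => ¬ p ∣ x.1).card ≤ p ^ 2 := by
    conv_rhs => rw [← Finset.card_range (p ^ 2)]
    have hv0 : ∀ x ∈ (S.filter fun x => p ∣ x.2).filter fun x => ¬ p ∣ x.1, x.2 = 0 := by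
      intro x hx
      simp only [Finset.mem_filter, hmem] at hx
      have := (dvd_of_sq_dvd_binQuartic hlead (Int.natCast_dvd_natCast.2 hx.1.2) hx.1.1.2).resolve_left
        (fun h => hx.2 (Int.natCast_dvd_natCast.1 h))
      exact Nat.eq_zero_of_dvd_of_lt (Int.natCast_dvd_natCast.1 this) hx.1.1.1.2
    refine Finset.card_le_card_of_injOn Prod.fst ?_ ?_
    · intro x hx
      simp only [Finset.coe_filter, Finset.mem_filter, hmem, Set.mem_ofPred_eq] at hx
      simpa using hx.1.1.1.1
    · intro x hx y hy h
      exact Prod.ext h ((hv0 x hx).trans (hv0 y hy).symm)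
  have h4 := Finset.card_filter_add_card_filter_not (s := S) fun x => p ∣ x.2
  have h5 := Finset.card_filter_add_card_filter_not (s := S.filter fun x => p ∣ x.2) fun x => p ∣ x.1
  omega

open Classical in
theorem residueMean_sq_dvd_le (hf : f.natDegree ≤ 4) (hlead : (f.coeff 4 : ZMod p) ≠ 0 ∨
      (f.coeff 4 = 0 ∧ (f.coeff 3 : ZMod p) ≠ 0))
    (hroot : ∀ x : ZMod p, f.eval₂ (Int.castRingHom (ZMod p)) x = 0 →
      f.derivative.eval₂ (Int.castRingHom (ZMod p)) x ≠ 0) :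
    residueMean (p ^ 2) (fun u v => if p ^ 2 ∣ (binQuartic f u v).natAbs then 1 else 0)
      ≤ 6 / (p : ℝ) ^ 2 := by
  have hp := (Fact.out : p.Prime)
  have hp0 : (0 : ℝ) < p := by exact_mod_cast hp.pos
  have h : (((Finset.range (p ^ 2) ×ˢ Finset.range (p ^ 2)).filter fun x : ℕ × ℕ =>
      ((p ^ 2 : ℕ) : ℤ) ∣ binQuartic f x.1 x.2).card : ℝ) ≤ 6 * (p : ℝ) ^ 2 := by
    exact_mod_cast card_sq_dvd_le hf hlead hroot
  rw [residueMean, ← Finset.sum_product', Finset.sum_boole]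
  simp only [← Int.natCast_dvd]
  push_cast at h ⊢
  rw [div_le_div_iff₀ (by positivity) (by positivity)]
  nlinarith [pow_pos hp0 2]

end

theorem exists_int_mul_eq_int_mul_prod {ι : Type*} [Fintype ι] {f : ℤ[X]} (hf : f ≠ 0) {c : ℚ}
    {g : ι → ℚ[X]} (hfac : f.map (Int.castRingHom ℚ) = C c * ∏ i, g i) {F : ι → ℤ[X]} {q : ι → ℚ}
    (hq : ∀ i, q i ≠ 0) (hF : ∀ i, (F i).map (Int.castRingHom ℚ) = C (q i) * g i) :
    ∃ s t : ℤ, s ≠ 0 ∧ t ≠ 0 ∧ C t * f = C s * ∏ i, F i := by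
  have hQ : ∏ i, q i ≠ 0 := Finset.prod_ne_zero_iff.2 fun i _ => hq i
  have hc : c ≠ 0 := by
    rintro rfl
    rw [C_0, zero_mul, Polynomial.map_eq_zero_iff (RingHom.injective_int _)] at hfac
    exact hf hfac
  set d := c / ∏ i, q i with hd
  refine ⟨d.num, d.den, Rat.num_ne_zero.2 (div_ne_zero hc hQ), by exact_mod_cast d.den_nz, ?_⟩
  apply map_injective _ (RingHom.injective_int (Int.castRingHom ℚ))
  have h1 : (d.den : ℚ) * c = d.num * ∏ i, q i := by
    rw [← Rat.den_mul_eq_num d, mul_assoc, hd, div_mul_cancel₀ _ hQ]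
  simp only [Polynomial.map_mul, Polynomial.map_C, Polynomial.map_prod, hfac, hF,
    Finset.prod_mul_distrib, Int.coe_castRingHom, Int.cast_natCast]
  rw [← mul_assoc, ← mul_assoc, ← C_mul, h1, C_mul, map_prod C]

theorem rootCount_eq_sum {p : ℕ} [Fact p.Prime] {ι : Type*} [Fintype ι] {f : ℤ[X]} {F : ι → ℤ[X]}
    {s t : ℤ} (hs : (s : ZMod p) ≠ 0) (ht : (t : ZMod p) ≠ 0) (h : C t * f = C s * ∏ i, F i)
    (hroot : ∀ x : ZMod p, f.eval₂ (Int.castRingHom (ZMod p)) x = 0 →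
      f.derivative.eval₂ (Int.castRingHom (ZMod p)) x ≠ 0) :
    rootCount f p = ∑ i, rootCount (F i) p := by
  classical
  simp only [rootCount, Nat.card_eq_fintype_card, Fintype.card_subtype]
  have hzero : ∀ x : ZMod p, f.eval₂ (Int.castRingHom (ZMod p)) x = 0 ↔
      ∃ i, (F i).eval₂ (Int.castRingHom (ZMod p)) x = 0 := by
    intro x
    have h1 := congrArg (eval₂ (Int.castRingHom (ZMod p)) x) h
    simp only [eval₂_mul, eval₂_C, eval₂_finsetProd, Int.coe_castRingHom] at h1
    have h2 : f.eval₂ (Int.castRingHom (ZMod p)) x = 0 ↔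
        ∏ i, (F i).eval₂ (Int.castRingHom (ZMod p)) x = 0 := by
      rw [← mul_eq_zero_iff_left ht, h1, mul_eq_zero, or_iff_right hs]
    rw [h2, Finset.prod_eq_zero_iff]
    simp
  rw [← Finset.card_biUnion]
  · congr 1
    ext x
    simp [hzero]
  · intro i _ j _ hij
    rw [Function.onFun, Finset.disjoint_left]
    intro x hi hj
    rw [Finset.mem_filter] at hi hj
    refine hroot x ((hzero x).2 ⟨i, hi.2⟩) ?_
    rw [← Finset.mul_prod_erase _ _ (Finset.mem_univ i), ← Finset.mul_prod_erase _ _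
      (Finset.mem_erase.2 ⟨hij.symm, Finset.mem_univ j⟩)] at h
    have h1 := congrArg (fun g => eval₂ (Int.castRingHom (ZMod p)) x (derivative g)) h
    simp only [derivative_mul, derivative_C, eval₂_mul, eval₂_add, eval₂_C, hi.2, hj.2,
      mul_zero, zero_mul, add_zero, zero_add] at h1
    exact (mul_eq_zero.1 h1).resolve_left ht

theorem intCast_zmod_ne_zero {n : ℤ} (hn : n ≠ 0) {p : ℕ} (hp : n.natAbs < p) :
    (n : ZMod p) ≠ 0 := by
  rw [Ne, ZMod.intCast_zmod_eq_zero_iff_dvd, Int.natCast_dvd]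
  exact fun h => hp.not_ge (Nat.le_of_dvd (Int.natAbs_pos.2 hn) h)

theorem exists_sum_chiA_mul_rootCount_le_of_eq_prod {ι : Type*} [Fintype ι] {a : ℤ} (ha : a ≠ 0)
    {f : ℤ[X]} (hsf : Squarefree (f.map (Int.castRingHom ℚ))) {c : ℚ}
    {g : ι → ℚ[X]} (hirr : ∀ i, Irreducible (g i))
    (hfac : f.map (Int.castRingHom ℚ) = C c * ∏ i, g i) :
    ∃ P₀ : ℕ, ∀ P, P₀ ≤ P → ∃ B : ℝ, ∀ z, 2 ≤ z →
      ∑ p ∈ goodPrimes P z, chiA a p * rootCount f p / p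
        ≤ Nat.card {i // IsSquare (a : AdjoinRoot (g i))} * Real.log (Real.log z) + B := by
  classical
  have hf : f ≠ 0 := by
    rintro rfl
    rw [Polynomial.map_zero] at hsf
    exact hsf.ne_zero rfl
  choose F hF P₁ hP₁ using fun i => exists_sum_chiA_mul_rootCount_le a ha (g i) (hirr i)
  choose q hq hF using hF
  obtain ⟨s, t, hs, ht, hst⟩ := exists_int_mul_eq_int_mul_prod hf hfac hq hF
  obtain ⟨n, hn, hroot⟩ := exists_eval₂_derivative_ne_zero hsf
  refine ⟨s.natAbs + t.natAbs + n.natAbs + ∑ i, P₁ i, fun P hP => ?_⟩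
  choose B hB using fun i => hP₁ i P
    (le_trans (Finset.single_le_sum (f := P₁) (fun _ _ => Nat.zero_le _) (Finset.mem_univ i)) (by omega))
  refine ⟨∑ i, B i, fun z hz => ?_⟩
  have h1 : ∀ p ∈ goodPrimes P z, chiA a p * rootCount f p / p =
      ∑ i, chiA a p * rootCount (F i) p / p := by
    intro p hp
    obtain ⟨⟨-, hp⟩, hPp⟩ := mem_goodPrimes.1 hp
    have := Fact.mk hp
    rw [rootCount_eq_sum (intCast_zmod_ne_zero hs (by omega)) (intCast_zmod_ne_zero ht (by omega)) hst
      (hroot p (intCast_zmod_ne_zero hn (by omega))), Nat.cast_sum, Finset.mul_sum, Finset.sum_div]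
  rw [Finset.sum_congr rfl h1, Finset.sum_comm]
  refine (Finset.sum_le_sum fun i _ => hB i z hz).trans (le_of_eq ?_)
  rw [Finset.sum_add_distrib, ← Finset.sum_mul, Finset.sum_boole, Nat.card_eq_fintype_card,
    Fintype.card_subtype]

theorem exists_sum_chiA_div_le {a : ℤ} (ha : ¬ IsSquare a) :
    ∃ P₀ : ℕ, ∀ P, P₀ ≤ P → ∃ B : ℝ, ∀ z, 2 ≤ z → ∑ p ∈ goodPrimes P z, chiA a p / p ≤ B := by
  have ha0 : a ≠ 0 := by
    rintro rfl
    exact ha (IsSquare.zero)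
  have hX : ((X : ℤ[X]).map (Int.castRingHom ℚ)) = C 1 * ∏ i : Unit, (X : ℚ[X]) := by simp
  obtain ⟨P₀, h⟩ := exists_sum_chiA_mul_rootCount_le_of_eq_prod ha0 (f := X)
    (by rw [map_X]; exact irreducible_X.squarefree) (fun _ => irreducible_X) hX
  have hsq : ¬ IsSquare (a : AdjoinRoot (X : ℚ[X])) := by
    intro hs
    have h1 := hs.map (AdjoinRoot.lift (RingHom.id ℚ) 0 (by simp))
    rw [map_intCast, Rat.isSquare_intCast_iff] at h1
    exact ha h1
  have hroot : ∀ p, rootCount X p = 1 := by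
    intro p
    simp [rootCount]
  refine ⟨P₀, fun P hP => ?_⟩
  obtain ⟨B, hB⟩ := h P hP
  refine ⟨B, fun z hz => ?_⟩
  simpa [hroot, hsq] using hB z hz

open Classical in
/-- The indicator function of `p ∣ n u v` if `χ_a(p) = 1`, and of `p² ∣ n u v` otherwise. -/
noncomputable def splitInd (a : ℤ) (n : ℤ → ℤ → ℕ) (p : ℕ) (u v : ℤ) : ℝ :=
  if chiA a p = 1 then dvdInd n p u v else if p ^ 2 ∣ n u v then 1 else 0

theorem chiA_eq_one_or {a : ℤ} (ha : a ≠ 0) {p : ℕ} (hp : 2 < p) (hap : a.natAbs < p) :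
    chiA a p = 1 ∨ chiA a p = -1 := by
  have := intCast_zmod_ne_zero ha hap
  unfold chiA
  rw [if_neg hp.ne', if_neg this]
  split_ifs <;> simp

section

variable {f : ℤ[X]}

theorem dvd_binQuartic_congr (f : ℤ[X]) {q d : ℕ} (hd : d ∣ q) {u u' v v' : ℤ}
    (hu : u ≡ u' [ZMOD q]) (hv : v ≡ v' [ZMOD q]) :
    d ∣ (binQuartic f u v).natAbs ↔ d ∣ (binQuartic f u' v').natAbs := by
  rw [← Int.natCast_dvd, ← Int.natCast_dvd]
  exact Int.ModEq.dvd_iff ((binQuartic_modEq f hu hv).of_dvd (Int.natCast_dvd_natCast.2 hd))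

theorem periodicMod_dvdInd_binQuartic (f : ℤ[X]) (p : ℕ) :
    PeriodicMod (p ^ 2) (dvdInd (fun u v => (binQuartic f u v).natAbs) p) := by
  intro u u' v v' hu hv
  simp only [dvdInd, dvd_binQuartic_congr f (Dvd.intro_left _ (sq p).symm) hu hv]

theorem periodicMod_splitInd_binQuartic (a : ℤ) (f : ℤ[X]) (p : ℕ) :
    PeriodicMod (p ^ 2) (splitInd a (fun u v => (binQuartic f u v).natAbs) p) := by
  intro u u' v v' hu hv
  simp only [splitInd, periodicMod_dvdInd_binQuartic f p u u' v v' hu hv,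
    dvd_binQuartic_congr f dvd_rfl hu hv]

theorem splitInd_zero_or_one (a : ℤ) (n : ℤ → ℤ → ℕ) (p : ℕ) (u v : ℤ) :
    splitInd a n p u v = 0 ∨ splitInd a n p u v = 1 := by
  unfold splitInd
  split_ifs
  · exact dvdInd_zero_or_one n p u v
  all_goals simp

theorem splitInd_eq_one_of_varpiA_ne_zero {a : ℤ} (ha : a ≠ 0) {n : ℤ → ℤ → ℕ} {u v : ℤ}
    (hn : n u v ≠ 0) (h : varpiA a (n u v) ≠ 0) {p : ℕ} (hp : p.Prime) (hp2 : 2 < p)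
    (hap : a.natAbs < p) (hpn : p ∣ n u v) : splitInd a n p u v = 1 := by
  unfold splitInd dvdInd
  rw [if_pos hpn]
  split_ifs with h1 h2
  · rfl
  · rfl
  · refine absurd ?_ h
    have h3 : chiA a p = -1 := (chiA_eq_one_or ha hp2 hap).resolve_left h1
    rw [varpiA, thetaA, Finset.prod_eq_zero (i := p), mul_zero]
    · exact Finset.mem_filter.2 ⟨Nat.mem_primeFactors.2 ⟨hp, hpn, hn⟩, h2⟩
    · rw [h3]
      norm_num

theorem exists_localDensities {ι : Type*} [Fintype ι] {a : ℤ} (ha : ¬ IsSquare a)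
    (hdeg : f.natDegree = 3 ∨ f.natDegree = 4) (hsf : Squarefree (f.map (Int.castRingHom ℚ)))
    {c : ℚ} {g : ι → ℚ[X]} (hirr : ∀ i, Irreducible (g i))
    (hfac : f.map (Int.castRingHom ℚ) = C c * ∏ i, g i) :
    ∃ (P : ℕ) (C : ℝ), a.natAbs ≤ P ∧ LocalDensities (fun u v => (binQuartic f u v).natAbs)
      (splitInd a fun u v => (binQuartic f u v).natAbs) P
      (Nat.card {i // IsSquare (a : AdjoinRoot (g i))}) 6 C := by
  classical
  have ha0 : a ≠ 0 := by
    rintro rfl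
    exact ha IsSquare.zero
  have hd4 : f.natDegree ≤ 4 := by omega
  obtain ⟨n, hn, hroot⟩ := exists_eval₂_derivative_ne_zero hsf
  obtain ⟨P₁, h₁⟩ := exists_sum_chiA_mul_rootCount_le_of_eq_prod ha0 hsf hirr hfac
  obtain ⟨P₂, h₂⟩ := exists_sum_chiA_div_le ha
  set P := 12 + a.natAbs + n.natAbs + (f.coeff 3).natAbs + (f.coeff 4).natAbs + P₁ + P₂ with hP
  obtain ⟨B₁, hB₁⟩ := h₁ P (by omega)
  obtain ⟨B₂, hB₂⟩ := h₂ P (by omega)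
  set δ : ℝ := if f.coeff 4 = 0 then 1 else 0 with hδ
  have hδ0 : 0 ≤ δ := by rw [hδ]; split_ifs <;> norm_num
  have hδ1 : δ ≤ 1 := by rw [hδ]; split_ifs <;> norm_num
  have hlead : ∀ p : ℕ, P < p → (f.coeff 4 : ZMod p) ≠ 0 ∨
      (f.coeff 4 = 0 ∧ (f.coeff 3 : ZMod p) ≠ 0) := by
    intro p hp
    by_cases h4 : f.coeff 4 = 0
    · refine Or.inr ⟨h4, intCast_zmod_ne_zero ?_ (by omega)⟩
      rcases hdeg with h | h
      · rw [← h, coeff_natDegree, Ne, leadingCoeff_eq_zero]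
        rintro rfl
        simp at h
      · rw [← h, coeff_natDegree, leadingCoeff_eq_zero] at h4
        rw [h4] at h
        simp at h
    · exact Or.inl (intCast_zmod_ne_zero h4 (by omega))
  have hmean : ∀ p : ℕ, p.Prime → P < p →
      residueMean (p ^ 2) (dvdInd (fun u v => (binQuartic f u v).natAbs) p) =
        (1 + (p - 1) * (rootCount f p + δ)) / (p : ℝ) ^ 2 := by
    intro p hp hPp
    have := Fact.mk hp
    rw [residueMean_dvdInd_binQuartic hd4]
    congr 4
    rw [hδ]
    by_cases h4 : f.coeff 4 = 0
    · simp [h4]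
    · rw [if_neg h4, if_neg (intCast_zmod_ne_zero h4 (by omega))]
  have hr : ∀ p : ℕ, p.Prime → P < p → (rootCount f p : ℝ) ≤ 4 := by
    intro p hp hPp
    have := Fact.mk hp
    exact_mod_cast (rootCount_le (map_ne_zero_of_leading (hlead p hPp))).trans hd4
  have hsq : ∀ p : ℕ, p.Prime → P < p → residueMean (p ^ 2)
      (fun u v => if p ^ 2 ∣ (binQuartic f u v).natAbs then 1 else 0) ≤ 6 / (p : ℝ) ^ 2 := by
    intro p hp hPp
    have := Fact.mk hp
    exact residueMean_sq_dvd_le hd4 (hlead p hPp) (hroot p (intCast_zmod_ne_zero hn (by omega)))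
  have hle : ∀ p : ℕ, p.Prime → P < p →
      residueMean (p ^ 2) (dvdInd (fun u v => (binQuartic f u v).natAbs) p) ≤ 6 / p := by
    intro p hp hPp
    have hp1 : (1 : ℝ) ≤ p := by exact_mod_cast hp.one_le
    rw [hmean p hp hPp, div_le_div_iff₀ (by positivity) (by positivity)]
    have h5 : (p - 1) * (rootCount f p + δ) ≤ (p - 1) * (5 : ℝ) :=
      mul_le_mul_of_nonneg_left (by linarith [hr p hp hPp]) (by linarith)
    nlinarith
  have hsplit : ∀ p : ℕ, splitInd a (fun u v => (binQuartic f u v).natAbs) p =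
      if chiA a p = 1 then dvdInd (fun u v => (binQuartic f u v).natAbs) p
      else fun u v => if p ^ 2 ∣ (binQuartic f u v).natAbs then 1 else 0 := by
    intro p
    ext u v
    unfold splitInd
    split_ifs <;> simp_all
  refine ⟨P, B₁ + δ * B₂ + 34, by omega, ?_⟩
  constructor
  · omega
  · norm_num
  · exact fun p _ _ => periodicMod_dvdInd_binQuartic f p
  · exact fun p _ _ => periodicMod_splitInd_binQuartic a f p
  · exact fun p _ _ => splitInd_zero_or_one a _ p
  · intro p hp hPp
    refine (hle p hp hPp).trans ?_
    have hp12 : (12 : ℝ) ≤ p := by exact_mod_cast (by omega : 12 ≤ p)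
    rw [div_le_div_iff₀ (by linarith) (by norm_num)]
    linarith
  · exact hle
  · intro p hp hPp
    rw [hsplit]
    split_ifs
    · exact hle p hp hPp
    · refine (hsq p hp hPp).trans ?_
      have hp1 : (1 : ℝ) ≤ p := by exact_mod_cast hp.one_le
      gcongr
      exact le_self_pow₀ hp1 two_ne_zero
  · intro z hz
    have hterm : ∀ p ∈ goodPrimes P z,
        2 * residueMean (p ^ 2) (splitInd a (fun u v => (binQuartic f u v).natAbs) p) -
          residueMean (p ^ 2) (dvdInd (fun u v => (binQuartic f u v).natAbs) p) ≤
        chiA a p * rootCount f p / p + δ * (chiA a p / p) + 17 * (1 / (p : ℝ) ^ 2) := by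
      intro p hp
      obtain ⟨⟨-, hp⟩, hPp⟩ := mem_goodPrimes.1 hp
      have hp0 : (0 : ℝ) < p := by exact_mod_cast hp.pos
      have hr0 : (0 : ℝ) ≤ rootCount f p := Nat.cast_nonneg _
      have h6 : residueMean (p ^ 2) (dvdInd (fun u v => (binQuartic f u v).natAbs) p) =
          rootCount f p / p + δ * (1 / p) + (1 - (rootCount f p + δ)) * (1 / (p : ℝ) ^ 2) := by
        rw [hmean p hp hPp]
        field_simp
        ring
      have h7 : 0 < 1 / (p : ℝ) ^ 2 := by positivity
      rw [hsplit]
      rcases chiA_eq_one_or ha0 (p := p) (by omega) (by omega) with h | h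
      · rw [if_pos h, h, one_mul, h6]
        nlinarith
      · rw [if_neg (by rw [h]; norm_num), h, h6]
        have h8 := hsq p hp hPp
        have h9 := hr p hp hPp
        rw [div_eq_mul_one_div] at h8
        rw [neg_one_mul, neg_div, neg_div]
        nlinarith
    refine (Finset.sum_le_sum hterm).trans ?_
    rw [Finset.sum_add_distrib, Finset.sum_add_distrib, ← Finset.mul_sum, ← Finset.mul_sum]
    have h1 := hB₁ z hz
    have h2 := mul_le_mul_of_nonneg_left (hB₂ z hz) hδ0
    have h3 := sum_primes_inv_sq_le (goodPrimes P z) fun p hp => (mem_goodPrimes.1 hp).1.2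
    linarith

end

theorem varpiA_le (a : ℤ) (n : ℕ) : varpiA a n ≤ 2 ^ n.primeFactors.card := by
  refine mul_le_of_le_one_right (by positivity) (Finset.prod_le_one (fun p _ => ?_) fun p _ => ?_)
  · linarith [neg_one_le_chiA a p]
  · linarith [chiA_le_one a p]

theorem exists_two_pow_card_primeFactors_le {κ : ℝ} (hκ : 0 < κ) :
    ∃ D : ℝ, 0 < D ∧ ∀ n : ℕ, n ≠ 0 → (2 : ℝ) ^ n.primeFactors.card ≤ D * (n : ℝ) ^ κ := by
  set K := ⌈(2 : ℝ) ^ (1 / κ)⌉₊ with hK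
  refine ⟨2 ^ K, by positivity, fun n hn => ?_⟩
  have h1 : ∀ p ∈ n.primeFactors, (2 : ℝ) ≤ (if p < K then 2 else 1) * (p : ℝ) ^ κ := by
    intro p hp
    have hp1 : (1 : ℝ) ≤ p := by exact_mod_cast (Nat.prime_of_mem_primeFactors hp).one_le
    split_ifs with h
    · linarith [Real.one_le_rpow hp1 hκ.le]
    · have h2 : (2 : ℝ) ^ (1 / κ) ≤ p := (Nat.le_ceil _).trans (by exact_mod_cast not_lt.1 h)
      have h3 := Real.rpow_le_rpow (by positivity) h2 hκ.le
      rw [← Real.rpow_mul (by norm_num), one_div_mul_cancel hκ.ne', Real.rpow_one] at h3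
      rwa [one_mul]
  have h2 : ∏ p ∈ n.primeFactors, (if p < K then (2 : ℝ) else 1) ≤ 2 ^ K := by
    rw [← Finset.prod_filter, Finset.prod_const]
    refine pow_le_pow_right₀ one_le_two ?_
    exact (Finset.card_le_card fun p hp => Finset.mem_range.2 (Finset.mem_filter.1 hp).2).trans_eq
      (Finset.card_range K)
  have h3 : ∏ p ∈ n.primeFactors, (p : ℝ) ^ κ ≤ (n : ℝ) ^ κ := by
    rw [Real.finsetProd_rpow _ _ fun p _ => Nat.cast_nonneg p, ← Nat.cast_prod]
    gcongr
    exact Nat.le_of_dvd (Nat.pos_of_ne_zero hn) (Nat.prod_primeFactors_dvd n)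
  calc (2 : ℝ) ^ n.primeFactors.card = ∏ p ∈ n.primeFactors, (2 : ℝ) := by rw [Finset.prod_const]
    _ ≤ ∏ p ∈ n.primeFactors, ((if p < K then 2 else 1) * (p : ℝ) ^ κ) :=
        Finset.prod_le_prod (fun _ _ => zero_le_two) h1
    _ ≤ 2 ^ K * (n : ℝ) ^ κ := by
        rw [Finset.prod_mul_distrib]
        gcongr

theorem natAbs_binQuartic_le (f : ℤ[X]) {V : ℝ} {u v : ℤ} (hu : |(u : ℝ)| ≤ V)
    (hv : |(v : ℝ)| ≤ V) : ((binQuartic f u v).natAbs : ℝ) ≤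
      (1 + ∑ i ∈ Finset.range 5, |(f.coeff i : ℝ)|) * V ^ 4 := by
  have hV : 0 ≤ V := (abs_nonneg _).trans hu
  rw [Nat.cast_natAbs, Int.cast_abs, binQuartic, Int.cast_sum]
  refine (Finset.abs_sum_le_sum_abs _ _).trans ?_
  rw [add_mul, one_mul, Finset.sum_mul]
  refine le_add_of_nonneg_of_le (by positivity) (Finset.sum_le_sum fun i hi => ?_)
  push_cast
  rw [abs_mul, abs_mul, abs_pow, abs_pow, mul_assoc]
  have h4 : i + (4 - i) = 4 := by
    have := Finset.mem_range.1 hi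
    omega
  calc |(f.coeff i : ℝ)| * (|(u : ℝ)| ^ i * |(v : ℝ)| ^ (4 - i))
      ≤ |(f.coeff i : ℝ)| * (V ^ i * V ^ (4 - i)) := by gcongr
    _ = |(f.coeff i : ℝ)| * V ^ 4 := by rw [← pow_add, h4]

theorem abs_intCast_le_iff {U : ℝ} (hU : 0 ≤ U) (u : ℤ) :
    |(u : ℝ)| ≤ U ↔ u ∈ Finset.Icc (-(⌊U⌋₊ : ℤ)) ⌊U⌋₊ := by
  rw [← Int.cast_abs, ← Nat.cast_natAbs, ← Nat.le_floor_iff hU, Finset.mem_Icc]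
  omega

theorem finsum_varpiA_eq (a : ℤ) (f : ℤ[X]) {U V : ℝ} (hU : 0 ≤ U) (hV : 0 ≤ V) :
    (∑ᶠ u ∈ {u : ℤ | (|u| : ℝ) ≤ U}, ∑ᶠ v ∈ {v : ℤ | (|v| : ℝ) ≤ V ∧ binQuartic f u v ≠ 0},
      varpiA a (binQuartic f u v).natAbs) =
    ∑ x ∈ intBox ⌊U⌋₊ ⌊V⌋₊ with binQuartic f x.1 x.2 ≠ 0 ∧ varpiA a (binQuartic f x.1 x.2).natAbs ≠ 0,
      varpiA a (binQuartic f x.1 x.2).natAbs := by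
  have hu : {u : ℤ | (|u| : ℝ) ≤ U} = ↑(Finset.Icc (-(⌊U⌋₊ : ℤ)) ⌊U⌋₊) := by
    ext u
    exact abs_intCast_le_iff hU u
  have hv : ∀ u, {v : ℤ | (|v| : ℝ) ≤ V ∧ binQuartic f u v ≠ 0} =
      ↑((Finset.Icc (-(⌊V⌋₊ : ℤ)) ⌊V⌋₊).filter fun v => binQuartic f u v ≠ 0) := by
    intro u
    ext v
    rw [Finset.mem_coe, Finset.mem_filter, ← abs_intCast_le_iff hV]
    rfl
  simp only [hu, hv, finsum_mem_coe_finset]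
  rw [← Finset.filter_filter, Finset.sum_filter_ne_zero, Finset.sum_filter, intBox,
    Finset.sum_product]
  simp only [Finset.sum_filter]

/-- The bound for `U ≤ c V^{ε/2}`. -/
theorem exists_sum_varpiA_le_of_le_rpow (a : ℤ) (f : ℤ[X]) {ε : ℝ} (hε : 0 < ε) (c : ℝ) :
    ∃ C' : ℝ, 0 ≤ C' ∧ ∀ U V : ℝ, 1 ≤ U → U ≤ V → U ≤ c * V ^ (ε / 2) →
      ∑ x ∈ intBox ⌊U⌋₊ ⌊V⌋₊ with binQuartic f x.1 x.2 ≠ 0 ∧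
        varpiA a (binQuartic f x.1 x.2).natAbs ≠ 0, varpiA a (binQuartic f x.1 x.2).natAbs
        ≤ C' * V ^ (1 + ε) := by
  obtain ⟨D, hD0, hD⟩ := exists_two_pow_card_primeFactors_le (κ := ε / 8) (by positivity)
  set S := 1 + ∑ i ∈ Finset.range 5, |(f.coeff i : ℝ)| with hS
  have hS0 : 0 ≤ S := by positivity
  refine ⟨9 * |c| * D * S ^ (ε / 8), by positivity, fun U V hU hUV hUc => ?_⟩
  have hV0 : 0 < V := by linarith
  have hw : ∀ x ∈ {x ∈ intBox ⌊U⌋₊ ⌊V⌋₊ | binQuartic f x.1 x.2 ≠ 0 ∧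
      varpiA a (binQuartic f x.1 x.2).natAbs ≠ 0}, varpiA a (binQuartic f x.1 x.2).natAbs ≤
        D * (S ^ (ε / 8) * V ^ (ε / 2)) := by
    intro x hx
    obtain ⟨hx, hx0, -⟩ := Finset.mem_filter.1 hx
    obtain ⟨h1, h2⟩ := Finset.mem_product.1 hx
    refine (varpiA_le _ _).trans ((hD _ (Int.natAbs_ne_zero.2 hx0)).trans ?_)
    have h3 := natAbs_binQuartic_le f (((abs_intCast_le_iff (by linarith) _).2 h1).trans hUV)
      ((abs_intCast_le_iff (by linarith) _).2 h2)
    have h4 : (V ^ 4) ^ (ε / 8) = V ^ (ε / 2) := by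
      rw [← Real.rpow_natCast, ← Real.rpow_mul hV0.le]
      congr 1
      push_cast
      ring
    rw [← h4, ← Real.mul_rpow hS0 (by positivity)]
    gcongr
  have hcard : (({x ∈ intBox ⌊U⌋₊ ⌊V⌋₊ | binQuartic f x.1 x.2 ≠ 0 ∧
      varpiA a (binQuartic f x.1 x.2).natAbs ≠ 0}).card : ℝ) ≤ (3 * U) * (3 * V) := by
    refine le_trans (Nat.cast_le.2 (Finset.card_filter_le _ _)) ?_
    rw [card_intBox]
    push_cast
    have h1 := Nat.floor_le (by linarith : 0 ≤ U)
    have h2 := Nat.floor_le hV0.le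
    gcongr <;> linarith
  have h1 := Finset.sum_le_card_nsmul _ _ _ hw
  rw [nsmul_eq_mul] at h1
  refine h1.trans ?_
  have h5 : U ≤ |c| * V ^ (ε / 2) := hUc.trans (by gcongr; exact le_abs_self c)
  have h6 : V ^ (1 + ε) = V ^ (ε / 2) * V * V ^ (ε / 2) := by
    rw [show 1 + ε = ε / 2 + 1 + ε / 2 by ring, Real.rpow_add hV0, Real.rpow_add hV0, Real.rpow_one]
  calc _ ≤ (3 * U) * (3 * V) * (D * (S ^ (ε / 8) * V ^ (ε / 2))) := by gcongr
    _ ≤ (3 * (|c| * V ^ (ε / 2))) * (3 * V) * (D * (S ^ (ε / 8) * V ^ (ε / 2))) := by gcongr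
    _ = _ := by rw [h6]; ring

/-- The bound for `U` larger than a constant and than `V^{ε/2}`. -/
theorem exists_sum_varpiA_le_of_rpow_le {ι : Type*} [Fintype ι] {a : ℤ} (ha : ¬ IsSquare a)
    {f : ℤ[X]} (hdeg : f.natDegree = 3 ∨ f.natDegree = 4)
    (hsf : Squarefree (f.map (Int.castRingHom ℚ)))
    {c : ℚ} {g : ι → ℚ[X]} (hirr : ∀ i, Irreducible (g i))
    (hfac : f.map (Int.castRingHom ℚ) = C c * ∏ i, g i) {ε : ℝ} (hε : 0 < ε) :
    ∃ C' : ℝ, 0 < C' ∧ ∃ M₀ : ℕ, ∀ U V : ℝ, M₀ ≤ ⌊U⌋₊ → U ≤ V → V ^ (ε / 2) ≤ ⌊U⌋₊ →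
      ∑ x ∈ intBox ⌊U⌋₊ ⌊V⌋₊ with binQuartic f x.1 x.2 ≠ 0 ∧
        varpiA a (binQuartic f x.1 x.2).natAbs ≠ 0, varpiA a (binQuartic f x.1 x.2).natAbs
        ≤ C' * (U * V * (1 + Real.log V) ^ Nat.card {i // IsSquare (a : AdjoinRoot (g i))}) := by
  have ha0 : a ≠ 0 := by
    rintro rfl
    exact ha IsSquare.zero
  obtain ⟨P, C₀, haP, hP⟩ := exists_localDensities ha hdeg hsf hirr hfac
  set S := 1 + ∑ i ∈ Finset.range 5, |(f.coeff i : ℝ)| with hS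
  have hS1 : 1 ≤ S := by
    rw [hS]
    exact le_add_of_nonneg_right (by positivity)
  have hlS := Real.log_nonneg hS1
  have hl2 : 0 < Real.log 2 := Real.log_pos one_lt_two
  obtain ⟨C', hC', M₀, h⟩ := hP.exists_sum_le (A := Real.log S / Real.log 2 + 8 / ε) (by positivity)
  refine ⟨C', hC', max M₀ 2, fun U V hM hUV hVU => ?_⟩
  have hM2 : 2 ≤ ⌊U⌋₊ := (le_max_right _ _).trans hM
  have hM2' : (2 : ℝ) ≤ ⌊U⌋₊ := by exact_mod_cast hM2
  have hU : (⌊U⌋₊ : ℝ) ≤ U := Nat.floor_le (Nat.pos_of_floor_pos (by omega)).le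
  have hU0 : 0 < U := by linarith
  have hV0 : 0 < V := by linarith
  have hV : (⌊V⌋₊ : ℝ) ≤ V := Nat.floor_le hV0.le
  have hlM : Real.log 2 ≤ Real.log ⌊U⌋₊ := Real.log_le_log two_pos hM2'
  have hlMV : Real.log ⌊U⌋₊ ≤ Real.log V := Real.log_le_log (by linarith) (by linarith)
  have hlV : ε / 2 * Real.log V ≤ Real.log ⌊U⌋₊ := by
    rw [← Real.log_rpow hV0]
    exact Real.log_le_log (by positivity) hVU
  refine (h ⌊U⌋₊ ⌊V⌋₊ ((le_max_left _ _).trans hM) (Nat.floor_le_floor hUV) _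
    (Finset.filter_subset _ _) _ ?_ ?_ ?_).trans ?_
  · intro x hx
    obtain ⟨hx, hx0, -⟩ := Finset.mem_filter.1 hx
    obtain ⟨h1, h2⟩ := Finset.mem_product.1 hx
    have h3 := natAbs_binQuartic_le f (((abs_intCast_le_iff (by linarith) _).2 h1).trans hUV)
      ((abs_intCast_le_iff (by linarith) _).2 h2)
    refine ⟨Int.natAbs_ne_zero.2 hx0, ?_⟩
    have h4 : (0 : ℝ) < (binQuartic f x.1 x.2).natAbs := by
      exact_mod_cast Int.natAbs_pos.2 hx0
    have h5 := Real.log_le_log h4 h3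
    rw [Real.log_mul (by linarith) (by positivity), Real.log_pow] at h5
    refine h5.trans ?_
    rw [add_mul]
    refine add_le_add ?_ ?_
    · rw [div_mul_eq_mul_div, le_div_iff₀ hl2]
      gcongr
    · rw [div_mul_eq_mul_div, le_div_iff₀ hε]
      push_cast
      linarith
  · exact fun x _ => varpiA_le _ _
  · intro x hx p hp hPp hpx
    obtain ⟨-, hx0, hx⟩ := Finset.mem_filter.1 hx
    exact splitInd_eq_one_of_varpiA_ne_zero ha0 (Int.natAbs_ne_zero.2 hx0) hx hp
      (hP.two_le.trans_lt hPp) (by omega) hpx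
  · gcongr

end

/-- Lemma 3: `Σ_{|u| ≤ U} Σ_{|v| ≤ V, F(u,v) ≠ 0} ϖ(|F(u,v)|) ≪_ε U V (1 + log V)^{ρ-2} + V^{1+ε}`
for `V ≥ U ≥ 1`. -/
theorem weighted_sum_bound
    (a : ℤ) (ha : ¬ IsSquare a)
    (f : Polynomial ℤ) (hdeg : f.natDegree = 3 ∨ f.natDegree = 4)
    (hsf : Squarefree (f.map (Int.castRingHom ℚ)))
    (c : ℚ) (r : ℕ) (fi : Fin r → Polynomial ℚ)
    (hmonic : ∀ i, (fi i).Monic) (hirr : ∀ i, Irreducible (fi i))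
    (hfac : f.map (Int.castRingHom ℚ) = Polynomial.C c * ∏ i, fi i)
    (ρ : ℕ) (hρ : ρ = 2 + Nat.card {i : Fin r // IsSquare ((a : AdjoinRoot (fi i)))}) :
    ∀ ε : ℝ, 0 < ε → ∃ C : ℝ, 0 < C ∧ ∀ U V : ℝ, 1 ≤ U → U ≤ V →
      (∑ᶠ u ∈ {u : ℤ | (|u| : ℝ) ≤ U},
        ∑ᶠ v ∈ {v : ℤ | (|v| : ℝ) ≤ V ∧ binQuartic f u v ≠ 0},
          varpiA a (binQuartic f u v).natAbs)
        ≤ C * (U * V * (1 + Real.log V) ^ (ρ - 2) + V ^ (1 + ε)) := by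
  intro ε hε
  obtain ⟨C₁, hC₁, M₀, h₁⟩ := exists_sum_varpiA_le_of_rpow_le ha hdeg hsf hirr hfac hε
  obtain ⟨C₂, hC₂, h₂⟩ := exists_sum_varpiA_le_of_le_rpow a f hε (M₀ + 2)
  refine ⟨C₁ + C₂, by positivity, fun U V hU hUV => ?_⟩
  have hV : 1 ≤ V := hU.trans hUV
  have hlV := Real.log_nonneg hV
  have hmain : 0 ≤ U * V * (1 + Real.log V) ^ (ρ - 2) := by positivity
  have herr : 0 ≤ V ^ (1 + ε) := by positivity
  rw [finsum_varpiA_eq a f (by linarith) (by linarith)]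
  by_cases h : M₀ ≤ ⌊U⌋₊ ∧ V ^ (ε / 2) ≤ ⌊U⌋₊
  · have h3 := h₁ U V h.1 hUV h.2
    rw [hρ, Nat.add_sub_cancel_left] at hmain ⊢
    refine h3.trans ?_
    rw [add_mul, mul_add, mul_add]
    linarith [mul_nonneg hC₁.le herr, mul_nonneg hC₂ hmain, mul_nonneg hC₂ herr]
  · have h3 := h₂ U V hU hUV ?_
    · refine h3.trans ?_
      rw [add_mul, mul_add, mul_add]
      linarith [mul_nonneg hC₁.le herr, mul_nonneg hC₁.le hmain, mul_nonneg hC₂ hmain]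
    · have h4 : 1 ≤ V ^ (ε / 2) := Real.one_le_rpow hV (by positivity)
      have h5 := Nat.lt_floor_add_one U
      have h6 : (0 : ℝ) ≤ M₀ := Nat.cast_nonneg _
      rcases not_and_or.1 h with h | h
      · have h7 : (⌊U⌋₊ : ℝ) ≤ M₀ := by exact_mod_cast (not_le.1 h).le
        nlinarith
      · nlinarith
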